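/- arXiv:2003.06275 — 5 statements merged into one kernel-verified Lean document; each statement's English description precedes it below -/
import Mathlib

section
/- Let q be an odd prime power and let F = F_q. Then the number of K-equivalence classes of 2-dimensional F-subspaces of Sym₃(F) is exactly 15. (Equivalently: there are exactly 15 orbits of lines in PG(5,q) under the action of PGL(3,q) ≤ PGL(6,q).) -/
open Matrix

/-- Two subspaces `W`, `W'` of the space of `3 × 3` matrices over `F` are `K`-equivalent
if `W' = {A * M * Aᵀ : M ∈ W}` for some invertible matrix `A`. -/
def KEquiv (F : Type*) [Field F] (W W' : Submodule F (Matrix (Fin 3) (Fin 3) F)) : Prop :=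
  ∃ A : Matrix (Fin 3) (Fin 3) F, IsUnit A ∧
    (W' : Set (Matrix (Fin 3) (Fin 3) F)) = (fun M => A * M * Aᵀ) '' (W : Set (Matrix (Fin 3) (Fin 3) F))

section Pencils

variable {F : Type*} [Field F]

namespace KEquiv

theorem refl (W : Submodule F (Matrix (Fin 3) (Fin 3) F)) : KEquiv F W W :=
  ⟨1, isUnit_one, by simp⟩

theorem trans {W₁ W₂ W₃ : Submodule F (Matrix (Fin 3) (Fin 3) F)}
    (h₁ : KEquiv F W₁ W₂) (h₂ : KEquiv F W₂ W₃) : KEquiv F W₁ W₃ := by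
  obtain ⟨A, hA, h₁⟩ := h₁
  obtain ⟨B, hB, h₂⟩ := h₂
  refine ⟨B * A, hB.mul hA, ?_⟩
  rw [h₂, h₁, Set.image_image]
  simp only [Matrix.transpose_mul, Matrix.mul_assoc]

end KEquiv

/-- The congruence action of a matrix, as a linear map. -/
def congruence (A : Matrix (Fin 3) (Fin 3) F) :
    Matrix (Fin 3) (Fin 3) F →ₗ[F] Matrix (Fin 3) (Fin 3) F :=
  LinearMap.mulRight F Aᵀ ∘ₗ LinearMap.mulLeft F A

@[simp]
theorem congruence_apply (A M : Matrix (Fin 3) (Fin 3) F) : congruence A M = A * M * Aᵀ := rfl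

theorem congruence_injective {A : Matrix (Fin 3) (Fin 3) F} (hA : IsUnit A) :
    Function.Injective (congruence A) := by
  intro M N h
  simp only [congruence_apply] at h
  have hAt : IsUnit Aᵀ := (Matrix.isUnit_transpose A).2 hA
  exact hA.mul_left_cancel (hAt.mul_right_cancel h)

theorem kEquiv_iff_map {W W' : Submodule F (Matrix (Fin 3) (Fin 3) F)} :
    KEquiv F W W' ↔ ∃ A, IsUnit A ∧ W' = W.map (congruence A) := by
  refine exists_congr fun A => and_congr_right fun _ => ?_
  exact SetLike.coe_set_eq (q := W.map (congruence A))

/-- A congruence mapping a subspace into one of the same dimension is a `K`-equivalence. -/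
theorem kEquiv_of_mapsTo {W W' : Submodule F (Matrix (Fin 3) (Fin 3) F)}
    {A : Matrix (Fin 3) (Fin 3) F} (hA : IsUnit A) (h : ∀ M ∈ W, A * M * Aᵀ ∈ W')
    (hdim : Module.finrank F W = Module.finrank F W') : KEquiv F W W' := by
  rw [kEquiv_iff_map]
  refine ⟨A, hA, (Submodule.eq_of_le_of_finrank_eq ?_ ?_).symm⟩
  · rintro _ ⟨M, hM, rfl⟩
    exact h M hM
  · rw [← hdim]
    exact ((W.equivMapOfInjective _ (congruence_injective hA)).finrank_eq).symm

/-- The subspace spanned by two matrices. -/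
abbrev pencil (M N : Matrix (Fin 3) (Fin 3) F) : Submodule F (Matrix (Fin 3) (Fin 3) F) :=
  Submodule.span F {M, N}

theorem KEquiv.pencil {M₁ M₂ N₁ N₂ : Matrix (Fin 3) (Fin 3) F} (A : Matrix (Fin 3) (Fin 3) F)
    (p q r s : F) (hA : A.det ≠ 0) (h : p * s - q * r ≠ 0)
    (h₁ : A * M₁ * Aᵀ = p • N₁ + q • N₂) (h₂ : A * M₂ * Aᵀ = r • N₁ + s • N₂) :
    KEquiv F (pencil M₁ M₂) (pencil N₁ N₂) := by
  rw [kEquiv_iff_map]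
  refine ⟨A, (Matrix.isUnit_iff_isUnit_det A).2 hA.isUnit, ?_⟩
  rw [_root_.pencil, _root_.pencil, Submodule.map_span, Set.image_pair, congruence_apply,
    congruence_apply, h₁, h₂]
  apply le_antisymm
  · rw [Submodule.span_le, Set.pair_subset_iff]
    simp only [SetLike.mem_coe, Submodule.mem_span_pair]
    obtain ⟨d, hd⟩ : ∃ d, d * (p * s - q * r) = 1 := ⟨_, inv_mul_cancel₀ h⟩
    refine ⟨⟨d * s, -(d * q), ?_⟩, ⟨-(d * r), d * p, ?_⟩⟩
    · ext i j
      simp only [Matrix.add_apply, Matrix.smul_apply, smul_eq_mul]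
      linear_combination N₁ i j * hd
    · ext i j
      simp only [Matrix.add_apply, Matrix.smul_apply, smul_eq_mul]
      linear_combination N₂ i j * hd
  · rw [Submodule.span_le, Set.pair_subset_iff]
    simp only [SetLike.mem_coe, Submodule.mem_span_pair]
    exact ⟨⟨p, q, rfl⟩, ⟨r, s, rfl⟩⟩

/-- The symmetric matrix with the given upper triangle. -/
def symMat (a b c d e f : F) : Matrix (Fin 3) (Fin 3) F := !![a, b, c; b, d, e; c, e, f]

theorem symMat_isSymm {R : Type*} (a b c d e f : R) : (symMat a b c d e f).IsSymm := by
  ext i j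
  fin_cases i <;> fin_cases j <;> rfl

theorem Matrix.IsSymm.exists_eq_symMat {R : Type*} {M : Matrix (Fin 3) (Fin 3) R} (hM : M.IsSymm) :
    ∃ a b c d e f, M = symMat a b c d e f := by
  refine ⟨M 0 0, M 0 1, M 0 2, M 1 1, M 1 2, M 2 2, ?_⟩
  ext i j
  fin_cases i <;> fin_cases j <;> first | rfl | exact hM.apply _ _

theorem symMat_inj {R : Type*} {a b c d e f a' b' c' d' e' f' : R} :
    symMat a b c d e f = symMat a' b' c' d' e' f' ↔
      a = a' ∧ b = b' ∧ c = c' ∧ d = d' ∧ e = e' ∧ f = f' := by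
  constructor
  · intro h
    exact ⟨congrFun (congrFun h 0) 0, congrFun (congrFun h 0) 1, congrFun (congrFun h 0) 2,
      congrFun (congrFun h 1) 1, congrFun (congrFun h 1) 2, congrFun (congrFun h 2) 2⟩
  · rintro ⟨rfl, rfl, rfl, rfl, rfl, rfl⟩
    rfl

theorem symMat_add (a b c d e f a' b' c' d' e' f' : F) :
    symMat a b c d e f + symMat a' b' c' d' e' f' =
      symMat (a + a') (b + b') (c + c') (d + d') (e + e') (f + f') := by
  simp [symMat]

theorem smul_symMat (t a b c d e f : F) :
    t • symMat a b c d e f = symMat (t * a) (t * b) (t * c) (t * d) (t * e) (t * f) := by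
  simp [symMat]

theorem symMat_zero : symMat (0 : F) 0 0 0 0 0 = 0 := by
  ext i j
  fin_cases i <;> fin_cases j <;> rfl

theorem symMat_eq_zero {a b c d e f : F} :
    symMat a b c d e f = 0 ↔ a = 0 ∧ b = 0 ∧ c = 0 ∧ d = 0 ∧ e = 0 ∧ f = 0 := by
  rw [← symMat_zero, symMat_inj]

theorem det_symMat (a b c d e f : F) :
    (symMat a b c d e f).det =
      a * d * f - a * e ^ 2 - b ^ 2 * f + 2 * b * c * e - c ^ 2 * d := by
  simp [symMat, Matrix.det_fin_three]
  ring

theorem adjugate_symMat (a b c d e f : F) :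
    (symMat a b c d e f).adjugate =
      symMat (d * f - e ^ 2) (c * e - b * f) (b * e - c * d) (a * f - c ^ 2) (b * c - a * e)
        (a * d - b ^ 2) := by
  simp only [symMat, Matrix.adjugate_fin_three_of]
  ext i j
  fin_cases i <;> fin_cases j <;> simp <;> ring

theorem vecMulVec_eq_symMat (x y z : F) :
    Matrix.vecMulVec ![x, y, z] ![x, y, z] =
      symMat (x ^ 2) (x * y) (x * z) (y ^ 2) (y * z) (z ^ 2) := by
  ext i j
  fin_cases i <;> fin_cases j <;> simp [symMat, Matrix.vecMulVec_apply] <;> ring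

theorem congruence_symMat (x₁ x₂ x₃ y₁ y₂ y₃ z₁ z₂ z₃ a b c d e f : F) :
    !![x₁, x₂, x₃; y₁, y₂, y₃; z₁, z₂, z₃] * symMat a b c d e f *
        !![x₁, x₂, x₃; y₁, y₂, y₃; z₁, z₂, z₃]ᵀ =
      symMat
        (a * x₁ ^ 2 + d * x₂ ^ 2 + f * x₃ ^ 2 + 2 * b * x₁ * x₂ + 2 * c * x₁ * x₃ + 2 * e * x₂ * x₃)
        (a * x₁ * y₁ + d * x₂ * y₂ + f * x₃ * y₃ + b * (x₁ * y₂ + x₂ * y₁)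
          + c * (x₁ * y₃ + x₃ * y₁) + e * (x₂ * y₃ + x₃ * y₂))
        (a * x₁ * z₁ + d * x₂ * z₂ + f * x₃ * z₃ + b * (x₁ * z₂ + x₂ * z₁)
          + c * (x₁ * z₃ + x₃ * z₁) + e * (x₂ * z₃ + x₃ * z₂))
        (a * y₁ ^ 2 + d * y₂ ^ 2 + f * y₃ ^ 2 + 2 * b * y₁ * y₂ + 2 * c * y₁ * y₃ + 2 * e * y₂ * y₃)
        (a * y₁ * z₁ + d * y₂ * z₂ + f * y₃ * z₃ + b * (y₁ * z₂ + y₂ * z₁)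
          + c * (y₁ * z₃ + y₃ * z₁) + e * (y₂ * z₃ + y₃ * z₂))
        (a * z₁ ^ 2 + d * z₂ ^ 2 + f * z₃ ^ 2 + 2 * b * z₁ * z₂ + 2 * c * z₁ * z₃
          + 2 * e * z₂ * z₃) := by
  ext i j
  fin_cases i <;> fin_cases j <;>
    simp [symMat, Matrix.mul_apply, Fin.sum_univ_three] <;> ring

/-! ### Invariants of subspaces under congruence -/

/-- The subspace contains a matrix of rank one. -/
def HasRankOne (W : Submodule F (Matrix (Fin 3) (Fin 3) F)) : Prop :=
  ∃ M ∈ W, M ≠ 0 ∧ M.adjugate = 0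

/-- All matrices in the subspace are singular. -/
def IsSingularSpace (W : Submodule F (Matrix (Fin 3) (Fin 3) F)) : Prop :=
  ∀ M ∈ W, M.det = 0

/-- The subspace contains a matrix of rank two whose adjugate is `-t` times a nonzero square:
for `t = 1` this is a hyperbolic form on its support, for `t` a nonsquare an elliptic one. -/
def HasType (t : F) (W : Submodule F (Matrix (Fin 3) (Fin 3) F)) : Prop :=
  ∃ M ∈ W, ∃ k : Fin 3 → F, k ≠ 0 ∧ M.adjugate = (-t) • Matrix.vecMulVec k k

/-- The determinant restricted to the subspace has a singular zero. -/
def HasDoubleRoot (W : Submodule F (Matrix (Fin 3) (Fin 3) F)) : Prop :=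
  ∃ M ∈ W, M ≠ 0 ∧ M.det = 0 ∧ ∀ N ∈ W, (M.adjugate * N).trace = 0

/-- All singular matrices in the subspace are proportional. -/
def SingularProportional (W : Submodule F (Matrix (Fin 3) (Fin 3) F)) : Prop :=
  ∃ M : Matrix (Fin 3) (Fin 3) F, ∀ N ∈ W, N.det = 0 → ∃ t : F, N = t • M

theorem KEquiv.symm {W W' : Submodule F (Matrix (Fin 3) (Fin 3) F)} (h : KEquiv F W W') :
    KEquiv F W' W := by
  obtain ⟨A, hA, rfl⟩ := kEquiv_iff_map.1 h
  have hdet := (Matrix.isUnit_iff_isUnit_det A).1 hA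
  have hcomp : (congruence A⁻¹) ∘ₗ (congruence A) = LinearMap.id := by
    ext1 M
    simp only [LinearMap.comp_apply, congruence_apply, LinearMap.id_apply, ← Matrix.mul_assoc]
    rw [Matrix.nonsing_inv_mul A hdet, Matrix.one_mul, Matrix.mul_assoc, ← Matrix.transpose_mul,
      Matrix.nonsing_inv_mul A hdet, Matrix.transpose_one, Matrix.mul_one]
  refine kEquiv_iff_map.2 ⟨A⁻¹, (Matrix.isUnit_nonsing_inv_iff).2 hA, ?_⟩
  rw [← Submodule.map_comp, hcomp, Submodule.map_id]

theorem adjugate_congruence (A M : Matrix (Fin 3) (Fin 3) F) :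
    (A * M * Aᵀ).adjugate = A.adjugateᵀ * M.adjugate * A.adjugate := by
  rw [Matrix.adjugate_mul_distrib, Matrix.adjugate_mul_distrib, ← Matrix.adjugate_transpose,
    Matrix.mul_assoc]

theorem det_congruence (A M : Matrix (Fin 3) (Fin 3) F) :
    (A * M * Aᵀ).det = A.det ^ 2 * M.det := by
  rw [Matrix.det_mul, Matrix.det_mul, Matrix.det_transpose]
  ring

theorem trace_adjugate_congruence (A M N : Matrix (Fin 3) (Fin 3) F) :
    ((A * M * Aᵀ).adjugate * (A * N * Aᵀ)).trace = A.det ^ 2 * (M.adjugate * N).trace := by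
  have h : A.adjugateᵀ * M.adjugate * A.adjugate * (A * N * Aᵀ) =
      A.adjugateᵀ * (M.adjugate * (A.adjugate * A) * N * Aᵀ) := by
    simp only [Matrix.mul_assoc]
  rw [adjugate_congruence, h, Matrix.trace_mul_comm, Matrix.adjugate_mul]
  have h' : M.adjugate * (A.det • 1) * N * Aᵀ * A.adjugateᵀ =
      A.det • (M.adjugate * N * (A.adjugate * A)ᵀ) := by
    simp only [Matrix.transpose_mul, Matrix.mul_assoc, Matrix.smul_mul, Matrix.mul_smul,
      Matrix.one_mul]
  rw [h', Matrix.adjugate_mul]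
  simp
  ring

section Congr

variable {W W' : Submodule F (Matrix (Fin 3) (Fin 3) F)}

theorem HasRankOne.congr (h : KEquiv F W W') (hW : HasRankOne W) : HasRankOne W' := by
  obtain ⟨A, hA, rfl⟩ := kEquiv_iff_map.1 h
  obtain ⟨M, hM, h0, hadj⟩ := hW
  refine ⟨_, Submodule.mem_map_of_mem hM, ?_, ?_⟩
  · simpa using (congruence_injective hA).ne h0
  · simp [adjugate_congruence, hadj]

theorem IsSingularSpace.congr (h : KEquiv F W W') (hW : IsSingularSpace W) :
    IsSingularSpace W' := by
  obtain ⟨A, hA, rfl⟩ := kEquiv_iff_map.1 h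
  rintro _ ⟨M, hM, rfl⟩
  rw [congruence_apply, det_congruence, hW M hM, mul_zero]

theorem HasType.congr {t : F} (h : KEquiv F W W') (hW : HasType t W) : HasType t W' := by
  obtain ⟨A, hA, rfl⟩ := kEquiv_iff_map.1 h
  obtain ⟨M, hM, k, hk, hadj⟩ := hW
  have hdet := ((Matrix.isUnit_iff_isUnit_det A).1 hA).ne_zero
  refine ⟨_, Submodule.mem_map_of_mem hM, A.adjugateᵀ *ᵥ k, fun h0 => hk ?_, ?_⟩
  · refine Matrix.eq_zero_of_mulVec_eq_zero ?_ h0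
    rw [Matrix.det_transpose, Matrix.det_adjugate]
    exact pow_ne_zero _ hdet
  · rw [congruence_apply, adjugate_congruence, hadj, Matrix.mul_smul, Matrix.smul_mul,
      Matrix.mul_vecMulVec, Matrix.vecMulVec_mul, Matrix.mulVec_transpose]

theorem HasDoubleRoot.congr (h : KEquiv F W W') (hW : HasDoubleRoot W) : HasDoubleRoot W' := by
  obtain ⟨A, hA, rfl⟩ := kEquiv_iff_map.1 h
  obtain ⟨M, hM, h0, hdet, htr⟩ := hW
  refine ⟨_, Submodule.mem_map_of_mem hM, ?_, ?_, ?_⟩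
  · simpa using (congruence_injective hA).ne h0
  · rw [congruence_apply, det_congruence, hdet, mul_zero]
  · rintro _ ⟨N, hN, rfl⟩
    rw [congruence_apply, congruence_apply, trace_adjugate_congruence, htr N hN, mul_zero]

theorem SingularProportional.congr (h : KEquiv F W W') (hW : SingularProportional W) :
    SingularProportional W' := by
  obtain ⟨A, hA, rfl⟩ := kEquiv_iff_map.1 h
  obtain ⟨M, hM⟩ := hW
  have hdet := ((Matrix.isUnit_iff_isUnit_det A).1 hA).ne_zero
  refine ⟨congruence A M, ?_⟩
  rintro _ ⟨N, hN, rfl⟩ h0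
  rw [congruence_apply, det_congruence] at h0
  obtain ⟨t, rfl⟩ := hM N hN ((mul_eq_zero.1 h0).resolve_left (pow_ne_zero _ hdet))
  exact ⟨t, map_smul _ _ _⟩

end Congr

open Classical in
/-- A `K`-equivalence invariant taking fifteen values. -/
noncomputable def lineIndex (ε : F) (W : Submodule F (Matrix (Fin 3) (Fin 3) F)) : Fin 15 :=
  if HasRankOne W then
    if IsSingularSpace W then
      if HasType ε W then 0 else 1
    else if HasType 1 W then 2 else if HasType ε W then 3 else 4
  else if IsSingularSpace W then
    if HasType ε W then 5 else 6
  else if HasType 1 W then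
    if HasType ε W then
      if HasDoubleRoot W then 8 else 10
    else if HasDoubleRoot W then
      if SingularProportional W then 13 else 7
    else if SingularProportional W then 11 else 9
  else if HasType ε W then 12 else 14

theorem lineIndex_congr {ε : F} {W W' : Submodule F (Matrix (Fin 3) (Fin 3) F)}
    (h : KEquiv F W W') : lineIndex ε W = lineIndex ε W' := by
  have h₁ : HasRankOne W ↔ HasRankOne W' := ⟨.congr h, .congr h.symm⟩
  have h₂ : IsSingularSpace W ↔ IsSingularSpace W' := ⟨.congr h, .congr h.symm⟩
  have h₃ (t : F) : HasType t W ↔ HasType t W' := ⟨.congr h, .congr h.symm⟩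
  have h₄ : HasDoubleRoot W ↔ HasDoubleRoot W' := ⟨.congr h, .congr h.symm⟩
  have h₅ : SingularProportional W ↔ SingularProportional W' := ⟨.congr h, .congr h.symm⟩
  unfold lineIndex
  rw [propext h₁, propext h₂, propext (h₃ ε), propext (h₃ 1), propext h₄, propext h₅]

theorem mem_pencil_symMat {M : Matrix (Fin 3) (Fin 3) F} {a b c d e f a' b' c' d' e' f' : F} :
    M ∈ pencil (symMat a b c d e f) (symMat a' b' c' d' e' f') ↔
      ∃ x y : F, symMat (x * a + y * a') (x * b + y * b') (x * c + y * c') (x * d + y * d')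
        (x * e + y * e') (x * f + y * f') = M := by
  simp only [pencil, Submodule.mem_span_pair, smul_symMat, symMat_add]

section Invariants

variable {a b c d e f a' b' c' d' e' f' : F}

theorem hasRankOne_pencil :
    HasRankOne (pencil (symMat a b c d e f) (symMat a' b' c' d' e' f')) ↔ ∃ x y : F,
      symMat (x * a + y * a') (x * b + y * b') (x * c + y * c') (x * d + y * d')
        (x * e + y * e') (x * f + y * f') ≠ 0 ∧
      (symMat (x * a + y * a') (x * b + y * b') (x * c + y * c') (x * d + y * d')
        (x * e + y * e') (x * f + y * f')).adjugate = 0 := by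
  simp only [HasRankOne, mem_pencil_symMat]
  exact ⟨fun ⟨_, ⟨x, y, h⟩, h'⟩ => ⟨x, y, h ▸ h'⟩, fun ⟨x, y, h⟩ => ⟨_, ⟨x, y, rfl⟩, h⟩⟩

theorem isSingularSpace_pencil :
    IsSingularSpace (pencil (symMat a b c d e f) (symMat a' b' c' d' e' f')) ↔ ∀ x y : F,
      (symMat (x * a + y * a') (x * b + y * b') (x * c + y * c') (x * d + y * d')
        (x * e + y * e') (x * f + y * f')).det = 0 := by
  simp only [IsSingularSpace, mem_pencil_symMat]
  exact ⟨fun h x y => h _ ⟨x, y, rfl⟩, fun h _ ⟨x, y, h'⟩ => h' ▸ h x y⟩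

theorem hasType_pencil {t : F} :
    HasType t (pencil (symMat a b c d e f) (symMat a' b' c' d' e' f')) ↔ ∃ x y k₁ k₂ k₃ : F,
      ¬(k₁ = 0 ∧ k₂ = 0 ∧ k₃ = 0) ∧
      (symMat (x * a + y * a') (x * b + y * b') (x * c + y * c') (x * d + y * d')
        (x * e + y * e') (x * f + y * f')).adjugate =
        symMat (-t * k₁ ^ 2) (-t * (k₁ * k₂)) (-t * (k₁ * k₃)) (-t * k₂ ^ 2) (-t * (k₂ * k₃))
          (-t * k₃ ^ 2) := by
  simp only [HasType, mem_pencil_symMat, ← smul_symMat, ← vecMulVec_eq_symMat]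
  constructor
  · rintro ⟨_, ⟨x, y, rfl⟩, k, hk, h⟩
    have hk' : k = ![k 0, k 1, k 2] := by
      ext i
      fin_cases i <;> rfl
    refine ⟨x, y, k 0, k 1, k 2, fun h0 => hk ?_, by rwa [← hk']⟩
    rw [hk', h0.1, h0.2.1, h0.2.2]
    simp
  · rintro ⟨x, y, k₁, k₂, k₃, hk, h⟩
    refine ⟨_, ⟨x, y, rfl⟩, ![k₁, k₂, k₃], fun h0 => hk ?_, h⟩
    exact ⟨congrFun h0 0, congrFun h0 1, congrFun h0 2⟩

theorem trace_symMat_mul :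
    (symMat a b c d e f * symMat a' b' c' d' e' f').trace =
      a * a' + d * d' + f * f' + 2 * (b * b' + c * c' + e * e') := by
  simp [symMat, Matrix.trace_fin_three]
  ring

theorem hasDoubleRoot_pencil :
    HasDoubleRoot (pencil (symMat a b c d e f) (symMat a' b' c' d' e' f')) ↔ ∃ x y : F,
      symMat (x * a + y * a') (x * b + y * b') (x * c + y * c') (x * d + y * d')
        (x * e + y * e') (x * f + y * f') ≠ 0 ∧
      (symMat (x * a + y * a') (x * b + y * b') (x * c + y * c') (x * d + y * d')
        (x * e + y * e') (x * f + y * f')).det = 0 ∧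
      ((symMat (x * a + y * a') (x * b + y * b') (x * c + y * c') (x * d + y * d')
        (x * e + y * e') (x * f + y * f')).adjugate * symMat a b c d e f).trace = 0 ∧
      ((symMat (x * a + y * a') (x * b + y * b') (x * c + y * c') (x * d + y * d')
        (x * e + y * e') (x * f + y * f')).adjugate * symMat a' b' c' d' e' f').trace = 0 := by
  constructor
  · rintro ⟨_, h, h0, hdet, htr⟩
    obtain ⟨x, y, rfl⟩ := mem_pencil_symMat.1 h
    exact ⟨x, y, h0, hdet, htr _ (Submodule.subset_span (by simp)),
      htr _ (Submodule.subset_span (by simp))⟩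
  · rintro ⟨x, y, h0, hdet, h₁, h₂⟩
    refine ⟨_, mem_pencil_symMat.2 ⟨x, y, rfl⟩, h0, hdet, fun N hN => ?_⟩
    obtain ⟨s, t, rfl⟩ := Submodule.mem_span_pair.1 hN
    simp only [Matrix.mul_add, Matrix.mul_smul, Matrix.trace_add, Matrix.trace_smul, h₁, h₂,
      smul_zero, add_zero]

theorem singularProportional_pencil
    (h : ∀ x y : F, (symMat (x * a + y * a') (x * b + y * b') (x * c + y * c') (x * d + y * d')
        (x * e + y * e') (x * f + y * f')).det = 0 → y = 0) :
    SingularProportional (pencil (symMat a b c d e f) (symMat a' b' c' d' e' f')) := by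
  refine ⟨symMat a b c d e f, fun N hN hdet => ?_⟩
  obtain ⟨x, y, rfl⟩ := mem_pencil_symMat.1 hN
  exact ⟨x, by simp [h x y hdet, smul_symMat]⟩

theorem not_singularProportional_pencil {x : F} (h₁ : (symMat a b c d e f).det = 0)
    (h₂ : (symMat (x * a + a') (x * b + b') (x * c + c') (x * d + d')
        (x * e + e') (x * f + f')).det = 0)
    (h : LinearIndependent F ![symMat a b c d e f, symMat a' b' c' d' e' f']) :
    ¬SingularProportional (pencil (symMat a b c d e f) (symMat a' b' c' d' e' f')) := by
  rintro ⟨M, hM⟩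
  obtain ⟨s, hs⟩ := hM _ (Submodule.subset_span (by simp)) h₁
  obtain ⟨t, ht⟩ := hM _ (mem_pencil_symMat.2 ⟨x, 1, rfl⟩) (by simpa using h₂)
  rw [← symMat_add, ← smul_symMat, ← smul_symMat, hs, one_smul] at ht
  rw [LinearIndependent.pair_iff] at h
  have hN : symMat a' b' c' d' e' f' = (t - x * s) • M := by
    rw [sub_smul, ← ht, mul_smul]
    abel
  obtain ⟨h1, h2⟩ := h (t - x * s) (-s) (by
    rw [hN, hs, smul_smul, smul_smul, ← add_smul]
    ring_nf
    simp)
  rw [neg_eq_zero] at h2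
  rw [h2, zero_smul] at hs
  exact one_ne_zero (h 1 0 (by rw [hs]; simp)).1

end Invariants

/-- Representatives of the orbits, where `ε` is a nonsquare, `ε * u ^ 2 - v ^ 2 = 1` and
`W₀` is a subspace without nonzero singular matrices. -/
def lineRep (ε u v : F) (W₀ : Submodule F (Matrix (Fin 3) (Fin 3) F)) :
    Fin 15 → Submodule F (Matrix (Fin 3) (Fin 3) F) := ![
  pencil (symMat 1 0 0 0 0 0) (symMat 0 0 0 1 0 0),
  pencil (symMat 1 0 0 0 0 0) (symMat 0 1 0 0 0 0),
  pencil (symMat 1 0 0 0 0 0) (symMat 0 0 0 0 1 0),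
  pencil (symMat 1 0 0 0 0 0) (symMat 0 0 0 1 0 (-ε)),
  pencil (symMat 1 0 0 0 0 0) (symMat 0 0 1 1 0 0),
  pencil (symMat 1 0 0 ε 0 0) (symMat 0 1 0 0 0 0),
  pencil (symMat 0 1 0 0 0 0) (symMat 0 0 1 0 0 0),
  pencil (symMat 0 1 0 0 0 0) (symMat (-1) 0 0 0 0 1),
  pencil (symMat 0 1 0 0 0 0) (symMat (-ε) 0 0 0 0 1),
  pencil (symMat 0 1 0 0 0 0) (symMat (-1) 0 0 (-1) 0 1),
  pencil (symMat 0 1 0 0 0 0) (symMat (-ε) 0 0 (-ε) 0 1),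
  pencil (symMat 0 1 0 0 0 0) (symMat (-1) 0 0 (-ε) 0 1),
  pencil (symMat 1 0 0 (-ε) 0 0) (symMat u v 0 (ε * u) 0 1),
  pencil (symMat 0 1 0 0 0 0) (symMat 0 0 1 1 0 0),
  W₀]

theorem linearIndependent_symMat {a b c d e f a' b' c' d' e' f' : F}
    (h : ∀ x y : F, x * a + y * a' = 0 → x * b + y * b' = 0 → x * c + y * c' = 0 →
      x * d + y * d' = 0 → x * e + y * e' = 0 → x * f + y * f' = 0 → x = 0 ∧ y = 0) :
    LinearIndependent F ![symMat a b c d e f, symMat a' b' c' d' e' f'] := by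
  rw [LinearIndependent.pair_iff]
  intro x y hxy
  rw [smul_symMat, smul_symMat, symMat_add, symMat_eq_zero] at hxy
  obtain ⟨h₁, h₂, h₃, h₄, h₅, h₆⟩ := hxy
  exact h x y h₁ h₂ h₃ h₄ h₅ h₆

theorem pencil_symMat_isSymm {a b c d e f a' b' c' d' e' f' : F} {M : Matrix (Fin 3) (Fin 3) F}
    (hM : M ∈ pencil (symMat a b c d e f) (symMat a' b' c' d' e' f')) : M.IsSymm := by
  obtain ⟨x, y, rfl⟩ := mem_pencil_symMat.1 hM
  exact symMat_isSymm _ _ _ _ _ _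

theorem finrank_pencil {M N : Matrix (Fin 3) (Fin 3) F} (h : LinearIndependent F ![M, N]) :
    Module.finrank F (pencil M N) = 2 := by
  have := finrank_span_eq_card h
  rwa [Matrix.range_cons_cons_empty, Fintype.card_fin] at this

theorem lineRep_isSymm {ε u v : F} {W₀ : Submodule F (Matrix (Fin 3) (Fin 3) F)}
    (hW₀ : ∀ M ∈ W₀, M.IsSymm) (i : Fin 15) : ∀ M ∈ lineRep ε u v W₀ i, M.IsSymm := by
  fin_cases i
  all_goals first | exact hW₀ | exact fun M hM => pencil_symMat_isSymm hM

theorem finrank_lineRep {ε u v : F} {W₀ : Submodule F (Matrix (Fin 3) (Fin 3) F)}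
    (hW₀ : Module.finrank F W₀ = 2) (i : Fin 15) :
    Module.finrank F (lineRep ε u v W₀ i) = 2 := by
  fin_cases i
  all_goals try exact hW₀
  all_goals
    refine finrank_pencil (linearIndependent_symMat fun x y => ?_)
    simp
    try grind

/-- Vanishing conditions on a pencil, phrased through coordinates of the adjugate. -/
theorem not_hasRankOne_pencil {a b c d e f a' b' c' d' e' f' : F}
    (h : ∀ x y : F, (symMat (x * a + y * a') (x * b + y * b') (x * c + y * c') (x * d + y * d')
        (x * e + y * e') (x * f + y * f')).adjugate = 0 → x = 0 ∧ y = 0) :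
    ¬HasRankOne (pencil (symMat a b c d e f) (symMat a' b' c' d' e' f')) := by
  rw [hasRankOne_pencil]
  rintro ⟨x, y, h0, hadj⟩
  obtain ⟨rfl, rfl⟩ := h x y hadj
  simp [symMat_zero] at h0

section Representatives

variable {ε : F}

theorem nonsquare_ne_zero (hε : ∀ x y : F, x ^ 2 = ε * y ^ 2 → x = 0 ∧ y = 0) : ε ≠ 0 := by
  rintro rfl
  exact one_ne_zero (hε 0 1 (by simp)).2

theorem hasRankOne_pencil_left {a b c d e f : F} :
    HasRankOne (pencil (symMat 1 0 0 0 0 0) (symMat a b c d e f)) :=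
  hasRankOne_pencil.2 ⟨1, 0, by simp [symMat_eq_zero], by simp [adjugate_symMat, symMat_zero]⟩

theorem hasType_one_pencil_left {a b c d e f : F} :
    HasType 1 (pencil (symMat 0 1 0 0 0 0) (symMat a b c d e f)) :=
  hasType_pencil.2 ⟨1, 0, 0, 0, 1, by simp, by simp [adjugate_symMat]⟩

theorem lineIndex_zero : lineIndex ε (pencil (symMat 1 0 0 0 0 0) (symMat 0 0 0 1 0 0)) = 0 := by
  have h₁ : IsSingularSpace (pencil (symMat (1 : F) 0 0 0 0 0) (symMat 0 0 0 1 0 0)) :=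
    isSingularSpace_pencil.2 fun x y => by simp [det_symMat]
  have h₂ : HasType ε (pencil (symMat 1 0 0 0 0 0) (symMat 0 0 0 1 0 0)) :=
    hasType_pencil.2 ⟨-ε, 1, 0, 0, 1, by simp, by simp [adjugate_symMat]⟩
  simp [lineIndex, hasRankOne_pencil_left, h₁, h₂]

theorem lineIndex_one (hε : ∀ x y : F, x ^ 2 = ε * y ^ 2 → x = 0 ∧ y = 0) :
    lineIndex ε (pencil (symMat 1 0 0 0 0 0) (symMat 0 1 0 0 0 0)) = 1 := by
  have h₁ : IsSingularSpace (pencil (symMat (1 : F) 0 0 0 0 0) (symMat 0 1 0 0 0 0)) :=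
    isSingularSpace_pencil.2 fun x y => by simp [det_symMat]
  have h₂ : ¬HasType ε (pencil (symMat 1 0 0 0 0 0) (symMat 0 1 0 0 0 0)) := by
    rw [hasType_pencil]
    rintro ⟨x, y, k₁, k₂, k₃, hk, h⟩
    have h0 := nonsquare_ne_zero hε
    have := hε y k₃
    simp [adjugate_symMat, symMat_inj] at h
    grind
  simp [lineIndex, hasRankOne_pencil_left, h₁, h₂]

theorem lineIndex_two : lineIndex ε (pencil (symMat 1 0 0 0 0 0) (symMat 0 0 0 0 1 0)) = 2 := by
  have h₁ : ¬IsSingularSpace (pencil (symMat (1 : F) 0 0 0 0 0) (symMat 0 0 0 0 1 0)) := by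
    rw [isSingularSpace_pencil]
    intro h
    simpa [det_symMat] using h 1 1
  have h₂ : HasType 1 (pencil (symMat (1 : F) 0 0 0 0 0) (symMat 0 0 0 0 1 0)) :=
    hasType_pencil.2 ⟨0, 1, 1, 0, 0, by simp, by simp [adjugate_symMat]⟩
  simp [lineIndex, hasRankOne_pencil_left, h₁, h₂]

theorem lineIndex_three (hε : ∀ x y : F, x ^ 2 = ε * y ^ 2 → x = 0 ∧ y = 0) :
    lineIndex ε (pencil (symMat 1 0 0 0 0 0) (symMat 0 0 0 1 0 (-ε))) = 3 := by
  have h0 := nonsquare_ne_zero hε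
  have h₁ : ¬IsSingularSpace (pencil (symMat 1 0 0 0 0 0) (symMat 0 0 0 1 0 (-ε))) := by
    rw [isSingularSpace_pencil]
    intro h
    simpa [det_symMat, h0] using h 1 1
  have h₂ : ¬HasType 1 (pencil (symMat 1 0 0 0 0 0) (symMat 0 0 0 1 0 (-ε))) := by
    rw [hasType_pencil]
    rintro ⟨x, y, k₁, k₂, k₃, hk, h⟩
    have := hε k₁ y
    simp [adjugate_symMat, symMat_inj] at h
    grind
  have h₃ : HasType ε (pencil (symMat 1 0 0 0 0 0) (symMat 0 0 0 1 0 (-ε))) :=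
    hasType_pencil.2 ⟨0, 1, 1, 0, 0, by simp, by simp [adjugate_symMat]⟩
  simp [lineIndex, hasRankOne_pencil_left, h₁, h₂, h₃]

theorem lineIndex_four (hε : ∀ x y : F, x ^ 2 = ε * y ^ 2 → x = 0 ∧ y = 0) :
    lineIndex ε (pencil (symMat 1 0 0 0 0 0) (symMat 0 0 1 1 0 0)) = 4 := by
  have h0 := nonsquare_ne_zero hε
  have h₁ : ¬IsSingularSpace (pencil (symMat (1 : F) 0 0 0 0 0) (symMat 0 0 1 1 0 0)) := by
    rw [isSingularSpace_pencil]
    intro h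
    simpa [det_symMat] using h 0 1
  have h₂ (t : F) (ht : t ≠ 0) :
      ¬HasType t (pencil (symMat 1 0 0 0 0 0) (symMat 0 0 1 1 0 0)) := by
    rw [hasType_pencil]
    rintro ⟨x, y, k₁, k₂, k₃, hk, h⟩
    simp [adjugate_symMat, symMat_inj] at h
    grind
  simp [lineIndex, hasRankOne_pencil_left, h₁, h₂ ε h0, h₂ 1 one_ne_zero]

theorem lineIndex_five (hε : ∀ x y : F, x ^ 2 = ε * y ^ 2 → x = 0 ∧ y = 0)
    (hrep : ∃ x y : F, ε * x ^ 2 - y ^ 2 = -ε) :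
    lineIndex ε (pencil (symMat 1 0 0 ε 0 0) (symMat 0 1 0 0 0 0)) = 5 := by
  have h₁ : IsSingularSpace (pencil (symMat 1 0 0 ε 0 0) (symMat 0 1 0 0 0 0)) :=
    isSingularSpace_pencil.2 fun x y => by simp [det_symMat]
  have h₂ : HasType ε (pencil (symMat 1 0 0 ε 0 0) (symMat 0 1 0 0 0 0)) := by
    obtain ⟨x, y, h⟩ := hrep
    exact hasType_pencil.2 ⟨x, y, 0, 0, 1, by simp, by simp [adjugate_symMat, ← h, symMat_inj]; ring⟩
  have h₃ : ¬HasRankOne (pencil (symMat 1 0 0 ε 0 0) (symMat 0 1 0 0 0 0)) := by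
    refine not_hasRankOne_pencil fun x y h => ?_
    have := hε y x
    simp [adjugate_symMat, symMat_eq_zero] at h
    grind
  simp [lineIndex, h₁, h₂, h₃]

theorem lineIndex_six (hε : ∀ x y : F, x ^ 2 = ε * y ^ 2 → x = 0 ∧ y = 0) :
    lineIndex ε (pencil (symMat 0 1 0 0 0 0) (symMat 0 0 1 0 0 0)) = 6 := by
  have h0 := nonsquare_ne_zero hε
  have h₁ : IsSingularSpace (pencil (symMat (0 : F) 1 0 0 0 0) (symMat 0 0 1 0 0 0)) :=
    isSingularSpace_pencil.2 fun x y => by simp [det_symMat]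
  have h₂ : ¬HasType ε (pencil (symMat 0 1 0 0 0 0) (symMat 0 0 1 0 0 0)) := by
    rw [hasType_pencil]
    rintro ⟨x, y, k₁, k₂, k₃, hk, h⟩
    have := hε y k₂
    have := hε x k₃
    simp [adjugate_symMat, symMat_inj] at h
    grind
  have h₃ : ¬HasRankOne (pencil (symMat (0 : F) 1 0 0 0 0) (symMat 0 0 1 0 0 0)) := by
    refine not_hasRankOne_pencil fun x y h => ?_
    simp [adjugate_symMat, symMat_eq_zero] at h
    grind
  simp [lineIndex, h₁, h₂, h₃]

theorem not_isSingularSpace_diag {α β : F} :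
    ¬IsSingularSpace (pencil (symMat 0 1 0 0 0 0) (symMat α 0 0 β 0 1)) := by
  rw [isSingularSpace_pencil]
  intro h
  have h₁ := h 1 1
  have h₂ := h 0 1
  simp [det_symMat] at h₁ h₂
  grind

theorem not_hasRankOne_diag {α β : F} (hα : α ≠ 0) :
    ¬HasRankOne (pencil (symMat 0 1 0 0 0 0) (symMat α 0 0 β 0 1)) := by
  refine not_hasRankOne_pencil fun x y h => ?_
  simp [adjugate_symMat, symMat_eq_zero, hα] at h
  grind

theorem hasDoubleRoot_diag {α : F} :
    HasDoubleRoot (pencil (symMat 0 1 0 0 0 0) (symMat α 0 0 0 0 1)) :=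
  hasDoubleRoot_pencil.2 ⟨0, 1, by simp [symMat_eq_zero], by simp [det_symMat],
    by simp [adjugate_symMat, trace_symMat_mul], by simp [adjugate_symMat, trace_symMat_mul]⟩

theorem not_hasDoubleRoot_diag (h2 : (2 : F) ≠ 0) {α β : F} (hα : α ≠ 0) (hβ : β ≠ 0) :
    ¬HasDoubleRoot (pencil (symMat 0 1 0 0 0 0) (symMat α 0 0 β 0 1)) := by
  rw [hasDoubleRoot_pencil]
  rintro ⟨x, y, h0, h₁, h₂, h₃⟩
  simp [det_symMat, adjugate_symMat, trace_symMat_mul, symMat_eq_zero, h2, hα, hβ] at h0 h₁ h₂ h₃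
  obtain rfl : y = 0 := by
    rcases h₂ with rfl | h₂
    · simp_all
    · exact h₂
  simp_all

theorem not_hasType_diag (hε : ∀ x y : F, x ^ 2 = ε * y ^ 2 → x = 0 ∧ y = 0) {β : F}
    (hβ : β = 0 ∨ β = -1 ∨ β = -ε) :
    ¬HasType ε (pencil (symMat 0 1 0 0 0 0) (symMat (-1) 0 0 β 0 1)) := by
  have h0 := nonsquare_ne_zero hε
  rw [hasType_pencil]
  rintro ⟨x, y, k₁, k₂, k₃, hk, h⟩
  have h₁ := hε y k₂
  have h₂ := hε y k₁
  have h₃ := hε x k₃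
  simp [adjugate_symMat, symMat_inj] at h
  obtain ⟨rfl, rfl⟩ := h₁ (by grind)
  rcases hβ with rfl | rfl | rfl <;> grind

theorem lineIndex_seven (hε : ∀ x y : F, x ^ 2 = ε * y ^ 2 → x = 0 ∧ y = 0) :
    lineIndex ε (pencil (symMat 0 1 0 0 0 0) (symMat (-1) 0 0 0 0 1)) = 7 := by
  have h₁ : (-1 : F) ≠ 0 := neg_ne_zero.2 one_ne_zero
  have h₂ : ¬SingularProportional (pencil (symMat (0 : F) 1 0 0 0 0) (symMat (-1) 0 0 0 0 1)) :=
    not_singularProportional_pencil (x := 0) (by simp [det_symMat]) (by simp [det_symMat])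
      (linearIndependent_symMat (by simp))
  simp [lineIndex, not_hasRankOne_diag h₁, not_isSingularSpace_diag, hasType_one_pencil_left,
    hasDoubleRoot_diag, not_hasType_diag hε, h₂]

theorem lineIndex_eight (hε : ∀ x y : F, x ^ 2 = ε * y ^ 2 → x = 0 ∧ y = 0) :
    lineIndex ε (pencil (symMat 0 1 0 0 0 0) (symMat (-ε) 0 0 0 0 1)) = 8 := by
  have h₁ : -ε ≠ 0 := neg_ne_zero.2 (nonsquare_ne_zero hε)
  have h₂ : HasType ε (pencil (symMat 0 1 0 0 0 0) (symMat (-ε) 0 0 0 0 1)) :=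
    hasType_pencil.2 ⟨0, 1, 0, 1, 0, by simp, by simp [adjugate_symMat]⟩
  simp [lineIndex, not_hasRankOne_diag h₁, not_isSingularSpace_diag, hasType_one_pencil_left,
    hasDoubleRoot_diag, h₂]

theorem lineIndex_nine (h2 : (2 : F) ≠ 0) (hε : ∀ x y : F, x ^ 2 = ε * y ^ 2 → x = 0 ∧ y = 0) :
    lineIndex ε (pencil (symMat 0 1 0 0 0 0) (symMat (-1) 0 0 (-1) 0 1)) = 9 := by
  have h₁ : (-1 : F) ≠ 0 := neg_ne_zero.2 one_ne_zero
  have h₂ : ¬SingularProportional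
      (pencil (symMat (0 : F) 1 0 0 0 0) (symMat (-1) 0 0 (-1) 0 1)) :=
    not_singularProportional_pencil (x := 1) (by simp [det_symMat]) (by simp [det_symMat])
      (linearIndependent_symMat (by simp))
  simp [lineIndex, not_hasRankOne_diag h₁, not_isSingularSpace_diag, hasType_one_pencil_left,
    not_hasDoubleRoot_diag h2 h₁ h₁, not_hasType_diag hε, h₂]

theorem lineIndex_ten (h2 : (2 : F) ≠ 0) (hε : ∀ x y : F, x ^ 2 = ε * y ^ 2 → x = 0 ∧ y = 0) :
    lineIndex ε (pencil (symMat 0 1 0 0 0 0) (symMat (-ε) 0 0 (-ε) 0 1)) = 10 := by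
  have h₁ : -ε ≠ 0 := neg_ne_zero.2 (nonsquare_ne_zero hε)
  have h₂ : HasType ε (pencil (symMat 0 1 0 0 0 0) (symMat (-ε) 0 0 (-ε) 0 1)) :=
    hasType_pencil.2 ⟨ε, 1, 1, 1, 0, by simp, by simp [adjugate_symMat, symMat_inj]; ring⟩
  simp [lineIndex, not_hasRankOne_diag h₁, not_isSingularSpace_diag, hasType_one_pencil_left,
    not_hasDoubleRoot_diag h2 h₁ h₁, h₂]

theorem lineIndex_eleven (h2 : (2 : F) ≠ 0) (hε : ∀ x y : F, x ^ 2 = ε * y ^ 2 → x = 0 ∧ y = 0) :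
    lineIndex ε (pencil (symMat 0 1 0 0 0 0) (symMat (-1) 0 0 (-ε) 0 1)) = 11 := by
  have h₁ : (-1 : F) ≠ 0 := neg_ne_zero.2 one_ne_zero
  have h₂ : -ε ≠ 0 := neg_ne_zero.2 (nonsquare_ne_zero hε)
  have h₃ : SingularProportional (pencil (symMat (0 : F) 1 0 0 0 0) (symMat (-1) 0 0 (-ε) 0 1)) :=
    singularProportional_pencil fun x y h => by
      have := hε x y
      simp [det_symMat] at h
      grind
  simp [lineIndex, not_hasRankOne_diag h₁, not_isSingularSpace_diag, hasType_one_pencil_left,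
    not_hasDoubleRoot_diag h2 h₁ h₂, not_hasType_diag hε, h₃]

theorem lineIndex_twelve (hε : ∀ x y : F, x ^ 2 = ε * y ^ 2 → x = 0 ∧ y = 0) {u v : F}
    (huv : ε * u ^ 2 - v ^ 2 = 1) :
    lineIndex ε (pencil (symMat 1 0 0 (-ε) 0 0) (symMat u v 0 (ε * u) 0 1)) = 12 := by
  have h₁ : ¬IsSingularSpace (pencil (symMat 1 0 0 (-ε) 0 0) (symMat u v 0 (ε * u) 0 1)) := by
    rw [isSingularSpace_pencil]
    intro h
    have := h 0 1
    simp [det_symMat] at this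
    exact one_ne_zero (by linear_combination this - huv)
  have h₂ : ¬HasType 1 (pencil (symMat 1 0 0 (-ε) 0 0) (symMat u v 0 (ε * u) 0 1)) := by
    rw [hasType_pencil]
    rintro ⟨x, y, k₁, k₂, k₃, hk, h⟩
    simp [adjugate_symMat, symMat_inj] at h
    obtain ⟨e₁, e₂, e₃, e₄, e₅, e₆⟩ := h
    have hy : y ^ 2 * (y ^ 2 - ε * x ^ 2) = 0 := by
      linear_combination y ^ 4 * (-huv) + (x + y * u) * y * e₁ - k₁ ^ 2 * e₄ -
        (y * v * y + k₁ * k₂) * e₂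
    have h₃ : (x + y * u) * (-(x * ε) + y * (ε * u)) - (y * v) ^ 2 = y ^ 2 - ε * x ^ 2 := by
      linear_combination y ^ 2 * huv
    obtain rfl : y = 0 := by
      rcases mul_eq_zero.1 hy with h | h
      · exact pow_eq_zero_iff two_ne_zero |>.1 h
      · exact (hε y x (sub_eq_zero.1 h)).1
    simp at e₁ e₄ e₆
    have h₅ := hε x k₃
    grind
  have h₃ : HasType ε (pencil (symMat 1 0 0 (-ε) 0 0) (symMat u v 0 (ε * u) 0 1)) :=
    hasType_pencil.2 ⟨1, 0, 0, 0, 1, by simp, by simp [adjugate_symMat]⟩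
  have h₄ : ¬HasRankOne (pencil (symMat 1 0 0 (-ε) 0 0) (symMat u v 0 (ε * u) 0 1)) := by
    refine not_hasRankOne_pencil fun x y h => ?_
    simp [adjugate_symMat, symMat_eq_zero] at h
    exact (hε y x (by linear_combination h.2.2.2 - y ^ 2 * huv)).symm
  simp [lineIndex, h₁, h₂, h₃, h₄]

theorem lineIndex_thirteen (hε : ∀ x y : F, x ^ 2 = ε * y ^ 2 → x = 0 ∧ y = 0) :
    lineIndex ε (pencil (symMat 0 1 0 0 0 0) (symMat 0 0 1 1 0 0)) = 13 := by
  have h0 := nonsquare_ne_zero hε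
  have h₁ : ¬IsSingularSpace (pencil (symMat (0 : F) 1 0 0 0 0) (symMat 0 0 1 1 0 0)) := by
    rw [isSingularSpace_pencil]
    intro h
    simpa [det_symMat] using h 0 1
  have h₂ : ¬HasType ε (pencil (symMat 0 1 0 0 0 0) (symMat 0 0 1 1 0 0)) := by
    rw [hasType_pencil]
    rintro ⟨x, y, k₁, k₂, k₃, hk, h⟩
    have := hε x k₃
    simp [adjugate_symMat, symMat_inj] at h
    grind
  have h₃ : ¬HasRankOne (pencil (symMat (0 : F) 1 0 0 0 0) (symMat 0 0 1 1 0 0)) := by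
    refine not_hasRankOne_pencil fun x y h => ?_
    simp [adjugate_symMat, symMat_eq_zero] at h
    grind
  have h₄ : HasDoubleRoot (pencil (symMat (0 : F) 1 0 0 0 0) (symMat 0 0 1 1 0 0)) :=
    hasDoubleRoot_pencil.2 ⟨1, 0, by simp [symMat_eq_zero], by simp [det_symMat],
      by simp [adjugate_symMat, trace_symMat_mul], by simp [adjugate_symMat, trace_symMat_mul]⟩
  have h₅ : SingularProportional (pencil (symMat (0 : F) 1 0 0 0 0) (symMat 0 0 1 1 0 0)) :=
    singularProportional_pencil fun x y h => by
      simp [det_symMat] at h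
      grind
  simp [lineIndex, hasType_one_pencil_left, h₁, h₂, h₃, h₄, h₅]

theorem lineIndex_fourteen (h0 : ε ≠ 0) {W₀ : Submodule F (Matrix (Fin 3) (Fin 3) F)}
    (hdim : Module.finrank F W₀ = 2) (hW₀ : ∀ M ∈ W₀, M.det = 0 → M = 0) :
    lineIndex ε W₀ = 14 := by
  have hne : ∃ M ∈ W₀, M ≠ 0 := by
    rw [← Submodule.ne_bot_iff]
    rintro rfl
    simp at hdim
  obtain ⟨M₀, hM₀, hM₀'⟩ := hne
  have hdet {M : Matrix (Fin 3) (Fin 3) F} (h : M.adjugate.det = 0) : M.det = 0 := by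
    rw [Matrix.det_adjugate] at h
    exact pow_eq_zero_iff (by simp) |>.1 h
  have h₁ : ¬IsSingularSpace W₀ := fun h => hM₀' (hW₀ _ hM₀ (h _ hM₀))
  have h₂ : ¬HasRankOne W₀ := by
    rintro ⟨M, hM, hne, h⟩
    exact hne (hW₀ M hM (hdet (by simp [h])))
  have h₃ (t : F) (ht : t ≠ 0) : ¬HasType t W₀ := by
    rintro ⟨M, hM, k, hk, h⟩
    have hM0 : M = 0 := hW₀ M hM (hdet (by
      rw [h, Matrix.det_smul, Matrix.det_vecMulVec, mul_zero]))
    obtain ⟨i, hi⟩ := Function.ne_iff.1 hk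
    have := congrFun (congrFun h i) i
    rw [hM0] at this
    simp [Matrix.vecMulVec_apply, ht] at this
    exact hi this
  simp [lineIndex, h₁, h₂, h₃ ε h0, h₃ 1 one_ne_zero]

theorem lineIndex_lineRep (h2 : (2 : F) ≠ 0)
    (hε : ∀ x y : F, x ^ 2 = ε * y ^ 2 → x = 0 ∧ y = 0)
    (hrep : ∃ x y : F, ε * x ^ 2 - y ^ 2 = -ε) {u v : F} (huv : ε * u ^ 2 - v ^ 2 = 1)
    {W₀ : Submodule F (Matrix (Fin 3) (Fin 3) F)} (hdim : Module.finrank F W₀ = 2)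
    (hW₀ : ∀ M ∈ W₀, M.det = 0 → M = 0) (i : Fin 15) :
    lineIndex ε (lineRep ε u v W₀ i) = i := by
  fin_cases i
  exacts [lineIndex_zero, lineIndex_one hε, lineIndex_two, lineIndex_three hε, lineIndex_four hε,
    lineIndex_five hε hrep, lineIndex_six hε, lineIndex_seven hε, lineIndex_eight hε,
    lineIndex_nine h2 hε, lineIndex_ten h2 hε, lineIndex_eleven h2 hε, lineIndex_twelve hε huv,
    lineIndex_thirteen hε, lineIndex_fourteen (nonsquare_ne_zero hε) hdim hW₀]

end Representatives

theorem exists_eq_pencil {W : Submodule F (Matrix (Fin 3) (Fin 3) F)}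
    (hdim : Module.finrank F W = 2) {M : Matrix (Fin 3) (Fin 3) F} (hM : M ∈ W) (h0 : M ≠ 0) :
    ∃ N ∈ W, LinearIndependent F ![M, N] ∧ W = pencil M N := by
  obtain ⟨N, hN, hMN⟩ : ∃ N ∈ W, N ∉ Submodule.span F {M} := by
    by_contra! h
    have := Submodule.finrank_mono (show W ≤ Submodule.span F {M} from h)
    rw [finrank_span_singleton h0] at this
    lia
  have hli : LinearIndependent F ![M, N] :=
    (LinearIndependent.pair_iff' h0).2 fun a ha => hMN (Submodule.mem_span_singleton.2 ⟨a, ha⟩)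
  refine ⟨N, hN, hli, (Submodule.eq_of_le_of_finrank_eq ?_ ?_).symm⟩
  · rw [Submodule.span_le, Set.pair_subset_iff]
    exact ⟨hM, hN⟩
  · rw [finrank_pencil hli, hdim]

section Anisotropic

variable {L : Type*} [Field L] [Algebra F L]

theorem exists_smul_eq_sq [Finite F] (hodd : Odd (Nat.card F)) (hL : Module.finrank F L = 3)
    {c : L} (hc : c ≠ 0) : ∃ r : F, ∃ p : L, p ≠ 0 ∧ p ^ 2 = r • c := by
  have : Module.Finite F L := Module.finite_of_finrank_pos (by lia)
  have : Finite L := Module.finite_of_finite F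
  obtain ⟨k, hk⟩ := hodd
  refine ⟨Algebra.norm F c, c ^ (2 * k ^ 2 + 3 * k + 2), pow_ne_zero _ hc, ?_⟩
  rw [Algebra.smul_def, FiniteField.algebraMap_norm_eq_pow_sum, hL, hk, ← pow_succ, ← pow_mul]
  congr 1
  simp [Finset.sum_range_succ]
  ring

/-- The Gram matrix of the form `(x, y) ↦ m (x * y)` in a given basis. -/
noncomputable def mulGram (b : Module.Basis (Fin 3) F L) :
    Module.Dual F L →ₗ[F] Matrix (Fin 3) (Fin 3) F where
  toFun m := Matrix.of fun i j => m (b i * b j)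
  map_add' _ _ := rfl
  map_smul' _ _ := rfl

@[simp]
theorem mulGram_apply (b : Module.Basis (Fin 3) F L) (m : Module.Dual F L) (i j : Fin 3) :
    mulGram b m i j = m (b i * b j) := rfl

theorem det_mulGram_ne_zero (b : Module.Basis (Fin 3) F L) {m : Module.Dual F L} (hm : m ≠ 0) :
    (mulGram b m).det ≠ 0 := by
  intro h
  obtain ⟨v, hv, hmv⟩ := Matrix.exists_mulVec_eq_zero_iff.2 h
  apply hm
  set x := ∑ j, v j • b j with hx
  have hx0 : x ≠ 0 := by
    intro h0
    apply hv
    ext j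
    exact Fintype.linearIndependent_iff.1 b.linearIndependent v h0 j
  have h₁ : m ∘ₗ LinearMap.mulRight F x = 0 := by
    refine b.ext fun i => ?_
    have := congrFun hmv i
    simpa [Matrix.mulVec, dotProduct, hx, Finset.mul_sum, mul_comm] using this
  ext y
  simpa [mul_assoc, hx0] using LinearMap.congr_fun h₁ (y * x⁻¹)

/-- The space of the Gram matrices of the forms `(x, y) ↦ m (x * y)` with `m 1 = 0`. -/
noncomputable def anisotropicPencil (b : Module.Basis (Fin 3) F L) :
    Submodule F (Matrix (Fin 3) (Fin 3) F) :=
  (Submodule.span F {(1 : L)}).dualAnnihilator.map (mulGram b)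

variable (b : Module.Basis (Fin 3) F L)

theorem anisotropicPencil_isSymm : ∀ M ∈ anisotropicPencil b, M.IsSymm := by
  rintro _ ⟨m, -, rfl⟩
  ext i j
  simp [mul_comm]

theorem det_ne_zero_of_mem_anisotropicPencil :
    ∀ M ∈ anisotropicPencil b, M.det = 0 → M = 0 := by
  rintro _ ⟨m, -, rfl⟩ h
  by_contra h0
  refine det_mulGram_ne_zero b (m := m) ?_ h
  rintro rfl
  simp at h0

theorem finrank_anisotropicPencil : Module.finrank F (anisotropicPencil b) = 2 := by
  have hinj : Function.Injective (mulGram b) := by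
    rw [← LinearMap.ker_eq_bot, LinearMap.ker_eq_bot']
    intro m hm
    by_contra h0
    apply det_mulGram_ne_zero b h0
    simp [hm]
  have : Module.Finite F L := .of_basis b
  have h₁ := Subspace.finrank_add_finrank_dualAnnihilator_eq (Submodule.span F {(1 : L)})
  rw [finrank_span_singleton one_ne_zero, Module.finrank_eq_card_basis b, Fintype.card_fin] at h₁
  rw [anisotropicPencil, ← (Submodule.equivMapOfInjective _ hinj _).finrank_eq]
  lia

theorem exists_algHom_of_det_ne_zero [Finite F] (hL : Module.finrank F L = 3)
    {T : Matrix (Fin 3) (Fin 3) F}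
    (hT : ∀ x : F, (Matrix.scalar (Fin 3) x - T).det ≠ 0) :
    ∃ ρ : L →ₐ[F] Matrix (Fin 3) (Fin 3) F, (∃ t, ρ t = T) ∧
      ∀ x, ∃ p : Polynomial F, ρ x = Polynomial.aeval T p := by
  obtain ⟨q, hq⟩ := CharP.exists F
  have : Fact q.Prime := ⟨CharP.char_is_prime F q⟩
  have hdeg : T.charpoly.natDegree = 3 := by simp
  have hirr : Irreducible T.charpoly := by
    rw [T.charpoly_monic.irreducible_iff_roots_eq_zero_of_degree_le_three (by lia) (by lia)]
    refine Multiset.eq_zero_of_forall_notMem fun x hx => hT x ?_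
    rw [← Matrix.eval_charpoly]
    exact Polynomial.isRoot_of_mem_roots hx
  have : Fact (Irreducible T.charpoly) := ⟨hirr⟩
  have hK : Module.finrank F (AdjoinRoot T.charpoly) = 3 := by
    rw [(AdjoinRoot.powerBasis hirr.ne_zero).finrank]
    simp
  let e : L ≃ₐ[F] AdjoinRoot T.charpoly :=
    (FiniteField.algEquivExtension F q 3 L hL).trans
      (FiniteField.algEquivExtension F q 3 _ hK).symm
  let g : AdjoinRoot T.charpoly →ₐ[F] Matrix (Fin 3) (Fin 3) F :=
    Ideal.Quotient.liftₐ (Ideal.span {T.charpoly}) (Polynomial.aeval T) (by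
      intro p hp
      obtain ⟨r, rfl⟩ := Ideal.mem_span_singleton.1 hp
      simp [Matrix.aeval_self_charpoly])
  have hg (p : Polynomial F) : g (AdjoinRoot.mk _ p) = Polynomial.aeval T p := rfl
  refine ⟨g.comp e, ⟨e.symm (AdjoinRoot.root _), ?_⟩, fun x => ?_⟩
  · simpa using hg Polynomial.X
  · obtain ⟨p, hp⟩ := AdjoinRoot.mk_surjective (e x)
    exact ⟨p, by simp [← hp, hg]⟩

theorem mul_aeval_eq_transpose_mul {A T : Matrix (Fin 3) (Fin 3) F} (h : A * T = Tᵀ * A)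
    (p : Polynomial F) : A * Polynomial.aeval T p = (Polynomial.aeval T p)ᵀ * A := by
  induction p using Polynomial.induction_on' with
  | add p q hp hq => simp [Matrix.mul_add, Matrix.add_mul, hp, hq]
  | monomial n a =>
    have hn : A * T ^ n = Tᵀ ^ n * A := (SemiconjBy.pow_right h n : SemiconjBy A (T ^ n) (Tᵀ ^ n))
    simp [Polynomial.aeval_monomial, Algebra.algebraMap_eq_smul_one, hn, Matrix.transpose_pow]

theorem kEquiv_anisotropicPencil [Finite F] (hodd : Odd (Nat.card F))
    {W : Submodule F (Matrix (Fin 3) (Fin 3) F)} (hsymm : ∀ M ∈ W, M.IsSymm)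
    (hdim : Module.finrank F W = 2) (hdet : ∀ M ∈ W, M.det = 0 → M = 0) :
    KEquiv F W (anisotropicPencil b) := by
  have hL : Module.finrank F L = 3 := by simp [Module.finrank_eq_card_basis b]
  have : Module.Finite F L := .of_basis b
  obtain ⟨A, B, hli, hspan⟩ : ∃ A B : Matrix (Fin 3) (Fin 3) F,
      (∀ x y : F, x • A + y • B = 0 → x = 0 ∧ y = 0) ∧ W = pencil A B := by
    obtain ⟨A, hA, hA0⟩ : ∃ A ∈ W, A ≠ 0 := by
      rw [← Submodule.ne_bot_iff]
      rintro rfl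
      simp at hdim
    obtain ⟨B, -, hli, h⟩ := exists_eq_pencil hdim hA hA0
    exact ⟨A, B, LinearIndependent.pair_iff.1 hli, h⟩
  subst hspan
  have hA := hsymm A (Submodule.subset_span (by simp))
  have hB := hsymm B (Submodule.subset_span (by simp))
  have hunit : IsUnit A.det := by
    refine Ne.isUnit fun h => ?_
    have := hdet A (Submodule.subset_span (by simp)) h
    exact one_ne_zero (hli 1 0 (by simp [this])).1
  have hAB : A * (A⁻¹ * B) = B := Matrix.mul_nonsing_inv_cancel_left _ _ hunit
  obtain ⟨ρ, ⟨t, ht⟩, hρ⟩ := exists_algHom_of_det_ne_zero hL (T := A⁻¹ * B) (by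
    intro x h
    have h₁ : A * (Matrix.scalar (Fin 3) x - A⁻¹ * B) = x • A + (-1 : F) • B := by
      rw [Matrix.mul_sub, hAB]
      simp [sub_eq_add_neg, ← Matrix.smul_one_eq_diagonal]
    have h₂ := hdet (x • A + (-1 : F) • B) (Submodule.mem_span_pair.2 ⟨_, _, rfl⟩)
      (by rw [← h₁, Matrix.det_mul, h, mul_zero])
    simpa using (hli _ _ h₂).2)
  have hρA (x : L) : A * ρ x = (ρ x)ᵀ * A := by
    obtain ⟨p, hp⟩ := hρ x
    rw [hp]
    refine mul_aeval_eq_transpose_mul ?_ p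
    rw [hAB, Matrix.transpose_mul, Matrix.transpose_nonsing_inv, hA.eq, hB.eq,
      Matrix.nonsing_inv_mul_cancel_right _ _ hunit]
  let ℓ : L →ₗ[F] F := Matrix.entryLinearMap F F 0 0 ∘ₗ LinearMap.mulLeft F A ∘ₗ ρ.toLinearMap
  have hℓ (x : L) : ℓ x = (A * ρ x) 0 0 := rfl
  obtain ⟨c, hc, hc0⟩ := Submodule.exists_mem_ne_zero_of_ne_bot
    (LinearMap.ker_ne_bot_of_finrank_lt (f := ℓ.prod (ℓ ∘ₗ LinearMap.mulLeft F t))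
      (by simp [hL]))
  obtain ⟨r, p, hp0, hp⟩ := exists_smul_eq_sq hodd hL hc0
  obtain ⟨hc₁, hc₂⟩ : ℓ c = 0 ∧ ℓ (t * c) = 0 := Prod.ext_iff.1 hc
  let C : Matrix (Fin 3) (Fin 3) F := Matrix.of fun i j => ρ (p * b j) i 0
  have hC : IsUnit C := by
    rw [Matrix.isUnit_iff_isUnit_det]
    refine Ne.isUnit fun h => ?_
    obtain ⟨v, hv, hCv⟩ := Matrix.exists_mulVec_eq_zero_iff.2 h
    apply hv
    set z := p * ∑ j, v j • b j with hz
    have hz1 : (ρ z).col 0 = 0 := by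
      ext i
      have := congrFun hCv i
      simpa [C, hz, Matrix.mulVec, dotProduct, Finset.mul_sum, mul_comm, Matrix.sum_apply] using this
    have hz0 : z = 0 := by
      by_contra hz0
      have h₁ : ρ z⁻¹ * ρ z = 1 := by rw [← map_mul, inv_mul_cancel₀ hz0, map_one]
      have h₂ := congrFun (congrFun h₁ 0) 0
      have h₃ (i : Fin 3) : ρ z i 0 = 0 := congrFun hz1 i
      simp [Matrix.mul_apply, h₃] at h₂
    ext j
    exact Fintype.linearIndependent_iff.1 b.linearIndependent v
      ((mul_eq_zero.1 hz0).resolve_left hp0) j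
  refine kEquiv_of_mapsTo ((Matrix.isUnit_transpose C).2 hC) ?_
    (hdim.trans (finrank_anisotropicPencil b).symm)
  intro M hM
  obtain ⟨x, y, rfl⟩ := Submodule.mem_span_pair.1 hM
  set s := algebraMap F L x + y • t with hs
  have hM' : x • A + y • B = A * ρ s := by
    simp [hs, ht, Matrix.mul_add, hAB, Algebra.algebraMap_eq_smul_one]
  rw [hM', Matrix.transpose_transpose]
  refine ⟨ℓ ∘ₗ LinearMap.mulLeft F (s * p ^ 2), ?_, ?_⟩
  · rw [SetLike.mem_coe, Submodule.mem_dualAnnihilator]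
    intro w hw
    obtain ⟨k, rfl⟩ := Submodule.mem_span_singleton.1 hw
    have : s * (r • c) * (k • 1) = (k * r * x) • c + (k * r * y) • (t * c) := by
      simp only [hs, Algebra.smul_def, map_mul]
      ring
    rw [LinearMap.comp_apply, LinearMap.mulLeft_apply, hp, this]
    simp [hc₁, hc₂]
  · ext i j
    have h₁ : (Cᵀ * (A * ρ s) * C) i j = ((ρ (p * b i))ᵀ * (A * ρ s) * ρ (p * b j)) 0 0 := rfl
    have h₂ : s * p ^ 2 * (b i * b j) = p * b i * (s * (p * b j)) := by ring
    rw [h₁, mulGram_apply, LinearMap.comp_apply, LinearMap.mulLeft_apply, hℓ, h₂, map_mul ρ,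
      map_mul ρ s, ← Matrix.mul_assoc, hρA]
    simp only [Matrix.mul_assoc]

end Anisotropic

section Completeness

/-- The congruence by the matrix with rows `x`, `y`, `z` maps the first of two symmetric matrices,
given by their upper triangles, to the second one. -/
def CongruenceMaps (x₁ x₂ x₃ y₁ y₂ y₃ z₁ z₂ z₃ a b c d e f a' b' c' d' e' f' : F) : Prop :=
  a * x₁ ^ 2 + d * x₂ ^ 2 + f * x₃ ^ 2 + 2 * b * x₁ * x₂ + 2 * c * x₁ * x₃ + 2 * e * x₂ * x₃ = a' ∧
  a * x₁ * y₁ + d * x₂ * y₂ + f * x₃ * y₃ + b * (x₁ * y₂ + x₂ * y₁) + c * (x₁ * y₃ + x₃ * y₁) +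
    e * (x₂ * y₃ + x₃ * y₂) = b' ∧
  a * x₁ * z₁ + d * x₂ * z₂ + f * x₃ * z₃ + b * (x₁ * z₂ + x₂ * z₁) + c * (x₁ * z₃ + x₃ * z₁) +
    e * (x₂ * z₃ + x₃ * z₂) = c' ∧
  a * y₁ ^ 2 + d * y₂ ^ 2 + f * y₃ ^ 2 + 2 * b * y₁ * y₂ + 2 * c * y₁ * y₃ + 2 * e * y₂ * y₃ = d' ∧
  a * y₁ * z₁ + d * y₂ * z₂ + f * y₃ * z₃ + b * (y₁ * z₂ + y₂ * z₁) + c * (y₁ * z₃ + y₃ * z₁) +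
    e * (y₂ * z₃ + y₃ * z₂) = e' ∧
  a * z₁ ^ 2 + d * z₂ ^ 2 + f * z₃ ^ 2 + 2 * b * z₁ * z₂ + 2 * c * z₁ * z₃ + 2 * e * z₂ * z₃ = f'

theorem CongruenceMaps.eq {x₁ x₂ x₃ y₁ y₂ y₃ z₁ z₂ z₃ a b c d e f a' b' c' d' e' f' : F}
    (h : CongruenceMaps x₁ x₂ x₃ y₁ y₂ y₃ z₁ z₂ z₃ a b c d e f a' b' c' d' e' f') :
    !![x₁, x₂, x₃; y₁, y₂, y₃; z₁, z₂, z₃] * symMat a b c d e f *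
      !![x₁, x₂, x₃; y₁, y₂, y₃; z₁, z₂, z₃]ᵀ = symMat a' b' c' d' e' f' := by
  rw [congruence_symMat, symMat_inj]
  exact h

variable (ε u v : F) (W₀ : Submodule F (Matrix (Fin 3) (Fin 3) F))

/-- If `W` is two-dimensional, then it is equivalent to one of the representatives. -/
def IsListed (W : Submodule F (Matrix (Fin 3) (Fin 3) F)) : Prop :=
  Module.finrank F W = 2 → ∃ i, KEquiv F W (lineRep ε u v W₀ i)

/-- All pencils of symmetric matrices through `M` are equivalent to one of the representatives. -/
def IsListedAt (M : Matrix (Fin 3) (Fin 3) F) : Prop :=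
  ∀ N : Matrix (Fin 3) (Fin 3) F, N.IsSymm → IsListed ε u v W₀ (pencil M N)

variable {ε u v W₀}

theorem isListed_lineRep (i : Fin 15) : IsListed ε u v W₀ (lineRep ε u v W₀ i) :=
  fun _ => ⟨i, KEquiv.refl _⟩

theorem KEquiv.finrank_eq {W W' : Submodule F (Matrix (Fin 3) (Fin 3) F)} (h : KEquiv F W W') :
    Module.finrank F W = Module.finrank F W' := by
  obtain ⟨A, hA, rfl⟩ := kEquiv_iff_map.1 h
  exact (W.equivMapOfInjective _ (congruence_injective hA)).finrank_eq

theorem IsListed.of_kEquiv {W W' : Submodule F (Matrix (Fin 3) (Fin 3) F)}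
    (h' : IsListed ε u v W₀ W') (h : KEquiv F W W') : IsListed ε u v W₀ W := by
  intro hW
  obtain ⟨i, hi⟩ := h' (h.finrank_eq ▸ hW)
  exact ⟨i, h.trans hi⟩

theorem isListed_of_dependent {M N : Matrix (Fin 3) (Fin 3) F} (x y : F) (hxy : x ≠ 0 ∨ y ≠ 0)
    (h : x • M + y • N = 0) : IsListed ε u v W₀ (pencil M N) := by
  intro hdim
  have hli : LinearIndependent F ![M, N] := by
    rw [linearIndependent_iff_card_eq_finrank_span, Matrix.range_cons_cons_empty]
    simpa [Set.finrank] using hdim.symm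
  have := LinearIndependent.pair_iff.1 hli x y h
  grind

theorem IsListed.of_congruence
    {a b c d e f a' b' c' d' e' f' a₁ b₁ c₁ d₁ e₁ f₁ a₂ b₂ c₂ d₂ e₂ f₂ : F}
    (h : IsListed ε u v W₀ (pencil (symMat a₁ b₁ c₁ d₁ e₁ f₁) (symMat a₂ b₂ c₂ d₂ e₂ f₂)))
    (x₁ x₂ x₃ y₁ y₂ y₃ z₁ z₂ z₃ p q r s : F)
    (hA : x₁ * y₂ * z₃ - x₁ * y₃ * z₂ - x₂ * y₁ * z₃ + x₂ * y₃ * z₁ + x₃ * y₁ * z₂ -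
      x₃ * y₂ * z₁ ≠ 0)
    (hpq : p * s - q * r ≠ 0)
    (h₁ : CongruenceMaps x₁ x₂ x₃ y₁ y₂ y₃ z₁ z₂ z₃ a b c d e f (p * a₁ + q * a₂)
      (p * b₁ + q * b₂) (p * c₁ + q * c₂) (p * d₁ + q * d₂) (p * e₁ + q * e₂) (p * f₁ + q * f₂))
    (h₂ : CongruenceMaps x₁ x₂ x₃ y₁ y₂ y₃ z₁ z₂ z₃ a' b' c' d' e' f' (r * a₁ + s * a₂)
      (r * b₁ + s * b₂) (r * c₁ + s * c₂) (r * d₁ + s * d₂) (r * e₁ + s * e₂) (r * f₁ + s * f₂)) :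
    IsListed ε u v W₀ (pencil (symMat a b c d e f) (symMat a' b' c' d' e' f')) := by
  refine h.of_kEquiv
    (KEquiv.pencil !![x₁, x₂, x₃; y₁, y₂, y₃; z₁, z₂, z₃] p q r s ?_ hpq ?_ ?_)
  · simpa [Matrix.det_fin_three] using hA
  · rw [h₁.eq, smul_symMat, smul_symMat, symMat_add]
  · rw [h₂.eq, smul_symMat, smul_symMat, symMat_add]

theorem IsListedAt.of_congruence {a b c d e f a₁ b₁ c₁ d₁ e₁ f₁ : F}
    (h : IsListedAt ε u v W₀ (symMat a₁ b₁ c₁ d₁ e₁ f₁))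
    (x₁ x₂ x₃ y₁ y₂ y₃ z₁ z₂ z₃ p : F)
    (hA : x₁ * y₂ * z₃ - x₁ * y₃ * z₂ - x₂ * y₁ * z₃ + x₂ * y₃ * z₁ + x₃ * y₁ * z₂ -
      x₃ * y₂ * z₁ ≠ 0)
    (hp : p ≠ 0)
    (h₁ : CongruenceMaps x₁ x₂ x₃ y₁ y₂ y₃ z₁ z₂ z₃ a b c d e f (p * a₁) (p * b₁) (p * c₁)
      (p * d₁) (p * e₁) (p * f₁)) :
    IsListedAt ε u v W₀ (symMat a b c d e f) := by
  intro N hN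
  set A := !![x₁, x₂, x₃; y₁, y₂, y₃; z₁, z₂, z₃] with hAdef
  refine (h (A * N * Aᵀ) ?_).of_kEquiv (KEquiv.pencil A p 0 0 1 ?_ ?_ ?_ ?_)
  · rw [Matrix.IsSymm, Matrix.transpose_mul, Matrix.transpose_mul, Matrix.transpose_transpose,
      hN.eq, Matrix.mul_assoc]
  · simpa [hAdef, Matrix.det_fin_three] using hA
  · simpa using hp
  · rw [h₁.eq, smul_symMat, zero_smul, add_zero]
  · simp

theorem isListed_unit_aux (h2 : (2 : F) ≠ 0)
    (hsq : ∀ x : F, x ≠ 0 → ∃ s, s ≠ 0 ∧ (x = s ^ 2 ∨ x = ε * s ^ 2)) {c d f : F} (hd : d ≠ 0) :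
    IsListed ε u v W₀ (pencil (symMat 1 0 0 0 0 0) (symMat 0 0 c d 0 f)) := by
  rcases eq_or_ne f 0 with rfl | hf
  · rcases eq_or_ne c 0 with rfl | hc
    · have h : IsListed ε u v W₀ (pencil (symMat 1 0 0 0 0 0) (symMat 0 0 0 1 0 0)) :=
        isListed_lineRep 0
      exact h.of_congruence 1 0 0 0 1 0 0 0 1 1 0 0 d (by simp) (by simpa)
        (by and_intros <;> ring) (by and_intros <;> ring)
    · have h : IsListed ε u v W₀ (pencil (symMat 1 0 0 0 0 0) (symMat 0 0 1 1 0 0)) :=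
        isListed_lineRep 4
      exact h.of_congruence d 0 0 0 c 0 0 0 c (d ^ 2) 0 0 (c ^ 2 * d) (by simp [*]) (by simp [*])
        (by and_intros <;> ring) (by and_intros <;> ring)
  · suffices h : IsListed ε u v W₀ (pencil (symMat 1 0 0 0 0 0) (symMat 0 0 0 d 0 f)) from
      h.of_congruence f 0 (-c) 0 1 0 0 0 1 (f ^ 2) 0 (-c ^ 2 * f) 1 (by simp [*]) (by simp [*])
        (by and_intros <;> ring) (by and_intros <;> ring)
    obtain ⟨s, hs, h⟩ := hsq (-f / d) (by simp [*])
    rw [div_eq_iff hd, div_eq_iff hd] at h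
    rcases h with h | h <;> obtain rfl := neg_eq_iff_eq_neg.1 h
    · have h : IsListed ε u v W₀ (pencil (symMat 1 0 0 0 0 0) (symMat 0 0 0 0 1 0)) :=
        isListed_lineRep 2
      exact h.of_congruence 1 0 0 0 s 1 0 s (-1) 1 0 0 (2 * d * s ^ 2)
        (by simp; grind) (by simp [*]) (by and_intros <;> ring) (by and_intros <;> ring)
    · have h : IsListed ε u v W₀ (pencil (symMat 1 0 0 0 0 0) (symMat 0 0 0 1 0 (-ε))) :=
        isListed_lineRep 3
      exact h.of_congruence 1 0 0 0 s 0 0 0 1 1 0 0 (d * s ^ 2)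
        (by simp [*]) (by simp [*]) (by and_intros <;> ring) (by and_intros <;> ring)

theorem isListedAt_unit (h2 : (2 : F) ≠ 0)
    (hsq : ∀ x : F, x ≠ 0 → ∃ s, s ≠ 0 ∧ (x = s ^ 2 ∨ x = ε * s ^ 2)) :
    IsListedAt ε u v W₀ (symMat 1 0 0 0 0 0) := by
  have h₁ {a b c d e f : F} (hd : d ≠ 0) :
      IsListed ε u v W₀ (pencil (symMat 1 0 0 0 0 0) (symMat a b c d e f)) := by
    have h : IsListed ε u v W₀ (pencil (symMat 1 0 0 0 0 0)
      (symMat 0 0 (d ^ 2 * c - d * b * e) d 0 (d ^ 2 * f - d * e ^ 2))) :=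
        isListed_unit_aux h2 hsq hd
    exact h.of_congruence d (-b) 0 0 1 0 0 (-e) d (d ^ 2) 0 (a * d ^ 2 - d * b ^ 2) 1
      (by simp [*]) (by simp [*]) (by and_intros <;> ring) (by and_intros <;> ring)
  have h₂ {a b c : F} (hb : b ≠ 0) :
      IsListed ε u v W₀ (pencil (symMat 1 0 0 0 0 0) (symMat a b c 0 0 0)) := by
    have h : IsListed ε u v W₀ (pencil (symMat 1 0 0 0 0 0) (symMat 0 1 0 0 0 0)) :=
      isListed_lineRep 1
    exact h.of_congruence 1 0 0 0 1 0 0 (-c) b 1 0 a b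
      (by simp [*]) (by simp [*]) (by and_intros <;> ring) (by and_intros <;> ring)
  intro N hN
  obtain ⟨a, b, c, d, e, f, rfl⟩ := hN.exists_eq_symMat
  by_cases hd : d = 0
  · subst hd
    by_cases hf : f = 0
    · subst hf
      by_cases he : e = 0
      · subst he
        by_cases hb : b = 0
        · subst hb
          by_cases hc : c = 0
          · subst hc
            refine isListed_of_dependent (-a) 1 (by simp) ?_
            simp [smul_symMat]
          · exact (h₂ (a := a) (c := 0) hc).of_congruence 1 0 0 0 0 1 0 1 0 1 0 0 1
              (by simp) (by simp) (by and_intros <;> ring) (by and_intros <;> ring)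
        · exact h₂ hb
      · have h := h₁ (a := a) (b := b + c) (c := c) (d := 2 * e) (e := e) (f := 0) (by simp [*])
        exact h.of_congruence 1 0 0 0 1 1 0 0 1 1 0 0 1
          (by simp) (by simp) (by and_intros <;> ring) (by and_intros <;> ring)
    · have h := h₁ (a := a) (b := c) (c := b) (e := e) (f := 0) hf
      exact h.of_congruence 1 0 0 0 0 1 0 1 0 1 0 0 1
        (by simp) (by simp) (by and_intros <;> ring) (by and_intros <;> ring)
  · exact h₁ hd

theorem isListed_hyperbolic_diag
    (hsq : ∀ x : F, x ≠ 0 → ∃ s, s ≠ 0 ∧ (x = s ^ 2 ∨ x = ε * s ^ 2))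
    {α β f : F} (hf : f ≠ 0) :
    IsListed ε u v W₀ (pencil (symMat 0 1 0 0 0 0) (symMat α 0 0 β 0 f)) := by
  have hform (α : F) : ∃ x s : F, (x = 0 ∨ x = 1 ∨ x = ε) ∧ s ≠ 0 ∧ α = -f * x * s ^ 2 := by
    by_cases hα : α = 0
    · exact ⟨0, 1, by simp, by simp, by simp [hα]⟩
    · obtain ⟨s, hs, h⟩ := hsq (α / -f) (by simp [*])
      rw [div_eq_iff (by simpa), div_eq_iff (by simpa)] at h
      rcases h with h | h
      · exact ⟨1, s, by simp, hs, by rw [h]; ring⟩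
      · exact ⟨ε, s, by simp, hs, by rw [h]; ring⟩
  have hscale {x y s t : F} (hs : s ≠ 0) (ht : t ≠ 0) (h : IsListed ε u v W₀
      (pencil (symMat 0 1 0 0 0 0) (symMat (-x) 0 0 (-y) 0 1))) :
      IsListed ε u v W₀ (pencil (symMat 0 1 0 0 0 0)
        (symMat (-f * x * s ^ 2) 0 0 (-f * y * t ^ 2) 0 f)) :=
    h.of_congruence t 0 0 0 s 0 0 0 (s * t) (s * t) 0 0 (f * s ^ 2 * t ^ 2)
      (by simp [*]) (by simp [*]) (by and_intros <;> ring) (by and_intros <;> ring)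
  have hswap {x y : F}
      (h : IsListed ε u v W₀ (pencil (symMat 0 1 0 0 0 0) (symMat x 0 0 y 0 1))) :
      IsListed ε u v W₀ (pencil (symMat 0 1 0 0 0 0) (symMat y 0 0 x 0 1)) :=
    h.of_congruence 0 1 0 1 0 0 0 0 1 1 0 0 1
      (by simp) (by simp) (by and_intros <;> ring) (by and_intros <;> ring)
  have h₂ : IsListed ε u v W₀ (pencil (symMat 1 0 0 0 0 0) (symMat 0 0 0 0 1 0)) :=
    isListed_lineRep 2
  have h₂' : IsListed ε u v W₀ (pencil (symMat 0 1 0 0 0 0) (symMat 0 0 0 0 0 1)) :=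
    h₂.of_congruence 0 0 1 1 0 0 0 1 0 0 1 1 0
      (by simp) (by simp) (by and_intros <;> ring) (by and_intros <;> ring)
  have h₇ : IsListed ε u v W₀ (pencil (symMat 0 1 0 0 0 0) (symMat (-1) 0 0 0 0 1)) :=
    isListed_lineRep 7
  have h₈ : IsListed ε u v W₀ (pencil (symMat 0 1 0 0 0 0) (symMat (-ε) 0 0 0 0 1)) :=
    isListed_lineRep 8
  have h₉ : IsListed ε u v W₀ (pencil (symMat 0 1 0 0 0 0) (symMat (-1) 0 0 (-1) 0 1)) :=
    isListed_lineRep 9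
  have h₁₀ : IsListed ε u v W₀ (pencil (symMat 0 1 0 0 0 0) (symMat (-ε) 0 0 (-ε) 0 1)) :=
    isListed_lineRep 10
  have h₁₁ : IsListed ε u v W₀ (pencil (symMat 0 1 0 0 0 0) (symMat (-1) 0 0 (-ε) 0 1)) :=
    isListed_lineRep 11
  obtain ⟨x, s, hx, hs, rfl⟩ := hform α
  obtain ⟨y, t, hy, ht, rfl⟩ := hform β
  apply hscale hs ht
  rcases hx with rfl | rfl | rfl <;> rcases hy with rfl | rfl | rfl <;> try rw [neg_zero]
  all_goals first | assumption | exact hswap ‹_›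

theorem isListedAt_hyperbolic (h2 : (2 : F) ≠ 0)
    (hsq : ∀ x : F, x ≠ 0 → ∃ s, s ≠ 0 ∧ (x = s ^ 2 ∨ x = ε * s ^ 2)) :
    IsListedAt ε u v W₀ (symMat 0 1 0 0 0 0) := by
  have h₀ {c d : F} (hc : c ≠ 0) :
      IsListed ε u v W₀ (pencil (symMat 0 1 0 0 0 0) (symMat 0 0 c d 0 0)) := by
    by_cases hd : d = 0
    · subst hd
      have h : IsListed ε u v W₀ (pencil (symMat 0 1 0 0 0 0) (symMat 0 0 1 0 0 0)) :=
        isListed_lineRep 6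
      exact h.of_congruence 1 0 0 0 1 0 0 0 1 1 0 0 c
        (by simp) (by simpa) (by and_intros <;> ring) (by and_intros <;> ring)
    · have h : IsListed ε u v W₀ (pencil (symMat 0 1 0 0 0 0) (symMat 0 0 1 1 0 0)) :=
        isListed_lineRep 13
      exact h.of_congruence d 0 0 0 c 0 0 0 c (d * c) 0 0 (c ^ 2 * d)
        (by simp [*]) (by simp [*]) (by and_intros <;> ring) (by and_intros <;> ring)
  have h₁ {a b c d : F} (hc : c ≠ 0) :
      IsListed ε u v W₀ (pencil (symMat 0 1 0 0 0 0) (symMat a b c d 0 0)) :=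
    (h₀ (c := 2 * c ^ 2) (d := d) (by simp [*])).of_congruence
      (2 * c) 0 (-a) 0 1 0 0 0 1 (2 * c) 0 (2 * b * c) 1
      (by simp [*]) (by simp [*]) (by and_intros <;> ring) (by and_intros <;> ring)
  have h₂ {a b d : F} (ha : a ≠ 0) :
      IsListed ε u v W₀ (pencil (symMat 0 1 0 0 0 0) (symMat a b 0 d 0 0)) := by
    by_cases hd : d = 0
    · subst hd
      have h : IsListed ε u v W₀ (pencil (symMat 1 0 0 0 0 0) (symMat 0 1 0 0 0 0)) :=
        isListed_lineRep 1
      exact h.of_congruence 1 0 0 0 1 0 0 0 1 0 1 a b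
        (by simp) (by simpa) (by and_intros <;> ring) (by and_intros <;> ring)
    · obtain ⟨s, hs, h⟩ := hsq (d / a) (by simp [*])
      rw [div_eq_iff ha, div_eq_iff ha] at h
      rcases h with rfl | rfl
      · have h : IsListed ε u v W₀ (pencil (symMat 1 0 0 0 0 0) (symMat 0 0 0 1 0 0)) :=
          isListed_lineRep 0
        exact h.of_congruence s 1 0 s (-1) 0 0 0 1 (2 * s) (-(2 * s))
          (2 * a * s ^ 2 + 2 * b * s) (2 * a * s ^ 2 - 2 * b * s)
          (ne_of_eq_of_ne (b := -(2 * s)) (by ring) (by simp [*]))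
          (ne_of_eq_of_ne (b := 2 * 2 * 2 * a * s ^ 3) (by ring) (by simp [*])) (by and_intros <;> ring) (by and_intros <;> ring)
      · have h : IsListed ε u v W₀ (pencil (symMat 1 0 0 ε 0 0) (symMat 0 1 0 0 0 0)) :=
          isListed_lineRep 5
        exact h.of_congruence s 0 0 0 1 0 0 0 1 0 s (a * s ^ 2) (b * s)
          (by simp [*]) (by simp [*]) (by and_intros <;> ring) (by and_intros <;> ring)
  have h₃ {a b c d e : F} (hc : c ≠ 0) (he : e ≠ 0) :
      IsListed ε u v W₀ (pencil (symMat 0 1 0 0 0 0) (symMat a b c d e 0)) := by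
    have h : IsListed ε u v W₀ (pencil (symMat 0 1 0 0 0 0) (symMat (-1) 0 0 0 0 1)) :=
      isListed_lineRep 7
    have h' : IsListed ε u v W₀ (pencil (symMat 0 1 0 0 0 0) (symMat 0 0 1 0 1 0)) :=
      h.of_congruence 1 1 0 0 0 1 1 (-1) 0 0 (-2) 2 0
        (ne_of_eq_of_ne (b := 2) (by ring) h2) (by simp [*])
        (by and_intros <;> ring) (by and_intros <;> ring)
    exact h'.of_congruence (2 * c * e ^ 2) 0 (-a * e ^ 2) 0 (2 * e * c ^ 2) (-d * c ^ 2) 0 0 1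
      (4 * c ^ 3 * e ^ 3) 0 (4 * b * c ^ 3 * e ^ 3 - 2 * c ^ 4 * e ^ 2 * d - 2 * a * e ^ 4 * c ^ 2)
      (2 * c ^ 2 * e ^ 2) (by simp [*])
      (ne_of_eq_of_ne (b := 2 * 2 * 2 * c ^ 5 * e ^ 5) (by ring) (by simp [*]))
      (by and_intros <;> ring) (by and_intros <;> ring)
  have hswap {a b c d e f : F}
      (h : IsListed ε u v W₀ (pencil (symMat 0 1 0 0 0 0) (symMat d b e a c f))) :
      IsListed ε u v W₀ (pencil (symMat 0 1 0 0 0 0) (symMat a b c d e f)) :=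
    h.of_congruence 0 1 0 1 0 0 0 0 1 1 0 0 1
      (by simp) (by simp) (by and_intros <;> ring) (by and_intros <;> ring)
  intro N hN
  obtain ⟨a, b, c, d, e, f, rfl⟩ := hN.exists_eq_symMat
  by_cases hf : f = 0
  · subst hf
    by_cases hc : c = 0 <;> by_cases he : e = 0
    · subst hc he
      by_cases ha : a = 0
      · subst ha
        by_cases hd : d = 0
        · subst hd
          refine isListed_of_dependent (-b) 1 (by simp) ?_
          simp [smul_symMat]
        · exact hswap (h₂ hd)
      · exact h₂ ha
    · subst hc
      exact hswap (h₁ he)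
    · subst he
      exact h₁ hc
    · exact h₃ hc he
  · have h : IsListed ε u v W₀ (pencil (symMat 0 1 0 0 0 0)
        (symMat (a * f ^ 2 - c ^ 2 * f) 0 0 (d * f ^ 2 - e ^ 2 * f) 0 f)) :=
      isListed_hyperbolic_diag hsq hf
    exact h.of_congruence f 0 (-c) 0 f (-e) 0 0 1 (f ^ 2) 0 (b * f ^ 2 - c * e * f) 1
      (by simp [*]) (by simp [*]) (by and_intros <;> ring) (by and_intros <;> ring)

/-- Binary forms with an isotropic vector. -/
theorem isListedAt_of_isotropic (h2 : (2 : F) ≠ 0)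
    (hsq : ∀ x : F, x ≠ 0 → ∃ s, s ≠ 0 ∧ (x = s ^ 2 ∨ x = ε * s ^ 2))
    {a b d s : F} (hs : s ≠ 0) (h : b ^ 2 - a * d = s ^ 2) :
    IsListedAt ε u v W₀ (symMat a b 0 d 0 0) := by
  have hH : IsListedAt ε u v W₀ (symMat 0 1 0 0 0 0) := isListedAt_hyperbolic h2 hsq
  by_cases ha : a = 0
  · subst ha
    have hb : b ≠ 0 := by
      rintro rfl
      exact pow_ne_zero 2 hs (by linear_combination -h)
    exact hH.of_congruence 1 0 0 (-d) (2 * b) 0 0 0 1 (2 * b ^ 2)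
      (by simp [*]) (by simp [*]) (by and_intros <;> ring)
  · refine hH.of_congruence (-b + s) a 0 (-b - s) a 0 0 0 1 (-2 * a * s ^ 2)
      (ne_of_eq_of_ne (b := 2 * a * s) (by ring) (by simp [*])) (by simp [*]) ?_
    and_intros
    · linear_combination (-a) * h
    · linear_combination (-a) * h
    · ring
    · linear_combination (-a) * h
    · ring
    · ring

theorem exists_sq_add_mul_sq (h2 : (2 : F) ≠ 0)
    (hsq : ∀ x : F, x ≠ 0 → ∃ s, s ≠ 0 ∧ (x = s ^ 2 ∨ x = ε * s ^ 2)) (hε : ε ≠ 0)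
    {a b k : F} (hk : k ≠ 0) (h : a ^ 2 - ε * b ^ 2 = k ^ 2) :
    ∃ p r : F, p ^ 2 + ε * r ^ 2 = a ∧ 2 * p * r = b := by
  wlog hak : a + k ≠ 0 generalizing k
  · rw [not_not] at hak
    refine this (neg_ne_zero.2 hk) (by rw [neg_sq]; exact h) fun h' => ?_
    exact mul_ne_zero h2 hk (by linear_combination hak - h')
  obtain ⟨s, hs, hs' | hs'⟩ := hsq ((a + k) / 2) (by simp [*]) <;> rw [div_eq_iff h2] at hs'
  · obtain ⟨r, rfl⟩ : ∃ r, b = 2 * s * r := ⟨b / (2 * s), by field_simp⟩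
    refine ⟨s, r, mul_left_cancel₀ (mul_ne_zero (pow_ne_zero 2 h2) (pow_ne_zero 2 hs)) ?_, rfl⟩
    linear_combination -h + (a - k - 2 * s ^ 2) * hs'
  · obtain ⟨r, rfl⟩ : ∃ r, b = 2 * s * r := ⟨b / (2 * s), by field_simp⟩
    refine ⟨r, s, mul_left_cancel₀
      (mul_ne_zero hε (mul_ne_zero (pow_ne_zero 2 h2) (pow_ne_zero 2 hs))) ?_, by ring⟩
    linear_combination -h + (a - k - 2 * ε * s ^ 2) * hs'

theorem IsListed.of_norm (h2 : (2 : F) ≠ 0)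
    (hsq : ∀ x : F, x ≠ 0 → ∃ s, s ≠ 0 ∧ (x = s ^ 2 ∨ x = ε * s ^ 2)) (hε : ε ≠ 0)
    {x y x' y' k : F} (hk : k ≠ 0) (h0 : ε * x ^ 2 - y ^ 2 ≠ 0)
    (hnorm : ε * x' ^ 2 - y' ^ 2 = k ^ 2 * (ε * x ^ 2 - y ^ 2))
    (h : IsListed ε u v W₀ (pencil (symMat 1 0 0 (-ε) 0 0) (symMat x' y' 0 (ε * x') 0 1))) :
    IsListed ε u v W₀ (pencil (symMat 1 0 0 (-ε) 0 0) (symMat x y 0 (ε * x) 0 1)) := by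
  obtain ⟨a, ha⟩ : ∃ a, a * (ε * x ^ 2 - y ^ 2) = ε * x' * x - y' * y := ⟨_, div_mul_cancel₀ _ h0⟩
  obtain ⟨b, hb⟩ : ∃ b, b * (ε * x ^ 2 - y ^ 2) = y' * x - x' * y := ⟨_, div_mul_cancel₀ _ h0⟩
  have hx : a * x + b * y = x' :=
    mul_right_cancel₀ h0 (by linear_combination x * ha + y * hb)
  have hy : a * y + b * ε * x = y' :=
    mul_right_cancel₀ h0 (by linear_combination y * ha + ε * x * hb)
  have hab : a ^ 2 - ε * b ^ 2 = k ^ 2 := by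
    subst hx hy
    exact mul_right_cancel₀ h0 (by linear_combination hnorm)
  obtain ⟨p, r, hpa, hpb⟩ := exists_sq_add_mul_sq h2 hsq hε hk hab
  have hp : p ^ 2 - ε * r ^ 2 ≠ 0 := by
    intro h0
    refine pow_ne_zero 2 hk ?_
    subst hpa hpb
    linear_combination -hab + (p ^ 2 - ε * r ^ 2) * h0
  refine h.of_congruence p r 0 (ε * r) p 0 0 0 1 (p ^ 2 - ε * r ^ 2) 0 0 1
    (ne_of_eq_of_ne (by ring) hp) (by simpa) (by and_intros <;> ring) ?_
  and_intros
  · linear_combination x * hpa + y * hpb + hx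
  · linear_combination y * hpa + ε * x * hpb + hy
  · ring
  · linear_combination ε * (x * hpa + y * hpb + hx)
  · ring
  · ring

theorem isListedAt_elliptic (h2 : (2 : F) ≠ 0)
    (hsq : ∀ x : F, x ≠ 0 → ∃ s, s ≠ 0 ∧ (x = s ^ 2 ∨ x = ε * s ^ 2))
    (hε : ∀ x y : F, x ^ 2 = ε * y ^ 2 → x = 0 ∧ y = 0)
    (huniv : ∀ a b : F, a ≠ 0 → b ≠ 0 → ∃ x y, a * x ^ 2 + b * y ^ 2 = 1)
    (huv : ε * u ^ 2 - v ^ 2 = 1) :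
    IsListedAt ε u v W₀ (symMat 1 0 0 (-ε) 0 0) := by
  have hε0 : ε ≠ 0 := by
    rintro rfl
    simpa using (hε 0 1 (by simp)).2
  have hnorm {x y : F} (h : ¬(x = 0 ∧ y = 0)) : ε * x ^ 2 - y ^ 2 ≠ 0 :=
    fun h' => h (hε y x (by linear_combination -h')).symm
  have h₁ : IsListed ε u v W₀ (pencil (symMat 1 0 0 (-ε) 0 0) (symMat 1 0 0 (ε * 1) 0 1)) := by
    obtain ⟨s, hs, h | h⟩ := hsq (-2) (by simpa)
    · have h := isListedAt_of_isotropic (u := u) (v := v) (W₀ := W₀) h2 hsq hs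
        (a := 2) (b := 0) (d := 1) (by linear_combination h) (symMat 1 0 0 0 0 (-ε))
        (symMat_isSymm ..)
      exact h.of_congruence 1 0 0 0 0 1 0 1 0 0 1 1 (-1)
        (by simp) (by simp) (by and_intros <;> ring) (by and_intros <;> ring)
    · have h := isListedAt_of_isotropic (u := u) (v := v) (W₀ := W₀) h2 hsq (mul_ne_zero hε0 hs)
        (a := 2 * ε) (b := 0) (d := 1) (by linear_combination ε * h) (symMat (-ε) 0 0 0 0 1)
        (symMat_isSymm ..)
      exact h.of_congruence 0 1 0 0 0 1 1 0 0 0 1 1 1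
        (by simp) (by simp) (by and_intros <;> ring) (by and_intros <;> ring)
  have h₂ (x y : F) :
      IsListed ε u v W₀ (pencil (symMat 1 0 0 (-ε) 0 0) (symMat x y 0 (ε * x) 0 1)) := by
    by_cases h0 : x = 0 ∧ y = 0
    · obtain ⟨rfl, rfl⟩ := h0
      have h : IsListed ε u v W₀ (pencil (symMat 1 0 0 0 0 0) (symMat 0 0 0 1 0 (-ε))) :=
        isListed_lineRep 3
      exact h.of_congruence 0 0 1 1 0 0 0 1 0 0 1 1 0
        (by simp) (by simp) (by and_intros <;> ring) (by and_intros <;> ring)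
    · obtain ⟨s, hs, h | h⟩ := hsq _ (hnorm h0)
      · have h₁₂ : IsListed ε u v W₀
            (pencil (symMat 1 0 0 (-ε) 0 0) (symMat u v 0 (ε * u) 0 1)) := isListed_lineRep 12
        exact h₁₂.of_norm h2 hsq hε0 (inv_ne_zero hs) (hnorm h0) (by rw [h, huv]; field_simp)
      · exact h₁.of_norm h2 hsq hε0 (inv_ne_zero hs) (hnorm h0) (by rw [h]; field_simp; ring)
  have h₃ (a b d : F) :
      IsListed ε u v W₀ (pencil (symMat 1 0 0 (-ε) 0 0) (symMat a b 0 d 0 0)) := by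
    obtain ⟨x, hx⟩ : ∃ x, x * (2 * ε) = ε * a + d :=
      ⟨_, div_mul_cancel₀ _ (mul_ne_zero h2 hε0)⟩
    suffices h : IsListed ε u v W₀ (pencil (symMat 1 0 0 (-ε) 0 0) (symMat x b 0 (ε * x) 0 0)) by
      refine h.of_congruence 1 0 0 0 1 0 0 0 1 1 0 (a - x) 1
        (by simp) (by simp) (by and_intros <;> ring) ?_
      and_intros <;> first | ring1 | linear_combination -hx
    by_cases h0 : x = 0 ∧ b = 0
    · obtain ⟨rfl, rfl⟩ := h0
      refine isListed_of_dependent 0 1 (by simp) ?_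
      simp [symMat_zero]
    · obtain ⟨s, t, hst⟩ := huniv ε _ hε0 (neg_ne_zero.2 (hnorm h0))
      have ht : t ≠ 0 := by
        rintro rfl
        exact one_ne_zero (hε (ε * s) 1 (by linear_combination ε * hst)).2
      have h := isListedAt_of_isotropic (u := u) (v := v) (W₀ := W₀) h2 hsq one_ne_zero
        (a := s + t * x) (b := t * b) (d := ε * (t * x - s)) (by linear_combination hst)
        (symMat 1 0 0 (-ε) 0 0) (symMat_isSymm ..)
      exact h.of_congruence 1 0 0 0 1 0 0 0 1 0 1 t⁻¹ (-t⁻¹ * s)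
        (by simp) (by simpa) (by and_intros <;> ring) (by and_intros <;> field_simp <;> ring)
  have h₄ {a b c d : F} (hc : c ≠ 0) :
      IsListed ε u v W₀ (pencil (symMat 1 0 0 (-ε) 0 0) (symMat a b c d 0 0)) := by
    obtain ⟨k, rfl⟩ : ∃ k, ε * k = d := ⟨_, mul_div_cancel₀ _ hε0⟩
    have h := isListedAt_hyperbolic (u := u) (v := v) (W₀ := W₀) h2 hsq
      (symMat 1 0 0 0 0 (-ε)) (symMat_isSymm ..)
    exact h.of_congruence (2 * c) 0 (-(a + k)) 0 0 1 0 (2 * c) (-2 * b)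
      0 (4 * c ^ 2) (2 * c ^ 2) (-4 * c ^ 2 * k) (by simp [*])
      (ne_of_eq_of_ne (b := -2 * 2 * 2 * c ^ 4) (by ring) (by simp [*]))
      (by and_intros <;> ring) (by and_intros <;> ring)
  intro N hN
  obtain ⟨a, b, c, d, e, f, rfl⟩ := hN.exists_eq_symMat
  by_cases hf : f = 0
  · subst hf
    by_cases h0 : c = 0 ∧ e = 0
    · obtain ⟨rfl, rfl⟩ := h0
      exact h₃ a b d
    · have hc := hnorm h0
      exact (h₄ hc).of_congruence (ε * c) (-e) 0 (-ε * e) (ε * c) 0 0 0 1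
        (ε * (ε * c ^ 2 - e ^ 2)) 0 0 1
        (a := 1) (a' := a) (d' := d) (b' := b)
        (ne_of_eq_of_ne (b := ε * (ε * c ^ 2 - e ^ 2)) (by ring) (mul_ne_zero hε0 hc))
        (by simp [hε0, hc])
        (by and_intros <;> ring)
        (a₂ := a * (ε * c) ^ 2 + d * e ^ 2 - 2 * b * ε * c * e)
        (b₂ := -a * ε ^ 2 * c * e - d * ε * c * e + b * (ε ^ 2 * c ^ 2 + ε * e ^ 2))
        (d₂ := a * ε ^ 2 * e ^ 2 + d * ε ^ 2 * c ^ 2 - 2 * b * ε ^ 2 * c * e)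
        (by and_intros <;> ring)
  · obtain ⟨x, hx⟩ : ∃ x, x * (2 * ε) = ε * (a * f - c ^ 2) + (d * f - e ^ 2) :=
      ⟨_, div_mul_cancel₀ _ (mul_ne_zero h2 hε0)⟩
    refine (h₂ x (b * f - c * e)).of_congruence f 0 (-c) 0 f (-e) 0 0 1
      (f ^ 2) 0 (f * (a * f - c ^ 2) - f * x) f (by simp [hf]) (by simp [hf])
      (by and_intros <;> ring) ?_
    and_intros <;> first | ring1 | linear_combination (-f) * hx

theorem isListedAt_diag (h2 : (2 : F) ≠ 0)
    (hsq : ∀ x : F, x ≠ 0 → ∃ s, s ≠ 0 ∧ (x = s ^ 2 ∨ x = ε * s ^ 2))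
    (hε : ∀ x y : F, x ^ 2 = ε * y ^ 2 → x = 0 ∧ y = 0)
    (huniv : ∀ a b : F, a ≠ 0 → b ≠ 0 → ∃ x y, a * x ^ 2 + b * y ^ 2 = 1)
    (huv : ε * u ^ 2 - v ^ 2 = 1) {a d : F} (ha : a ≠ 0) :
    IsListedAt ε u v W₀ (symMat a 0 0 d 0 0) := by
  by_cases hd : d = 0
  · subst hd
    exact (isListedAt_unit h2 hsq).of_congruence 1 0 0 0 1 0 0 0 1 a
      (by simp) ha (by and_intros <;> ring)
  · obtain ⟨s, hs, h | h⟩ := hsq (-a * d) (by simp [*])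
    · exact isListedAt_of_isotropic h2 hsq hs (by linear_combination h)
    · refine (isListedAt_elliptic h2 hsq hε huniv huv).of_congruence s 0 0 0 a 0 0 0 1 (a * s ^ 2)
        (by simp [*]) (by simp [*]) ?_
      and_intros <;> first | ring1 | linear_combination (-a) * h

theorem isListedAt_of_det_eq_zero (h2 : (2 : F) ≠ 0)
    (hsq : ∀ x : F, x ≠ 0 → ∃ s, s ≠ 0 ∧ (x = s ^ 2 ∨ x = ε * s ^ 2))
    (hε : ∀ x y : F, x ^ 2 = ε * y ^ 2 → x = 0 ∧ y = 0)
    (huniv : ∀ a b : F, a ≠ 0 → b ≠ 0 → ∃ x y, a * x ^ 2 + b * y ^ 2 = 1)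
    (huv : ε * u ^ 2 - v ^ 2 = 1) {M : Matrix (Fin 3) (Fin 3) F} (hM : M.IsSymm) (h0 : M ≠ 0)
    (hdet : M.det = 0) : IsListedAt ε u v W₀ M := by
  have hdiag {a d : F} (ha : a ≠ 0) : IsListedAt ε u v W₀ (symMat a 0 0 d 0 0) :=
    isListedAt_diag h2 hsq hε huniv huv ha
  have h₁ {a d e f : F} (ha : a ≠ 0) (h : d * f = e ^ 2) :
      IsListedAt ε u v W₀ (symMat a 0 0 d e f) := by
    by_cases hd : d = 0
    · subst hd
      obtain rfl : e = 0 := by simpa using h.symm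
      exact (hdiag (d := f) ha).of_congruence 1 0 0 0 0 1 0 1 0 1
        (by simp) (by simp) (by and_intros <;> ring)
    · refine (hdiag (d := d) ha).of_congruence 1 0 0 0 1 0 0 (-e) d 1
        (by simp [*]) (by simp) ?_
      and_intros <;> first | ring1 | linear_combination d * h
  have h₂ {a b c d e f : F} (ha : a ≠ 0) (h : (symMat a b c d e f).det = 0) :
      IsListedAt ε u v W₀ (symMat a b c d e f) := by
    rw [det_symMat] at h
    have h' := h₁ (a := a) (d := a * (a * d - b ^ 2)) (e := a * (a * e - b * c))
      (f := a * (a * f - c ^ 2)) ha (by linear_combination a ^ 3 * h)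
    exact h'.of_congruence 1 0 0 (-b) a 0 (-c) 0 a 1 (by simp [*]) (by simp)
      (by and_intros <;> ring)
  have h₃ {a b c d e f : F} (hb : b ≠ 0) (h : (symMat a b c d e f).det = 0) :
      IsListedAt ε u v W₀ (symMat a b c d e f) := by
    rw [det_symMat] at h
    by_cases ha : a = 0
    · by_cases hd : d = 0
      · subst ha hd
        refine (h₂ (a := 2 * b) (b := b) (c := c + e) (d := 0) (e := e) (f := f) (by simp [*])
          (by rw [det_symMat]; linear_combination h)).of_congruence 1 1 0 0 1 0 0 0 1 1
          (by simp) (by simp) (by and_intros <;> ring)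
      · exact (h₂ (b := b) (c := e) (d := a) (e := c) (f := f) hd
          (by rw [det_symMat]; linear_combination h)).of_congruence 0 1 0 1 0 0 0 0 1 1
          (by simp) (by simp) (by and_intros <;> ring)
    · exact h₂ ha (by rw [det_symMat]; exact h)
  obtain ⟨a, b, c, d, e, f, rfl⟩ := hM.exists_eq_symMat
  rw [Ne, symMat_eq_zero] at h0
  have hdet' := hdet
  rw [det_symMat] at hdet'
  by_cases ha : a = 0
  · by_cases hb : b = 0
    · by_cases hc : c = 0
      · by_cases hd : d = 0
        · by_cases he : e = 0
          · exact (h₂ (a := f) (b := e) (c := c) (d := d) (e := b) (f := a) (by tauto)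
              (by rw [det_symMat]; linear_combination hdet')).of_congruence 0 0 1 0 1 0 1 0 0 1
              (by simp) (by simp) (by and_intros <;> ring)
          · exact (h₃ (a := f) (b := e) (c := c) (d := d) (e := b) (f := a) he
              (by rw [det_symMat]; linear_combination hdet')).of_congruence 0 0 1 0 1 0 1 0 0 1
              (by simp) (by simp) (by and_intros <;> ring)
        · exact (h₂ (a := d) (b := b) (c := e) (d := a) (e := c) (f := f) hd
            (by rw [det_symMat]; linear_combination hdet')).of_congruence 0 1 0 1 0 0 0 0 1 1
            (by simp) (by simp) (by and_intros <;> ring)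
      · exact (h₃ (a := a) (b := c) (c := b) (d := f) (e := e) (f := d) hc
          (by rw [det_symMat]; linear_combination hdet')).of_congruence 1 0 0 0 0 1 0 1 0 1
          (by simp) (by simp) (by and_intros <;> ring)
    · exact h₃ hb hdet
  · exact h₂ ha hdet

theorem exists_kEquiv_lineRep (h2 : (2 : F) ≠ 0)
    (hsq : ∀ x : F, x ≠ 0 → ∃ s, s ≠ 0 ∧ (x = s ^ 2 ∨ x = ε * s ^ 2))
    (hε : ∀ x y : F, x ^ 2 = ε * y ^ 2 → x = 0 ∧ y = 0)
    (huniv : ∀ a b : F, a ≠ 0 → b ≠ 0 → ∃ x y, a * x ^ 2 + b * y ^ 2 = 1)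
    (huv : ε * u ^ 2 - v ^ 2 = 1) {W : Submodule F (Matrix (Fin 3) (Fin 3) F)}
    (hW : ∀ M ∈ W, M.IsSymm) (hdim : Module.finrank F W = 2) {M : Matrix (Fin 3) (Fin 3) F}
    (hM : M ∈ W) (h0 : M ≠ 0) (hdet : M.det = 0) : ∃ i, KEquiv F W (lineRep ε u v W₀ i) := by
  obtain ⟨N, hN, -, rfl⟩ := exists_eq_pencil hdim hM h0
  exact isListedAt_of_det_eq_zero h2 hsq hε huniv huv (hW M hM) h0 hdet N (hW N hN) hdim

end Completeness
end Pencils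

section FiniteFields

variable {F : Type*} [Field F] [Fintype F]

theorem exists_mul_sq_add_mul_sq_eq_one (hodd : Odd (Fintype.card F)) {a b : F} (ha : a ≠ 0)
    (hb : b ≠ 0) : ∃ x y, a * x ^ 2 + b * y ^ 2 = 1 := by
  obtain ⟨x, y, h⟩ := FiniteField.exists_root_sum_quadratic
    (Polynomial.degree_quadratic (b := 0) (c := -1) ha)
    (Polynomial.degree_quadratic (b := 0) (c := 0) hb) (Nat.odd_iff.1 hodd)
  refine ⟨x, y, ?_⟩
  simp only [Polynomial.eval_add, Polynomial.eval_mul, Polynomial.eval_C, Polynomial.eval_pow,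
    Polynomial.eval_X] at h
  linear_combination h

theorem eq_sq_or_eq_mul_sq {ε : F} (hε : ¬IsSquare ε) {x : F} (hx : x ≠ 0) :
    ∃ s, s ≠ 0 ∧ (x = s ^ 2 ∨ x = ε * s ^ 2) := by
  classical
  have hε0 : ε ≠ 0 := fun h => hε (h ▸ IsSquare.zero)
  by_cases h : IsSquare x
  · obtain ⟨s, rfl⟩ := h
    exact ⟨s, left_ne_zero_of_mul hx, .inl (sq s).symm⟩
  · have hxε : quadraticChar F (x * ε) = 1 := by
      rw [map_mul, quadraticChar_neg_one_iff_not_isSquare.2 h,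
        quadraticChar_neg_one_iff_not_isSquare.2 hε]
      rfl
    obtain ⟨r, hr⟩ := (quadraticChar_one_iff_isSquare (mul_ne_zero hx hε0)).1 hxε
    have hr0 : r ≠ 0 := left_ne_zero_of_mul (hr ▸ mul_ne_zero hx hε0)
    refine ⟨r / ε, div_ne_zero hr0 hε0, .inr ?_⟩
    field_simp
    linear_combination hr

theorem sq_eq_mul_sq_of_not_isSquare {F : Type*} [Field F] {ε : F} (hε : ¬IsSquare ε) {x y : F}
    (h : x ^ 2 = ε * y ^ 2) : x = 0 ∧ y = 0 := by
  by_cases hy : y = 0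
  · subst hy
    exact ⟨by simpa using h, rfl⟩
  · refine absurd ⟨x / y, ?_⟩ hε
    field_simp
    exact h.symm

end FiniteFields

/-- There are exactly 15 `K`-equivalence classes of 2-dimensional subspaces of the space
of symmetric `3 × 3` matrices over a finite field `F` of odd order
(i.e. 15 orbits of lines of `PG(5,q)` under `PGL(3,q) ≤ PGL(6,q)`). -/
theorem fifteen_orbits_of_lines (F : Type*) [Field F] [Fintype F]
    (hodd : Odd (Fintype.card F)) :
    ∃ R : Fin 15 → Submodule F (Matrix (Fin 3) (Fin 3) F),
      (∀ i, (∀ M ∈ R i, M.IsSymm) ∧ Module.finrank F ↥(R i) = 2) ∧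
      (∀ i j, KEquiv F (R i) (R j) → i = j) ∧
      (∀ W : Submodule F (Matrix (Fin 3) (Fin 3) F),
        (∀ M ∈ W, M.IsSymm) → Module.finrank F ↥W = 2 →
        ∃ i, KEquiv F W (R i)) := by
  have hchar : ringChar F ≠ 2 := fun h => Nat.not_even_iff_odd.2 hodd
    (Nat.even_iff.2 (FiniteField.even_card_iff_char_two.1 h))
  have h2 : (2 : F) ≠ 0 := Ring.two_ne_zero hchar
  obtain ⟨ε, hεsq⟩ := FiniteField.exists_nonsquare hchar
  have hε (x y : F) (h : x ^ 2 = ε * y ^ 2) := sq_eq_mul_sq_of_not_isSquare hεsq h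
  have hε0 : ε ≠ 0 := fun h => hεsq (h ▸ IsSquare.zero)
  have hsq (x : F) (hx : x ≠ 0) := eq_sq_or_eq_mul_sq hεsq hx
  have huniv (a b : F) (ha : a ≠ 0) (hb : b ≠ 0) := exists_mul_sq_add_mul_sq_eq_one hodd ha hb
  obtain ⟨u, v, huv⟩ := huniv ε (-1) hε0 (by simp)
  replace huv : ε * u ^ 2 - v ^ 2 = 1 := by linear_combination huv
  have hrep : ∃ x y : F, ε * x ^ 2 - y ^ 2 = -ε := by
    obtain ⟨x, y, h⟩ := huniv (-1) ε⁻¹ (by simp) (inv_ne_zero hε0)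
    refine ⟨x, y, ?_⟩
    field_simp at h
    linear_combination -h
  obtain ⟨p, hp⟩ := CharP.exists F
  have : Fact p.Prime := ⟨CharP.char_is_prime F p⟩
  let b : Module.Basis (Fin 3) F (FiniteField.Extension F p 3) :=
    Module.finBasisOfFinrankEq _ _ (FiniteField.finrank_extension F p 3)
  refine ⟨lineRep ε u v (anisotropicPencil b), fun i => ⟨lineRep_isSymm
    (anisotropicPencil_isSymm b) i, finrank_lineRep (finrank_anisotropicPencil b) i⟩,
    fun i j h => ?_, fun W hsymm hdim => ?_⟩
  · have hindex := lineIndex_lineRep h2 hε hrep huv (finrank_anisotropicPencil b)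
      (det_ne_zero_of_mem_anisotropicPencil b)
    rw [← hindex i, ← hindex j, lineIndex_congr h]
  · by_cases hdet : ∀ M ∈ W, M.det = 0 → M = 0
    · exact ⟨14, kEquiv_anisotropicPencil b (by rwa [Nat.card_eq_fintype_card]) hsymm hdim hdet⟩
    · push Not at hdet
      obtain ⟨M, hM, hdet, h0⟩ := hdet
      exact exists_kEquiv_lineRep h2 hsq hε huniv huv hsymm hdim hM h0 hdet
end

section
/- Let q be an odd prime power, F = F_q, and let M be a symmetric 3×3 matrix over F. Then there exists an invertible matrix A ∈ GL(3,F) with A M Aᵀ = diag(1,−1,0) if and only if det M = 0 and the three elements −det(M₁₁(M)), −det(M₂₂(M)), −det(M₃₃(M)) are all squares in F with at least one of them nonzero, where Mᵢᵢ(M) denotes the 2×2 matrix obtained from M by deleting its i-th row and i-th column. -/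
open Matrix

/-- The `2 × 2` matrix obtained from a `3 × 3` matrix by deleting its `i`-th row and
`i`-th column. -/
def delRowCol {F : Type*} (M : Matrix (Fin 3) (Fin 3) F) (i : Fin 3) :
    Matrix (Fin 2) (Fin 2) F :=
  M.submatrix i.succAbove i.succAbove

/-- A nondegenerate binary quadratic form whose negated determinant is a square is congruent to
`diag(1, -1)`. -/
theorem exists_hyperbolic_basis {F : Type*} [Field F] (h2 : (2 : F) ≠ 0) {a b c s : F}
    (hs : s ≠ 0) (h : b * b - a * c = s * s) :
    ∃ x y z w : F, a * x * x + 2 * b * x * y + c * y * y = 1 ∧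
      a * z * z + 2 * b * z * w + c * w * w = -1 ∧
      a * x * z + b * (x * w + y * z) + c * y * w = 0 ∧ x * w - y * z ≠ 0 := by
  obtain ⟨x, y, z, w, hx, hz, hxz⟩ : ∃ x y z w : F,
      a * x * x + 2 * b * x * y + c * y * y = 1 ∧
      a * z * z + 2 * b * z * w + c * w * w = -1 ∧
      a * x * z + b * (x * w + y * z) + c * y * w = 0 := by
    -- It suffices to combine two isotropic vectors that are not orthogonal.
    obtain ⟨k, l, m, n, β, hβ, hk, hm, hkm⟩ : ∃ k l m n β : F, β ≠ 0 ∧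
        a * k * k + 2 * b * k * l + c * l * l = 0 ∧
        a * m * m + 2 * b * m * n + c * n * n = 0 ∧
        a * k * m + b * (k * n + l * m) + c * l * n = β := by
      by_cases ha : a = 0
      · subst ha
        have hb : b ≠ 0 := by
          rintro rfl
          exact hs (mul_self_eq_zero.mp (by linear_combination -h))
        exact ⟨1, 0, -c, 2 * b, 2 * b * b, mul_ne_zero (mul_ne_zero h2 hb) hb,
          by ring, by ring, by ring⟩
      · refine ⟨-(b + s), a, -(b - s), a, -(2 * a * (s * s)), ?_, ?_, ?_, ?_⟩
        · exact neg_ne_zero.mpr (mul_ne_zero (mul_ne_zero h2 ha) (mul_ne_zero hs hs))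
        · linear_combination -a * h
        · linear_combination -a * h
        · linear_combination -a * h
    obtain ⟨t, ht⟩ : ∃ t : F, 2 * t * β = 1 := ⟨(2 * β)⁻¹, by field_simp⟩
    refine ⟨k + t * m, l + t * n, k - t * m, l - t * n, ?_, ?_, ?_⟩
    · linear_combination hk + t ^ 2 * hm + 2 * t * hkm + ht
    · linear_combination hk + t ^ 2 * hm - 2 * t * hkm - ht
    · linear_combination hk - t ^ 2 * hm
  refine ⟨x, y, z, w, hx, hz, hxz, fun hd => ?_⟩
  have : (1 : F) = 0 := by
    linear_combination (s * s) * (x * w - y * z) * hd + (x * w - y * z) ^ 2 * h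
      + (a * z * z + 2 * b * z * w + c * w * w) * hx + hz
      - (a * x * z + b * (x * w + y * z) + c * y * w) * hxz
  exact one_ne_zero this

theorem delRowCol_det {F : Type*} [CommRing F] (M : Matrix (Fin 3) (Fin 3) F) (i : Fin 3) :
    (delRowCol M i).det =
      M (i.succAbove 0) (i.succAbove 0) * M (i.succAbove 1) (i.succAbove 1) -
        M (i.succAbove 0) (i.succAbove 1) * M (i.succAbove 1) (i.succAbove 0) := by
  simp [delRowCol, det_fin_two]

/-- The Gram matrix of `diag(1, -1, 0)` has negated principal minors equal to the squares of the
`2 × 2` minors of the first two columns. -/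
theorem neg_det_delRowCol_mul_diagonal {F : Type*} [CommRing F]
    (B : Matrix (Fin 3) (Fin 3) F) (i : Fin 3) :
    -(delRowCol (B * diagonal ![1, -1, 0] * Bᵀ) i).det =
      (B (i.succAbove 0) 0 * B (i.succAbove 1) 1 - B (i.succAbove 0) 1 * B (i.succAbove 1) 0) *
      (B (i.succAbove 0) 0 * B (i.succAbove 1) 1 -
        B (i.succAbove 0) 1 * B (i.succAbove 1) 0) := by
  rw [delRowCol_det]
  simp only [mul_apply, Fin.sum_univ_three, transpose_apply, diagonal_apply]
  simp
  ring

/-- A singular symmetric `3 × 3` matrix over a field of characteristic not two is congruent to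
`diag(1, -1, 0)` as soon as the negative of some principal `2 × 2` minor is a nonzero square. -/
theorem exists_congruent_diagonal {F : Type*} [Field F] (h2 : (2 : F) ≠ 0)
    {M : Matrix (Fin 3) (Fin 3) F} (hM : M.IsSymm) (hdet : M.det = 0) (i : Fin 3)
    (hsq : IsSquare (-(delRowCol M i).det)) (hne : -(delRowCol M i).det ≠ 0) :
    ∃ A : Matrix (Fin 3) (Fin 3) F, IsUnit A ∧ A * M * Aᵀ = diagonal ![1, -1, 0] := by
  obtain ⟨s, hs⟩ := hsq
  have hs0 : s ≠ 0 := by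
    rintro rfl
    exact hne (by simpa using hs)
  have h10 := hM.apply 0 1
  have h20 := hM.apply 0 2
  have h21 := hM.apply 1 2
  rw [delRowCol_det, hM.apply (i.succAbove 0) (i.succAbove 1)] at hs
  obtain ⟨x, y, z, w, hx, hz, hxz, hd⟩ := exists_hyperbolic_basis h2 hs0
    (a := M (i.succAbove 0) (i.succAbove 0)) (b := M (i.succAbove 0) (i.succAbove 1))
    (c := M (i.succAbove 1) (i.succAbove 1)) (by linear_combination hs)
  rw [det_fin_three, h10, h20, h21] at hdet
  have key : ∀ A : Matrix (Fin 3) (Fin 3) F, A.det ≠ 0 →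
      (∀ j k, (A * M * Aᵀ) j k = diagonal ![1, -1, 0] j k) →
      ∃ A : Matrix (Fin 3) (Fin 3) F, IsUnit A ∧ A * M * Aᵀ = diagonal ![1, -1, 0] :=
    fun A hA hE => ⟨A, (isUnit_iff_isUnit_det A).mpr hA.isUnit, Matrix.ext hE⟩
  have hss := mul_ne_zero hs0 hs0
  -- The last row of each matrix spans the kernel of `M`.
  fin_cases i <;> simp [Fin.succAbove] at hs hx hz hxz
  · refine key !![0, x, y; 0, z, w; M 1 1 * M 2 2 - M 1 2 * M 1 2, M 0 2 * M 1 2 - M 0 1 * M 2 2,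
      M 0 1 * M 1 2 - M 0 2 * M 1 1] ?_ ?_
    · rw [det_fin_three]
      simp
      intro h0
      apply mul_ne_zero hd hss
      linear_combination -h0 - (x * w - y * z) * hs
    · intro j k
      simp only [mul_apply, Fin.sum_univ_three, transpose_apply]
      fin_cases j <;> fin_cases k <;> simp [h10, h20, h21]
      all_goals grind
  · refine key !![x, 0, y; z, 0, w; M 0 2 * M 1 2 - M 0 1 * M 2 2, M 0 0 * M 2 2 - M 0 2 * M 0 2,
      M 0 1 * M 0 2 - M 0 0 * M 1 2] ?_ ?_
    · rw [det_fin_three]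
      simp
      intro h0
      apply mul_ne_zero hd hss
      linear_combination h0 - (x * w - y * z) * hs
    · intro j k
      simp only [mul_apply, Fin.sum_univ_three, transpose_apply]
      fin_cases j <;> fin_cases k <;> simp [h10, h20, h21]
      all_goals grind
  · refine key !![x, y, 0; z, w, 0; M 0 1 * M 1 2 - M 0 2 * M 1 1, M 0 1 * M 0 2 - M 0 0 * M 1 2,
      M 0 0 * M 1 1 - M 0 1 * M 0 1] ?_ ?_
    · rw [det_fin_three]
      simp
      intro h0
      apply mul_ne_zero hd hss
      linear_combination -h0 - (x * w - y * z) * hs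
    · intro j k
      simp only [mul_apply, Fin.sum_univ_three, transpose_apply]
      fin_cases j <;> fin_cases k <;> simp [h10, h20, h21]
      all_goals grind

/-- Criterion for a symmetric `3 × 3` matrix over a finite field of odd order to be
congruent to `diag(1, −1, 0)`: this happens if and only if `det M = 0`, the negatives of the
three principal `2 × 2` minors `−det(Mᵢᵢ(M))` are all squares, and at least one of them is
nonzero. -/
theorem congruent_to_diag_one_negone_zero_iff (F : Type*) [Field F] [Fintype F]
    (hodd : Odd (Fintype.card F))
    (M : Matrix (Fin 3) (Fin 3) F) (hM : M.IsSymm) :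
    (∃ A : Matrix (Fin 3) (Fin 3) F, IsUnit A ∧ A * M * Aᵀ = diagonal ![1, -1, 0]) ↔
      (M.det = 0 ∧
        (∀ i : Fin 3, IsSquare (-(delRowCol M i).det)) ∧
        (∃ i : Fin 3, -(delRowCol M i).det ≠ 0)) := by
  have h2 : (2 : F) ≠ 0 := by
    apply Ring.two_ne_zero
    intro hc
    have := FiniteField.even_card_of_char_two hc
    grind
  constructor
  · rintro ⟨A, hA, hE⟩
    have hdA : IsUnit A.det := (isUnit_iff_isUnit_det A).mp hA
    have hMB : M = A⁻¹ * diagonal ![1, -1, 0] * A⁻¹ᵀ := by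
      rw [← hE, mul_assoc A, nonsing_inv_mul_cancel_left _ _ hdA, mul_assoc, ← transpose_mul,
        nonsing_inv_mul _ hdA, transpose_one, mul_one]
    have hdB : (A⁻¹).det ≠ 0 := (isUnit_nonsing_inv_det A hdA).ne_zero
    generalize A⁻¹ = B at hMB hdB
    subst hMB
    refine ⟨by simp [Fin.prod_univ_three], fun i => ⟨_, neg_det_delRowCol_mul_diagonal B i⟩, ?_⟩
    by_contra! hall
    simp only [neg_det_delRowCol_mul_diagonal, mul_self_eq_zero] at hall
    have h0 := hall 0
    have h1 := hall 1
    have h2 := hall 2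
    simp [Fin.succAbove] at h0 h1 h2
    apply hdB
    rw [det_fin_three]
    linear_combination B 0 2 * h0 - B 1 2 * h1 + B 2 2 * h2
  · rintro ⟨hdet, hsq, i, hne⟩
    exact exists_congruent_diagonal h2 hM hdet i (hsq i) hne
end

section
/- Let F be a field and let A be a 3×3 matrix whose entries are homogeneous linear polynomials in three variables X₀, X₁, X₂ over F. If v ∈ F³ is such that the 3×3 matrix over F obtained by evaluating every entry of A at v has rank exactly 1, then all three partial derivatives ∂(det A)/∂X₀, ∂(det A)/∂X₁, ∂(det A)/∂X₂ vanish when evaluated at v. In other words, every point at which A has rank 1 is a singular point of the cubic curve defined by det A = 0. -/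
open Matrix MvPolynomial

/-- A matrix of rank at most one over a field is an outer product of two vectors. -/
theorem Matrix.exists_eq_vecMulVec_of_rank_le_one {m n K : Type*} [Finite m] [Fintype n]
    [Field K] (M : Matrix m n K) (hM : M.rank ≤ 1) :
    ∃ (w : m → K) (c : n → K), M = vecMulVec w c := by
  classical
  obtain ⟨w, hw⟩ := finrank_le_one_iff.mp hM
  choose c hc using fun j : n => hw ⟨M.mulVecLin (Pi.single j 1), LinearMap.mem_range_self _ _⟩
  refine ⟨w, c, ?_⟩
  ext i j
  have h := congrFun (congrArg Subtype.val (hc j)) i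
  simp only [Submodule.coe_smul, Pi.smul_apply, smul_eq_mul, mulVecLin_apply,
    mulVec_single_one, col_apply] at h
  rw [vecMulVec_apply, ← h, mul_comm]

/-- Let `A` be a `3 × 3` matrix whose entries are homogeneous linear polynomials in
`X₀, X₁, X₂` over a field `F`. If evaluating `A` at a point `v ∈ F³` yields a matrix of
rank exactly 1, then all three partial derivatives of `det A` vanish at `v`; that is,
`v` is a singular point of the cubic curve `det A = 0`. -/
theorem rank_one_point_is_singular_point_of_det_cubic (F : Type*) [Field F]
    (A : Matrix (Fin 3) (Fin 3) (MvPolynomial (Fin 3) F))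
    (hA : ∀ i j, (A i j).IsHomogeneous 1)
    (v : Fin 3 → F)
    (hrank : (A.map (MvPolynomial.eval v)).rank = 1) :
    ∀ k : Fin 3, MvPolynomial.eval v (MvPolynomial.pderiv k A.det) = 0 := by
  intro k
  obtain ⟨w, c, h⟩ := exists_eq_vecMulVec_of_rank_le_one _ hrank.le
  have hentry (i j : Fin 3) : eval v (A i j) = w i * c j := congrFun (congrFun h i) j
  simp only [det_fin_three, map_add, map_sub, Derivation.leibniz, smul_eq_mul, map_mul, hentry]
  ring
end

section
/- Let q be an odd prime power and F = F_q. Let W₁ = {[[a,c,0],[c,b,0],[0,0,0]] : a,b,c ∈ F} (the symmetric matrices whose third row and column are zero) and W₂ = {diag(a,b,c) : a,b,c ∈ F} (the diagonal matrices). Then W₁ has point-orbit distribution [q+1, q(q+1)/2, q(q−1)/2, 0] and W₂ has point-orbit distribution [3, 3(q−1)/2, 3(q−1)/2, (q−1)²]. -/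
open Matrix

/-- The number of points (1-dimensional subspaces) contained in a set `S` of `3 × 3`
matrices whose (nonzero) spanning matrices satisfy the property `P`. -/
noncomputable def ptsWith (F : Type*) [Field F] (S : Set (Matrix (Fin 3) (Fin 3) F))
    (P : Matrix (Fin 3) (Fin 3) F → Prop) : ℕ :=
  Set.ncard {p : Submodule F (Matrix (Fin 3) (Fin 3) F) |
    ↑p ⊆ S ∧ Module.finrank F ↥p = 1 ∧ ∃ M ∈ p, M ≠ 0 ∧ P M}

/-- A matrix is exterior if it is congruent to `diag(1, −1, 0)`. -/
def Exterior {F : Type*} [Field F] (M : Matrix (Fin 3) (Fin 3) F) : Prop :=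
  ∃ A : Matrix (Fin 3) (Fin 3) F, IsUnit A ∧ A * M * Aᵀ = diagonal ![1, -1, 0]

/-- A matrix is interior if it is congruent to `diag(1, −ε, 0)` for some nonsquare `ε`. -/
def Interior {F : Type*} [Field F] (M : Matrix (Fin 3) (Fin 3) F) : Prop :=
  ∃ (A : Matrix (Fin 3) (Fin 3) F) (ε : F), IsUnit A ∧ ¬ IsSquare ε ∧
    A * M * Aᵀ = diagonal ![1, -ε, 0]

/-- `S` has point-orbit distribution `[n₁, n₂, n₃, n₄]`: it contains `n₁` rank-1 points,
`n₂` exterior rank-2 points, `n₃` interior rank-2 points and `n₄` rank-3 points. -/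
def HasPointOrbitDistribution (F : Type*) [Field F] (S : Set (Matrix (Fin 3) (Fin 3) F))
    (n₁ n₂ n₃ n₄ : ℕ) : Prop :=
  ptsWith F S (fun M => M.rank = 1) = n₁ ∧
  ptsWith F S Exterior = n₂ ∧
  ptsWith F S Interior = n₃ ∧
  ptsWith F S (fun M => M.rank = 3) = n₄

/-! ### Rank-one matrices -/

lemma minor_eq_zero_of_rank_eq_one {F : Type*} [Field F] {M : Matrix (Fin 3) (Fin 3) F}
    (h : M.rank = 1) (i j k l : Fin 3) : M i j * M k l = M i l * M k j := by
  by_contra hne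
  have hdet : (M.submatrix ![i, k] ![j, l]).det ≠ 0 := by
    rw [det_fin_two]
    simpa [sub_eq_zero] using hne
  have h2 := rank_of_isUnit _ ((isUnit_iff_isUnit_det _).2 hdet.isUnit)
  have hle := rank_submatrix_le M ![i, k] ![j, l]
  simp only [Fintype.card_fin] at h2
  omega

lemma rank_eq_one_iff_minors {F : Type*} [Field F] {M : Matrix (Fin 3) (Fin 3) F} (hM : M ≠ 0) :
    M.rank = 1 ↔ ∀ i j k l, M i j * M k l = M i l * M k j := by
  refine ⟨minor_eq_zero_of_rank_eq_one, fun h => ?_⟩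
  obtain ⟨i, j, hij⟩ : ∃ i j, M i j ≠ 0 := by
    by_contra! hc
    exact hM (by ext i j; exact hc i j)
  have hv : M = vecMulVec (fun k => M k j / M i j) (fun l => M i l) := by
    ext k l
    rw [vecMulVec_apply, div_mul_eq_mul_div, eq_div_iff hij]
    linear_combination h k l i j
  have hle : M.rank ≤ 1 := by
    rw [hv]
    exact rank_vecMulVec_le _ _
  have hpos : 1 ≤ M.rank := by
    have hdet : (M.submatrix ![i] ![j]).det ≠ 0 := by
      rw [det_fin_one]
      exact hij
    have h1 := rank_of_isUnit _ ((isUnit_iff_isUnit_det _).2 hdet.isUnit)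
    have hle := rank_submatrix_le M ![i] ![j]
    simp only [Fintype.card_fin] at h1
    omega
  omega

lemma rank_eq_three_iff_det {F : Type*} [Field F] {M : Matrix (Fin 3) (Fin 3) F} :
    M.rank = 3 ↔ M.det ≠ 0 := by
  refine ⟨fun h => ?_, fun h => by simpa using rank_of_det_ne_zero h⟩
  have hsurj : Function.Surjective M.mulVec := by
    change Function.Surjective M.mulVecLin
    rw [← LinearMap.range_eq_top]
    apply Submodule.eq_top_of_finrank_eq
    rw [Module.finrank_fin_fun]
    exact h
  exact ((isUnit_iff_isUnit_det M).1 (mulVec_surjective_iff_isUnit.1 hsurj)).ne_zero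

/-! ### Counting points by counting vectors -/

/-- A point `F ∙ M` of the image of an injective linear map is counted by the `q - 1` nonzero
vectors lying over it. -/
lemma ptsWith_mul_card_sub_one {F V : Type*} [Field F] [Fintype F] [AddCommGroup V] [Module F V]
    [Fintype V] (φ : V →ₗ[F] Matrix (Fin 3) (Fin 3) F) (hφ : Function.Injective φ)
    {S : Set (Matrix (Fin 3) (Fin 3) F)} (hS : S = Set.range φ)
    (P : Matrix (Fin 3) (Fin 3) F → Prop) (Q : V → Prop) [DecidablePred Q]
    (hQ : ∀ v, Q v ↔ v ≠ 0 ∧ ∃ l : F, l ≠ 0 ∧ P (l • φ v)) :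
    ptsWith F S P * (Fintype.card F - 1) = (Finset.univ.filter Q).card := by
  classical
  have : Finite (Submodule F (Matrix (Fin 3) (Fin 3) F)) :=
    Finite.of_injective (fun p => (p : Set (Matrix (Fin 3) (Fin 3) F))) SetLike.coe_injective
  have := Fintype.ofFinite (Submodule F (Matrix (Fin 3) (Fin 3) F))
  unfold ptsWith
  rw [Set.ncard_eq_toFinset_card']
  rw [Finset.card_eq_sum_card_fiberwise (f := fun v => Submodule.span F {φ v})
    (t := Set.toFinset {p : Submodule F (Matrix (Fin 3) (Fin 3) F) |
    ↑p ⊆ S ∧ Module.finrank F ↥p = 1 ∧ ∃ M ∈ p, M ≠ 0 ∧ P M})]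
  · rw [Finset.sum_const_nat]
    intro p hp
    simp only [Set.mem_toFinset, Set.mem_ofPred_eq] at hp
    obtain ⟨hpS, hp1, M, hMp, hM0, hPM⟩ := hp
    have hspan : p = Submodule.span F {M} :=
      ((Submodule.span_singleton_le_iff_mem _ _).2 hMp |> Submodule.eq_of_le_of_finrank_eq <|
        by rw [hp1, finrank_span_singleton hM0]).symm
    obtain ⟨v, rfl⟩ : ∃ v, φ v = M := by
      have := hpS hMp
      rwa [hS] at this
    have hv : v ≠ 0 := by
      rintro rfl
      simp at hM0
    rw [← Finset.card_univ, ← Finset.card_erase_of_mem (Finset.mem_univ (0 : F))]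
    symm
    refine Finset.card_bij (fun l _ => l • v) ?_ ?_ ?_
    · intro l hl
      have hl0 : l ≠ 0 := by simpa using hl
      simp only [Finset.mem_filter, Finset.mem_univ, true_and, hQ]
      refine ⟨⟨smul_ne_zero hl0 hv, l⁻¹, inv_ne_zero hl0, ?_⟩, ?_⟩
      · rwa [map_smul, inv_smul_smul₀ hl0]
      · rw [hspan, map_smul]
        exact Submodule.span_singleton_smul_eq hl0.isUnit _
    · intro l _ l' _ h
      exact smul_left_injective F hv h
    · intro w hw
      simp only [Finset.mem_filter, Finset.mem_univ, true_and, hQ] at hw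
      have hmem : φ w ∈ Submodule.span F {φ v} := by
        rw [← hspan, ← hw.2]
        exact Submodule.mem_span_singleton_self _
      obtain ⟨l, hl⟩ := Submodule.mem_span_singleton.1 hmem
      have hlw : l • v = w := hφ (by rw [map_smul, hl])
      refine ⟨l, ?_, hlw⟩
      have : l ≠ 0 := by
        rintro rfl
        exact hw.1.1 (by rw [← hlw, zero_smul])
      simpa using this
  · intro v hv
    simp only [Finset.coe_filter, Finset.mem_univ, true_and, Set.mem_ofPred_eq, hQ] at hv
    obtain ⟨hv, l, hl, hP⟩ := hv
    have hφv : φ v ≠ 0 := (map_ne_zero_iff φ hφ).2 hv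
    simp only [Set.coe_toFinset, Set.mem_ofPred_eq]
    refine ⟨?_, finrank_span_singleton hφv, l • φ v,
      Submodule.smul_mem _ _ (Submodule.mem_span_singleton_self _), smul_ne_zero hl hφv, hP⟩
    intro M hM
    obtain ⟨m, rfl⟩ := Submodule.mem_span_singleton.1 hM
    rw [hS]
    exact ⟨m • v, map_smul _ _ _⟩

/-! ### Counting solutions of quadratic equations -/

section Sums

variable {F : Type*} [Field F] [Fintype F]

lemma sum_affine (f : F → ℕ) (k : F) {m : F} (hm : m ≠ 0) :
    ∑ x, f (k + m * x) = ∑ x, f x :=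
  ((Equiv.mulLeft₀ m hm).trans (Equiv.addLeft k)).sum_comp f

variable [DecidableEq F]

lemma sum_ite_eq_zero_const (X Y : ℕ) :
    ∑ x : F, (if x = 0 then X else Y) = X + (Fintype.card F - 1) * Y := by
  rw [Finset.sum_ite, Finset.filter_eq', Finset.filter_ne']
  simp [Finset.card_erase_of_mem]

lemma sum_sq_sub_mul (f : F → ℕ) :
    ∑ c : F, ∑ b : F, ∑ a : F, f (c ^ 2 - a * b) =
      Fintype.card F * ∑ c, f (c ^ 2) +
        Fintype.card F * (Fintype.card F - 1) * ∑ x, f x := by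
  have hin : ∀ c b : F, ∑ a : F, f (c ^ 2 - a * b) =
      if b = 0 then Fintype.card F * f (c ^ 2) else ∑ x, f x := by
    intro c b
    split_ifs with hb
    · simp [hb]
    · rw [← sum_affine f (c ^ 2) (neg_ne_zero.2 hb)]
      exact Finset.sum_congr rfl fun a _ => by congr 1; ring
  simp only [hin, sum_ite_eq_zero_const, Finset.sum_add_distrib, ← Finset.mul_sum,
    Finset.sum_const, Finset.card_univ, smul_eq_mul]
  ring

lemma sum_mul_eq_zero_ite (f : F → ℕ) (hf : f 0 = 0) :
    ∑ a : F, ∑ b : F, ∑ c : F,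
      (if a * b * c = 0 then f (-(a * b + b * c + c * a)) else 0) =
      3 * (Fintype.card F - 1) * ∑ x, f x := by
  have hin : ∀ a : F, ∑ b : F, ∑ c : F,
      (if a * b * c = 0 then f (-(a * b + b * c + c * a)) else 0) =
      if a = 0 then (Fintype.card F - 1) * ∑ x, f x else 2 * ∑ x, f x := by
    intro a
    split_ifs with ha
    · subst ha
      have : ∀ b : F, ∑ c : F,
          (if 0 * b * c = 0 then f (-(0 * b + b * c + c * 0)) else 0) =
          if b = 0 then 0 else ∑ x, f x := by
        intro b
        split_ifs with hb
        · simp [hb, hf]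
        · rw [← sum_affine f 0 (neg_ne_zero.2 hb)]
          exact Finset.sum_congr rfl fun c _ => by simp
      simp only [this, sum_ite_eq_zero_const, zero_add]
    · have : ∀ b : F, ∑ c : F,
          (if a * b * c = 0 then f (-(a * b + b * c + c * a)) else 0) =
          (if b = 0 then ∑ x, f x else 0) + f (0 + -a * b) := by
        intro b
        split_ifs with hb
        · subst hb
          rw [show f (0 + -a * 0) = 0 by simpa using hf, add_zero, ← sum_affine f 0 (neg_ne_zero.2 ha)]
          exact Finset.sum_congr rfl fun c _ => by simp [mul_comm]
        · simp [ha, hb, Finset.sum_ite_eq']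
      simp only [this, Finset.sum_add_distrib, sum_ite_eq_zero_const,
        sum_affine f 0 (neg_ne_zero.2 ha)]
      ring
  simp only [hin, sum_ite_eq_zero_const]
  ring

end Sums

/-! ### Squares in a finite field of odd order -/

lemma ringChar_ne_two_of_odd_card {F : Type*} [Field F] [Fintype F]
    (hodd : Odd (Fintype.card F)) : ringChar F ≠ 2 := by
  intro h
  have := FiniteField.even_card_iff_char_two.1 h
  rw [Nat.odd_iff] at hodd
  omega

lemma card_squares_and_nonsquares {F : Type*} [Field F] [Fintype F] [DecidableEq F]
    (hF : ringChar F ≠ 2) :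
    2 * (Finset.univ.filter fun x : F => x ≠ 0 ∧ IsSquare x).card + 1 = Fintype.card F ∧
      2 * (Finset.univ.filter fun x : F => ¬ IsSquare x).card + 1 = Fintype.card F := by
  classical
  have hsum := quadraticChar_sum_zero hF
  have hchar : ∀ x : F, quadraticChar F x =
      (if x ≠ 0 ∧ IsSquare x then 1 else 0) - (if ¬ IsSquare x then 1 else 0) := by
    intro x
    by_cases hx : x = 0
    · simp [hx]
    by_cases hs : IsSquare x
    · simp [hx, hs, (quadraticChar_one_iff_isSquare hx).2 hs]
    · simp [hx, hs, quadraticChar_neg_one_iff_not_isSquare.2 hs]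
  simp only [hchar, Finset.sum_sub_distrib, Finset.sum_boole] at hsum
  have htotal : ∑ x : F, ((if x ≠ 0 ∧ IsSquare x then 1 else 0) +
      ((if ¬ IsSquare x then 1 else 0) + if x = 0 then 1 else 0)) = Fintype.card F := by
    rw [← Finset.card_univ, Finset.card_eq_sum_ones]
    refine Finset.sum_congr rfl fun x _ => ?_
    by_cases hx : x = 0
    · simp [hx]
    by_cases hs : IsSquare x <;> simp [hx, hs]
  simp only [Finset.sum_add_distrib, Finset.sum_boole, Finset.filter_eq', Finset.mem_univ,
    if_true, Finset.card_singleton, Nat.cast_id] at htotal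
  omega

/-! ### Congruence to `diag(1, -t, 0)` -/

/-- `M` is congruent to `diag(1, -t, 0)`. -/
def CongruentTo {F : Type*} [Field F] (t : F) (M : Matrix (Fin 3) (Fin 3) F) : Prop :=
  ∃ A : Matrix (Fin 3) (Fin 3) F, IsUnit A ∧ A * M * Aᵀ = diagonal ![1, -t, 0]

section Congruence

variable {F : Type*} [Field F]

lemma CongruentTo.adjugate_apply {t : F} {M : Matrix (Fin 3) (Fin 3) F} (h : CongruentTo t M) :
    ∃ x : Fin 3 → F, ∑ i, ∑ j, x i * M.adjugate i j * x j = -t := by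
  obtain ⟨A, -, h⟩ := h
  have hadj := congrArg (fun N => adjugate N 2 2) h
  simp only [adjugate_mul_distrib, ← adjugate_transpose A] at hadj
  refine ⟨fun i => A.adjugate i 2, ?_⟩
  simp only [mul_apply, transpose_apply, Finset.mul_sum, ← mul_assoc] at hadj
  exact hadj.trans (by rw [adjugate_fin_three]; simp)

lemma CongruentTo.det_eq_zero {t : F} {M : Matrix (Fin 3) (Fin 3) F} (h : CongruentTo t M) :
    M.det = 0 := by
  obtain ⟨A, hA, h⟩ := h
  have hdet := congrArg det h
  have hA0 : A.det ≠ 0 := ((isUnit_iff_isUnit_det A).1 hA).ne_zero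
  simpa [det_diagonal, Fin.prod_univ_three, hA0] using hdet

/-- The linear parametrization of the symmetric matrices with zero third row and column. -/
def blockMap (F : Type*) [Field F] : F × F × F →ₗ[F] Matrix (Fin 3) (Fin 3) F where
  toFun v := !![v.2.2, v.1, 0; v.1, v.2.1, 0; 0, 0, 0]
  map_add' v w := by ext i j; fin_cases i <;> fin_cases j <;> simp
  map_smul' l v := by ext i j; fin_cases i <;> fin_cases j <;> simp

/-- The linear parametrization of the diagonal matrices. -/
def diagMap (F : Type*) [Field F] : F × F × F →ₗ[F] Matrix (Fin 3) (Fin 3) F where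
  toFun v := !![v.1, 0, 0; 0, v.2.1, 0; 0, 0, v.2.2]
  map_add' v w := by ext i j; fin_cases i <;> fin_cases j <;> simp
  map_smul' l v := by ext i j; fin_cases i <;> fin_cases j <;> simp

lemma blockMap_apply (c b a : F) :
    blockMap F (c, b, a) = !![a, c, 0; c, b, 0; 0, 0, 0] := rfl

lemma diagMap_apply (a b c : F) :
    diagMap F (a, b, c) = !![a, 0, 0; 0, b, 0; 0, 0, c] := rfl

lemma blockMap_injective : Function.Injective (blockMap F) := by
  rintro ⟨c, b, a⟩ ⟨c', b', a'⟩ h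
  have h00 := congrFun (congrFun h 0) 0
  have h01 := congrFun (congrFun h 0) 1
  have h11 := congrFun (congrFun h 1) 1
  simp [blockMap_apply] at h00 h01 h11
  simp [*]

lemma diagMap_injective : Function.Injective (diagMap F) := by
  rintro ⟨a, b, c⟩ ⟨a', b', c'⟩ h
  have h00 := congrFun (congrFun h 0) 0
  have h11 := congrFun (congrFun h 1) 1
  have h22 := congrFun (congrFun h 2) 2
  simp [diagMap_apply] at h00 h11 h22
  simp [*]

lemma range_blockMap :
    {M | ∃ a b c : F, M = !![a, c, 0; c, b, 0; 0, 0, 0]} = Set.range (blockMap F) := by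
  ext M
  constructor
  · rintro ⟨a, b, c, rfl⟩
    exact ⟨(c, b, a), rfl⟩
  · rintro ⟨⟨c, b, a⟩, rfl⟩
    exact ⟨a, b, c, rfl⟩

lemma range_diagMap :
    {M | ∃ a b c : F, M = !![a, 0, 0; 0, b, 0; 0, 0, c]} = Set.range (diagMap F) := by
  ext M
  constructor
  · rintro ⟨a, b, c, rfl⟩
    exact ⟨(a, b, c), rfl⟩
  · rintro ⟨⟨a, b, c⟩, rfl⟩
    exact ⟨a, b, c, rfl⟩

lemma diagonal_eq_of (t : F) :
    diagonal ![1, -t, 0] = !![1, 0, 0; 0, -t, 0; 0, 0, 0] := by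
  ext i j
  fin_cases i <;> fin_cases j <;> simp

lemma congruentTo_of_eq {t : F} {M A : Matrix (Fin 3) (Fin 3) F} (hA : A.det ≠ 0)
    (h : A * M * Aᵀ = !![1, 0, 0; 0, -t, 0; 0, 0, 0]) : CongruentTo t M :=
  ⟨A, (isUnit_iff_isUnit_det A).2 hA.isUnit, h.trans (diagonal_eq_of t).symm⟩

lemma exists_congruentTo_smul_blockMap (h2 : (2 : F) ≠ 0) {t : F} (ht : t ≠ 0) (c b a : F) :
    (∃ l : F, l ≠ 0 ∧ CongruentTo t (l • blockMap F (c, b, a))) ↔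
      ∃ s : F, s ≠ 0 ∧ c ^ 2 - a * b = t * s ^ 2 := by
  constructor
  · rintro ⟨l, hl, h⟩
    obtain ⟨x, hx⟩ := h.adjugate_apply
    simp [blockMap_apply, adjugate_fin_three, Fin.sum_univ_three] at hx
    have hx2 : x 2 ≠ 0 := by
      intro h0
      exact ht (by simpa [h0] using hx)
    refine ⟨(l * x 2)⁻¹, inv_ne_zero (mul_ne_zero hl hx2), ?_⟩
    field_simp
    linear_combination -hx
  · rintro ⟨s, hs, h⟩
    by_cases ha : a = 0
    · subst ha
      by_cases hb : b = 0
      · subst hb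
        have hc : c ≠ 0 := by
          rintro rfl
          simp [ht, hs] at h
        refine ⟨(2 * c)⁻¹, inv_ne_zero (mul_ne_zero h2 hc),
          congruentTo_of_eq (A := !![1, 1, 0; c / s, -(c / s), 0; 0, 0, 1]) ?_ ?_⟩
        · have : -(c / s) - c / s ≠ 0 := by
            field_simp
            norm_num [h2, hc, hs]
          simpa [det_fin_three] using this
        · rw [blockMap_apply]
          ext i j
          fin_cases i <;> fin_cases j <;>
            simp [mul_apply, Fin.sum_univ_three] <;> field_simp <;>
              first | ring1 | linear_combination -h | linear_combination -2 * h
      · refine ⟨b⁻¹, inv_ne_zero hb,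
          congruentTo_of_eq (A := !![0, 1, 0; b / s, -(c / s), 0; 0, 0, 1]) ?_ ?_⟩
        · simp [det_fin_three, hb, hs]
        · rw [blockMap_apply]
          ext i j
          fin_cases i <;> fin_cases j <;>
            simp [mul_apply, Fin.sum_univ_three] <;> field_simp <;>
              first | ring1 | linear_combination h | linear_combination -h
    · refine ⟨a⁻¹, inv_ne_zero ha,
        congruentTo_of_eq (A := !![1, 0, 0; -(c / s), a / s, 0; 0, 0, 1]) ?_ ?_⟩
      · simp [det_fin_three, ha, hs]
      · rw [blockMap_apply]
        ext i j
        fin_cases i <;> fin_cases j <;>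
          simp [mul_apply, Fin.sum_univ_three] <;> field_simp <;>
            first | ring1 | linear_combination h | linear_combination -h

lemma exists_congruentTo_smul_diagMap {t : F} (ht : t ≠ 0) (a b c : F) :
    (∃ l : F, l ≠ 0 ∧ CongruentTo t (l • diagMap F (a, b, c))) ↔
      a * b * c = 0 ∧ ∃ s : F, s ≠ 0 ∧ -(a * b + b * c + c * a) = t * s ^ 2 := by
  constructor
  · rintro ⟨l, hl, h⟩
    have hdet := h.det_eq_zero
    obtain ⟨x, hx⟩ := h.adjugate_apply
    simp [diagMap_apply, adjugate_fin_three, Fin.sum_univ_three] at hx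
    simp [diagMap_apply, det_fin_three, hl] at hdet
    refine ⟨by simpa using hdet, ?_⟩
    have key : ∀ y d : F, l ^ 2 * d * y ^ 2 = -t → ∃ s : F, s ≠ 0 ∧ -d = t * s ^ 2 := by
      intro y d hd
      have hy : y ≠ 0 := by
        rintro rfl
        exact ht (by simpa using hd)
      refine ⟨(l * y)⁻¹, inv_ne_zero (mul_ne_zero hl hy), ?_⟩
      field_simp
      linear_combination -hd
    rcases hdet with (rfl | rfl) | rfl
    · exact key (x 0) _ (by linear_combination hx)
    · exact key (x 1) _ (by linear_combination hx)
    · exact key (x 2) _ (by linear_combination hx)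
  · rintro ⟨h0, s, hs, h⟩
    have h0' : (a = 0 ∨ b = 0) ∨ c = 0 := by simpa using h0
    have hts := mul_ne_zero ht (pow_ne_zero 2 hs)
    rcases h0' with (rfl | rfl) | rfl
    · have hb : b ≠ 0 := by rintro rfl; exact hts (by linear_combination -h)
      refine ⟨b⁻¹, inv_ne_zero hb,
        congruentTo_of_eq (A := !![0, 1, 0; 0, 0, b / s; 1, 0, 0]) ?_ ?_⟩
      · simp [det_fin_three, hb, hs]
      · rw [diagMap_apply]
        ext i j
        fin_cases i <;> fin_cases j <;>
          simp [mul_apply, Fin.sum_univ_three] <;> field_simp; linear_combination -h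
    · have ha : a ≠ 0 := by rintro rfl; exact hts (by linear_combination -h)
      refine ⟨a⁻¹, inv_ne_zero ha,
        congruentTo_of_eq (A := !![1, 0, 0; 0, 0, a / s; 0, 1, 0]) ?_ ?_⟩
      · simp [det_fin_three, ha, hs]
      · rw [diagMap_apply]
        ext i j
        fin_cases i <;> fin_cases j <;>
          simp [mul_apply, Fin.sum_univ_three] <;> field_simp; linear_combination -h
    · have ha : a ≠ 0 := by rintro rfl; exact hts (by linear_combination -h)
      refine ⟨a⁻¹, inv_ne_zero ha,
        congruentTo_of_eq (A := !![1, 0, 0; 0, a / s, 0; 0, 0, 1]) ?_ ?_⟩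
      · simp [det_fin_three, ha, hs]
      · rw [diagMap_apply]
        ext i j
        fin_cases i <;> fin_cases j <;>
          simp [mul_apply, Fin.sum_univ_three] <;> field_simp; linear_combination -h

end Congruence

/-! ### Exterior and interior points -/

section Points

variable {F : Type*} [Field F]

lemma exterior_iff_congruentTo {M : Matrix (Fin 3) (Fin 3) F} :
    Exterior M ↔ CongruentTo 1 M := Iff.rfl

lemma interior_iff_congruentTo {M : Matrix (Fin 3) (Fin 3) F} :
    Interior M ↔ ∃ ε : F, ¬ IsSquare ε ∧ CongruentTo ε M :=
  ⟨fun ⟨A, ε, hA, hε, h⟩ => ⟨ε, hε, A, hA, h⟩, fun ⟨ε, hε, A, hA, h⟩ => ⟨A, ε, hA, hε, h⟩⟩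

lemma exists_eq_one_mul_sq_iff {d : F} :
    (∃ s : F, s ≠ 0 ∧ d = 1 * s ^ 2) ↔ d ≠ 0 ∧ IsSquare d := by
  constructor
  · rintro ⟨s, hs, rfl⟩
    exact ⟨by simpa using hs, s, by ring⟩
  · rintro ⟨hd, s, rfl⟩
    exact ⟨s, by simpa using hd, by ring⟩

lemma exists_nonsquare_mul_sq_iff {d : F} :
    (∃ ε : F, ¬ IsSquare ε ∧ ∃ s : F, s ≠ 0 ∧ d = ε * s ^ 2) ↔ ¬ IsSquare d := by
  constructor
  · rintro ⟨ε, hε, s, hs, rfl⟩ ⟨r, hr⟩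
    refine hε ⟨r / s, ?_⟩
    field_simp
    linear_combination hr
  · exact fun hd => ⟨d, hd, 1, one_ne_zero, by ring⟩

variable {V : Type*} [AddCommGroup V] [Module F V] {φ : V →ₗ[F] Matrix (Fin 3) (Fin 3) F}
  {Z : V → Prop} {δ : V → F}

lemma exists_exterior_smul_iff
    (hφ : ∀ t : F, t ≠ 0 → ∀ v, (∃ l : F, l ≠ 0 ∧ CongruentTo t (l • φ v)) ↔
      Z v ∧ ∃ s : F, s ≠ 0 ∧ δ v = t * s ^ 2) (hδ : δ 0 = 0) (v : V) :
    Z v ∧ δ v ≠ 0 ∧ IsSquare (δ v) ↔ v ≠ 0 ∧ ∃ l : F, l ≠ 0 ∧ Exterior (l • φ v) := by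
  simp only [exterior_iff_congruentTo, hφ 1 one_ne_zero, exists_eq_one_mul_sq_iff]
  refine ⟨fun h => ⟨?_, h⟩, And.right⟩
  rintro rfl
  exact h.2.1 hδ

lemma exists_interior_smul_iff
    (hφ : ∀ t : F, t ≠ 0 → ∀ v, (∃ l : F, l ≠ 0 ∧ CongruentTo t (l • φ v)) ↔
      Z v ∧ ∃ s : F, s ≠ 0 ∧ δ v = t * s ^ 2) (hδ : δ 0 = 0) (v : V) :
    Z v ∧ ¬ IsSquare (δ v) ↔ v ≠ 0 ∧ ∃ l : F, l ≠ 0 ∧ Interior (l • φ v) := by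
  have hswap : (∃ l : F, l ≠ 0 ∧ Interior (l • φ v)) ↔
      ∃ ε : F, ¬ IsSquare ε ∧ ∃ l : F, l ≠ 0 ∧ CongruentTo ε (l • φ v) := by
    simp only [interior_iff_congruentTo]
    exact ⟨fun ⟨l, hl, ε, hε, h⟩ => ⟨ε, hε, l, hl, h⟩, fun ⟨ε, hε, l, hl, h⟩ => ⟨l, hl, ε, hε, h⟩⟩
  have hiff : (∃ ε : F, ¬ IsSquare ε ∧ ∃ l : F, l ≠ 0 ∧ CongruentTo ε (l • φ v)) ↔
      Z v ∧ ¬ IsSquare (δ v) := by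
    rw [← exists_nonsquare_mul_sq_iff, ← exists_and_left]
    refine exists_congr fun ε => ?_
    rw [and_left_comm]
    refine and_congr_right fun hε => hφ ε ?_ v
    rintro rfl
    exact hε IsSquare.zero
  rw [hswap, hiff]
  refine ⟨fun h => ⟨?_, h⟩, And.right⟩
  rintro rfl
  exact h.2 (hδ ▸ IsSquare.zero)

lemma exists_rank_eq_one_smul_iff (hφ : Function.Injective φ) (v : V) :
    (v ≠ 0 ∧ ∀ i j k l, φ v i j * φ v k l = φ v i l * φ v k j) ↔
      v ≠ 0 ∧ ∃ l : F, l ≠ 0 ∧ (l • φ v).rank = 1 := by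
  refine and_congr_right fun hv => ?_
  have hM : φ v ≠ 0 := (map_ne_zero_iff φ hφ).2 hv
  rw [← rank_eq_one_iff_minors hM]
  refine ⟨fun h => ⟨1, one_ne_zero, by rwa [one_smul]⟩, fun ⟨l, hl, h⟩ => ?_⟩
  rwa [rank_smul_of_mem_nonZeroDivisors _ (mem_nonZeroDivisors_of_ne_zero hl)] at h

lemma exists_rank_eq_three_smul_iff (v : V) :
    (φ v).det ≠ 0 ↔ v ≠ 0 ∧ ∃ l : F, l ≠ 0 ∧ (l • φ v).rank = 3 := by
  rw [← rank_eq_three_iff_det]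
  refine ⟨fun h => ⟨?_, 1, one_ne_zero, by rwa [one_smul]⟩, fun ⟨_, l, hl, h⟩ => ?_⟩
  · rintro rfl
    simp at h
  · rwa [rank_smul_of_mem_nonZeroDivisors _ (mem_nonZeroDivisors_of_ne_zero hl)] at h

end Points

/-! ### Counting triples -/

section Triples

lemma card_filter_triple {F : Type*} [Fintype F] (p : F × F × F → Prop) [DecidablePred p] :
    (Finset.univ.filter p).card = ∑ x, ∑ y, ∑ z, if p (x, y, z) then 1 else 0 := by
  rw [Finset.card_filter]
  simp only [Fintype.sum_prod_type]

variable {F : Type*} [Field F] [Fintype F] [DecidableEq F]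

lemma card_filter_sq_sub_mul (R : F → Prop) [DecidablePred R] :
    (Finset.univ.filter fun v : F × F × F => R (v.1 ^ 2 - v.2.2 * v.2.1)).card =
      Fintype.card F * (Finset.univ.filter fun c : F => R (c ^ 2)).card +
        Fintype.card F * (Fintype.card F - 1) * (Finset.univ.filter R).card := by
  rw [card_filter_triple, Finset.card_filter, Finset.card_filter]
  exact sum_sq_sub_mul fun x => if R x then 1 else 0

lemma card_filter_mul_eq_zero_and (R : F → Prop) [DecidablePred R] (hR : ¬ R 0) :
    (Finset.univ.filter fun v : F × F × F => v.1 * v.2.1 * v.2.2 = 0 ∧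
      R (-(v.1 * v.2.1 + v.2.1 * v.2.2 + v.2.2 * v.1))).card =
      3 * (Fintype.card F - 1) * (Finset.univ.filter R).card := by
  rw [card_filter_triple, Finset.card_filter]
  simp only [ite_and]
  exact sum_mul_eq_zero_ite (fun x => if R x then 1 else 0) (by simp [hR])

lemma card_filter_one_ne_zero :
    (Finset.univ.filter fun v : F × F × F =>
      v ≠ 0 ∧ v.1 * v.2.1 = 0 ∧ v.2.1 * v.2.2 = 0 ∧ v.2.2 * v.1 = 0).card =
      3 * (Fintype.card F - 1) := by
  rw [card_filter_triple]
  have hin : ∀ a b : F, (∑ c : F, if ((a, b, c) : F × F × F) ≠ 0 ∧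
      a * b = 0 ∧ b * c = 0 ∧ c * a = 0 then 1 else 0) =
      if a = 0 then (if b = 0 then Fintype.card F - 1 else 1) else if b = 0 then 1 else 0 := by
    intro a b
    rw [← Finset.card_filter]
    by_cases ha : a = 0 <;> by_cases hb : b = 0 <;>
      simp [ha, hb, Finset.filter_ne', Finset.filter_eq', Finset.card_erase_of_mem]
  simp only [hin]
  have hout : ∀ a : F, (∑ b : F, if a = 0 then (if b = 0 then Fintype.card F - 1 else 1)
      else if b = 0 then 1 else 0) = if a = 0 then 2 * (Fintype.card F - 1) else 1 := by
    intro a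
    split_ifs
    · rw [sum_ite_eq_zero_const]
      ring
    · rw [sum_ite_eq_zero_const]
      ring
  simp only [hout, sum_ite_eq_zero_const]
  ring

lemma card_filter_mul_ne_zero :
    (Finset.univ.filter fun v : F × F × F => v.1 * v.2.1 * v.2.2 ≠ 0).card =
      (Fintype.card F - 1) ^ 3 := by
  rw [card_filter_triple]
  have hin : ∀ a b c : F, (if a * b * c ≠ 0 then 1 else 0) =
      (if a = 0 then 0 else 1) * ((if b = 0 then 0 else 1) * (if c = 0 then 0 else 1)) := by
    intro a b c
    by_cases ha : a = 0 <;> by_cases hb : b = 0 <;> by_cases hc : c = 0 <;> simp [ha, hb, hc]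
  simp only [hin, ← Finset.mul_sum, ← Finset.sum_mul, sum_ite_eq_zero_const]
  ring

end Triples

/-! ### The two distributions -/

lemma hasPointOrbitDistribution_blockMap {F : Type*} [Field F] [Fintype F] {k : ℕ}
    (hF : ringChar F ≠ 2) (hk : Fintype.card F = 2 * k + 1) (hk0 : 0 < k) :
    HasPointOrbitDistribution F (Set.range (blockMap F))
      (2 * k + 2) ((2 * k + 1) * (k + 1)) ((2 * k + 1) * k) 0 := by
  classical
  have h2 : (2 : F) ≠ 0 := Ring.two_ne_zero hF
  have hq : Fintype.card F - 1 = 2 * k := by omega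
  obtain ⟨hsq, hns⟩ := card_squares_and_nonsquares hF
  have hcongr : ∀ t : F, t ≠ 0 → ∀ v, (∃ l : F, l ≠ 0 ∧ CongruentTo t (l • blockMap F v)) ↔
      True ∧ ∃ s : F, s ≠ 0 ∧ v.1 ^ 2 - v.2.2 * v.2.1 = t * s ^ 2 := by
    rintro t ht ⟨c, b, a⟩
    rw [true_and]
    exact exists_congruentTo_smul_blockMap h2 ht c b a
  refine ⟨?_, ?_, ?_, ?_⟩ <;> apply Nat.eq_of_mul_eq_mul_right (show 0 < 2 * k by omega)
  · have hpts := ptsWith_mul_card_sub_one (blockMap F) blockMap_injective rfl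
      (fun M => M.rank = 1) _ (exists_rank_eq_one_smul_iff blockMap_injective)
    have hset : (Finset.univ.filter fun v : F × F × F => v ≠ 0 ∧
        ∀ i j k l, blockMap F v i j * blockMap F v k l = blockMap F v i l * blockMap F v k j) =
        (Finset.univ.filter fun v : F × F × F => v.1 ^ 2 - v.2.2 * v.2.1 = 0).erase 0 := by
      ext ⟨c, b, a⟩
      simp only [Finset.mem_filter, Finset.mem_univ, true_and, Finset.mem_erase]
      refine and_congr_right fun _ => ⟨fun h => ?_, fun h => ?_⟩
      · have := h 0 0 1 1
        simp [blockMap_apply] at this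
        linear_combination -this
      · intro i j k l
        rw [blockMap_apply]
        fin_cases i <;> fin_cases j <;> fin_cases k <;> fin_cases l <;> simp <;>
          first | ring1 | linear_combination h | linear_combination -h
    have hcard := card_filter_sq_sub_mul fun x : F => x = 0
    have hc : (Finset.univ.filter fun c : F => c ^ 2 = 0).card = 1 :=
      Finset.card_eq_one.2 ⟨0, by ext; simp⟩
    have hz : (Finset.univ.filter fun x : F => x = 0).card = 1 :=
      Finset.card_eq_one.2 ⟨0, by ext; simp⟩
    rw [hset, Finset.card_erase_of_mem (by simp), hcard, hc, hz, hq, hk] at hpts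
    rw [hpts]
    have : (2 * k + 1) * 1 + (2 * k + 1) * (2 * k) * 1 = (2 * k + 2) * (2 * k) + 1 := by ring
    omega
  · have hpts := ptsWith_mul_card_sub_one (blockMap F) blockMap_injective rfl
      Exterior _ (exists_exterior_smul_iff hcongr (by simp))
    have hcard := card_filter_sq_sub_mul fun x : F => x ≠ 0 ∧ IsSquare x
    simp only [true_and] at hpts
    have hc : (Finset.univ.filter fun c : F => c ^ 2 ≠ 0 ∧ IsSquare (c ^ 2)).card = 2 * k := by
      simp [IsSquare.sq, Finset.filter_ne', Finset.card_erase_of_mem, hq]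
    have hsk : (Finset.univ.filter fun x : F => x ≠ 0 ∧ IsSquare x).card = k := by omega
    rw [hcard, hc, hsk, hq, hk] at hpts
    rw [hpts]
    ring
  · have hpts := ptsWith_mul_card_sub_one (blockMap F) blockMap_injective rfl
      Interior _ (exists_interior_smul_iff hcongr (by simp))
    have hcard := card_filter_sq_sub_mul fun x : F => ¬ IsSquare x
    simp only [true_and] at hpts
    have hc : (Finset.univ.filter fun c : F => ¬ IsSquare (c ^ 2)).card = 0 := by
      simp [IsSquare.sq]
    have hnk : (Finset.univ.filter fun x : F => ¬ IsSquare x).card = k := by omega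
    rw [hcard, hc, hnk, hq, hk] at hpts
    rw [hpts]
    ring
  · have hpts := ptsWith_mul_card_sub_one (blockMap F) blockMap_injective rfl
      (fun M => M.rank = 3) _ exists_rank_eq_three_smul_iff
    have hdet : ∀ v, (blockMap F v).det = 0 := by
      rintro ⟨c, b, a⟩
      simp [blockMap_apply, det_fin_three]
    rw [hq] at hpts
    rw [hpts]
    simp [hdet]

lemma hasPointOrbitDistribution_diagMap {F : Type*} [Field F] [Fintype F] {k : ℕ}
    (hF : ringChar F ≠ 2) (hk : Fintype.card F = 2 * k + 1) (hk0 : 0 < k) :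
    HasPointOrbitDistribution F (Set.range (diagMap F)) 3 (3 * k) (3 * k) ((2 * k) ^ 2) := by
  classical
  have hq : Fintype.card F - 1 = 2 * k := by omega
  obtain ⟨hsq, hns⟩ := card_squares_and_nonsquares hF
  have hcongr : ∀ t : F, t ≠ 0 → ∀ v, (∃ l : F, l ≠ 0 ∧ CongruentTo t (l • diagMap F v)) ↔
      v.1 * v.2.1 * v.2.2 = 0 ∧
        ∃ s : F, s ≠ 0 ∧ -(v.1 * v.2.1 + v.2.1 * v.2.2 + v.2.2 * v.1) = t * s ^ 2 := by
    rintro t ht ⟨a, b, c⟩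
    exact exists_congruentTo_smul_diagMap ht a b c
  refine ⟨?_, ?_, ?_, ?_⟩ <;> apply Nat.eq_of_mul_eq_mul_right (show 0 < 2 * k by omega)
  · have hpts := ptsWith_mul_card_sub_one (diagMap F) diagMap_injective rfl
      (fun M => M.rank = 1) _ (exists_rank_eq_one_smul_iff diagMap_injective)
    have hset : (Finset.univ.filter fun v : F × F × F => v ≠ 0 ∧
        ∀ i j k l, diagMap F v i j * diagMap F v k l = diagMap F v i l * diagMap F v k j) =
        Finset.univ.filter fun v : F × F × F =>
          v ≠ 0 ∧ v.1 * v.2.1 = 0 ∧ v.2.1 * v.2.2 = 0 ∧ v.2.2 * v.1 = 0 := by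
      ext ⟨a, b, c⟩
      simp only [Finset.mem_filter, Finset.mem_univ, true_and]
      refine and_congr_right fun _ => ⟨fun h => ?_, fun ⟨hab, hbc, hca⟩ => ?_⟩
      · have h01 := h 0 0 1 1
        have h12 := h 1 1 2 2
        have h20 := h 2 2 0 0
        simp only [diagMap_apply] at h01 h12 h20
        exact ⟨by simpa using h01, by simpa using h12, by simpa using h20⟩
      · intro i j k l
        rw [diagMap_apply]
        fin_cases i <;> fin_cases j <;> fin_cases k <;> fin_cases l <;> simp <;>
          first
          | ring1
          | simpa using hab
          | simpa using hbc
          | simpa using hca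
          | simpa [or_comm] using hab
          | simpa [or_comm] using hbc
          | simpa [or_comm] using hca
    rw [hset, card_filter_one_ne_zero, hq] at hpts
    exact hpts
  · have hpts := ptsWith_mul_card_sub_one (diagMap F) diagMap_injective rfl
      Exterior _ (exists_exterior_smul_iff hcongr (by simp))
    have hsk : (Finset.univ.filter fun x : F => x ≠ 0 ∧ IsSquare x).card = k := by omega
    rw [card_filter_mul_eq_zero_and (fun x : F => x ≠ 0 ∧ IsSquare x) (by simp), hsk, hq] at hpts
    rw [hpts]
    ring
  · have hpts := ptsWith_mul_card_sub_one (diagMap F) diagMap_injective rfl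
      Interior _ (exists_interior_smul_iff hcongr (by simp))
    have hnk : (Finset.univ.filter fun x : F => ¬ IsSquare x).card = k := by omega
    rw [card_filter_mul_eq_zero_and (fun x : F => ¬ IsSquare x) (by simp), hnk, hq] at hpts
    rw [hpts]
    ring
  · have hpts := ptsWith_mul_card_sub_one (diagMap F) diagMap_injective rfl
      (fun M => M.rank = 3) _ exists_rank_eq_three_smul_iff
    have hdet : ∀ v, (diagMap F v).det = v.1 * v.2.1 * v.2.2 := by
      rintro ⟨a, b, c⟩
      simp [diagMap_apply, det_fin_three]
    simp only [hdet] at hpts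
    rw [card_filter_mul_ne_zero, hq] at hpts
    rw [hpts]
    ring

/-- The plane `Σ₁` representative (symmetric matrices with third row and column zero) has
point-orbit distribution `[q+1, q(q+1)/2, q(q−1)/2, 0]`, and the plane `Σ₂` representative
(diagonal matrices) has point-orbit distribution `[3, 3(q−1)/2, 3(q−1)/2, (q−1)²]`. -/
theorem distribution_Sigma1_Sigma2 (F : Type*) [Field F] [Fintype F]
    (hodd : Odd (Fintype.card F)) :
    HasPointOrbitDistribution F
      {M | ∃ a b c : F, M = !![a, c, 0; c, b, 0; 0, 0, 0]}
      (Fintype.card F + 1)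
      (Fintype.card F * (Fintype.card F + 1) / 2)
      (Fintype.card F * (Fintype.card F - 1) / 2)
      0 ∧
    HasPointOrbitDistribution F
      {M | ∃ a b c : F, M = !![a, 0, 0; 0, b, 0; 0, 0, c]}
      3
      (3 * (Fintype.card F - 1) / 2)
      (3 * (Fintype.card F - 1) / 2)
      ((Fintype.card F - 1) ^ 2) := by
  obtain ⟨k, hk⟩ := hodd
  have hF := ringChar_ne_two_of_odd_card ⟨k, hk⟩
  have hk0 : 0 < k := by
    have := Fintype.one_lt_card (α := F)
    omega
  have hblock := hasPointOrbitDistribution_blockMap hF hk hk0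
  have hdiag := hasPointOrbitDistribution_diagMap hF hk hk0
  rw [range_blockMap, range_diagMap, hk, Nat.add_sub_cancel,
    show (2 * k + 1) * (2 * k + 1 + 1) / 2 = (2 * k + 1) * (k + 1) by
      rw [show (2 * k + 1) * (2 * k + 1 + 1) = (2 * k + 1) * (k + 1) * 2 by ring]
      simp,
    show (2 * k + 1) * (2 * k) / 2 = (2 * k + 1) * k by
      rw [show (2 * k + 1) * (2 * k) = (2 * k + 1) * k * 2 by ring]
      simp,
    show 3 * (2 * k) / 2 = 3 * k by omega]
  exact ⟨hblock, hdiag⟩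
end

section
/- Let q be an odd prime power and F = F_q. The subspace W₄ = {[[a,0,c],[0,b,c],[c,c,0]] : a,b,c ∈ F} of Sym₃(F) (a representative of the orbit Σ₄) has point-orbit distribution [2, (3q−1)/2, (q−1)/2, q²−q]. -/
open Matrix

namespace Sigma4

open Finset

variable {F : Type*} [Field F]

/-- The general matrix of the plane `Σ₄`. -/
def planeMatrix (a b c : F) : Matrix (Fin 3) (Fin 3) F := !![a, 0, c; 0, b, c; c, c, 0]

lemma smul_planeMatrix (k a b c : F) :
    k • planeMatrix a b c = planeMatrix (k * a) (k * b) (k * c) := by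
  simp [planeMatrix]

lemma planeMatrix_inj {a b c a' b' c' : F} :
    planeMatrix a b c = planeMatrix a' b' c' ↔ a = a' ∧ b = b' ∧ c = c' := by
  constructor
  · intro h
    exact ⟨by simpa [planeMatrix] using congr_fun₂ h 0 0,
      by simpa [planeMatrix] using congr_fun₂ h 1 1,
      by simpa [planeMatrix] using congr_fun₂ h 0 2⟩
  · rintro ⟨rfl, rfl, rfl⟩
    rfl

lemma planeMatrix_eq_zero_iff {a b c : F} :
    planeMatrix a b c = 0 ↔ a = 0 ∧ b = 0 ∧ c = 0 := by
  have h : planeMatrix (0 : F) 0 0 = 0 := by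
    ext i j; fin_cases i <;> fin_cases j <;> rfl
  rw [← h, planeMatrix_inj]

lemma planeMatrix_zero_right (a b : F) : planeMatrix a b 0 = diagonal ![a, b, 0] := by
  ext i j; fin_cases i <;> fin_cases j <;> rfl

lemma det_planeMatrix (a b c : F) : (planeMatrix a b c).det = -(c ^ 2 * (a + b)) := by
  simp [planeMatrix, det_fin_three]; ring

/-- The coordinates `(a, b, c)` of a normalised spanning matrix of each point of the plane. -/
def rep : (F × F) ⊕ F ⊕ Unit → F × F × F
  | .inl (a, b) => (a, b, 1)
  | .inr (.inl b) => (1, b, 0)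
  | .inr (.inr _) => (0, 1, 0)

lemma exists_smul_rep (a b c : F) (h : ¬ (a = 0 ∧ b = 0 ∧ c = 0)) :
    ∃ i : (F × F) ⊕ F ⊕ Unit, ∃ k : F, k ≠ 0 ∧ rep i = (k * a, k * b, k * c) := by
  by_cases hc : c = 0
  · by_cases ha : a = 0
    · have hb : b ≠ 0 := fun hb => h ⟨ha, hb, hc⟩
      exact ⟨.inr (.inr ()), b⁻¹, inv_ne_zero hb, by simp [rep, ha, hc, hb]⟩
    · exact ⟨.inr (.inl (a⁻¹ * b)), a⁻¹, inv_ne_zero ha, by simp [rep, hc, ha]⟩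
  · exact ⟨.inl (c⁻¹ * a, c⁻¹ * b), c⁻¹, inv_ne_zero hc, by simp [rep, hc]⟩

lemma rep_ne_zero (i : (F × F) ⊕ F ⊕ Unit) :
    planeMatrix (rep i).1 (rep i).2.1 (rep i).2.2 ≠ 0 := by
  rw [Ne, planeMatrix_eq_zero_iff]
  rcases i with ⟨a, b⟩ | b | u <;> simp [rep]

lemma eq_of_rep_eq_mul {i j : (F × F) ⊕ F ⊕ Unit} {k : F}
    (h : rep i = (k * (rep j).1, k * (rep j).2.1, k * (rep j).2.2)) : i = j := by
  rcases i with ⟨a, b⟩ | b | u <;> rcases j with ⟨a', b'⟩ | b' | u' <;>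
    simp [rep] at h ⊢ <;> grind

open Classical in
/-- Counting the points of the plane with a given property through normalised coordinates. -/
lemma ptsWith_eq_sum [Fintype F] (P : Matrix (Fin 3) (Fin 3) F → Prop) (R : F → F → F → Prop)
    (hPR : ∀ a b c, planeMatrix a b c ≠ 0 → (P (planeMatrix a b c) ↔ R a b c))
    (hR : ∀ k a b c, k ≠ 0 → R a b c → R (k * a) (k * b) (k * c)) :
    ptsWith F {M | ∃ a b c : F, M = !![a, 0, c; 0, b, c; c, c, 0]} P =
      (∑ a : F, ∑ b : F, if R a b 1 then 1 else 0) + ((∑ b : F, if R 1 b 0 then 1 else 0) +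
        if R 0 1 0 then 1 else 0) := by
  let g : (F × F) ⊕ F ⊕ Unit → Matrix (Fin 3) (Fin 3) F :=
    fun i => planeMatrix (rep i).1 (rep i).2.1 (rep i).2.2
  let s : Set ((F × F) ⊕ F ⊕ Unit) := {i | R (rep i).1 (rep i).2.1 (rep i).2.2}
  have hset : {p : Submodule F (Matrix (Fin 3) (Fin 3) F) |
      ↑p ⊆ {M | ∃ a b c : F, M = !![a, 0, c; 0, b, c; c, c, 0]} ∧
      Module.finrank F ↥p = 1 ∧ ∃ M ∈ p, M ≠ 0 ∧ P M} =
      (fun i => Submodule.span F {g i}) '' s := by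
    ext p
    constructor
    · rintro ⟨hp, hfin, M, hM, hM0, hPM⟩
      obtain ⟨a, b, c, rfl⟩ := hp hM
      change planeMatrix a b c ∈ p at hM
      change planeMatrix a b c ≠ 0 at hM0
      obtain ⟨i, k, hk, hi⟩ := exists_smul_rep a b c (by rwa [← planeMatrix_eq_zero_iff])
      have hgi : g i = k • planeMatrix a b c := by
        simp only [g, hi, smul_planeMatrix]
      refine ⟨i, ?_, ?_⟩
      · simp only [s, Set.mem_ofPred_eq, hi]
        exact hR k a b c hk ((hPR a b c hM0).1 hPM)
      · refine Submodule.eq_of_le_of_finrank_eq ?_ ?_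
        · rw [Submodule.span_singleton_le_iff_mem, hgi]
          exact p.smul_mem k hM
        · rw [finrank_span_singleton (rep_ne_zero i), hfin]
    · rintro ⟨i, hi, rfl⟩
      refine ⟨?_, finrank_span_singleton (rep_ne_zero i), g i,
        Submodule.mem_span_singleton_self _, rep_ne_zero i, (hPR _ _ _ (rep_ne_zero i)).2 hi⟩
      intro M hM
      obtain ⟨k, rfl⟩ := Submodule.mem_span_singleton.1 hM
      exact ⟨_, _, _, smul_planeMatrix _ _ _ _⟩
  have hinj : Function.Injective (fun i => Submodule.span F {g i}) := by
    intro i j hij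
    have : g i ∈ Submodule.span F {g j} := by
      rw [← show Submodule.span F {g i} = Submodule.span F {g j} from hij]
      exact Submodule.mem_span_singleton_self _
    obtain ⟨k, hk⟩ := Submodule.mem_span_singleton.1 this
    simp only [g, smul_planeMatrix, planeMatrix_inj] at hk
    exact eq_of_rep_eq_mul (k := k) (by ext <;> simp [hk])
  rw [ptsWith, hset, Set.ncard_image_of_injective _ hinj, Set.ncard_eq_toFinset_card',
    Set.toFinset_ofPred, card_filter, Fintype.sum_sum_type, Fintype.sum_sum_type,
    Fintype.sum_prod_type]
  simp only [rep, univ_unique, sum_singleton]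
  congr!

/-- A `2 × 2` minor of a congruent copy of a degenerate diagonal matrix. -/
lemma minor_congr_diagonal (A : Matrix (Fin 3) (Fin 3) F) (a b : F) :
    (A * planeMatrix a b 0 * Aᵀ) 0 0 * (A * planeMatrix a b 0 * Aᵀ) 1 1 -
      (A * planeMatrix a b 0 * Aᵀ) 0 1 * (A * planeMatrix a b 0 * Aᵀ) 1 0 =
      a * b * (A 0 0 * A 1 1 - A 0 1 * A 1 0) ^ 2 := by
  simp [planeMatrix, mul_apply, Fin.sum_univ_three]; ring

/-- A `2 × 2` minor of a congruent copy of a singular nondiagonal matrix of the plane; the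
square is that of the determinant of two rows of `A` and the kernel vector `(c, -c, -a)`. -/
lemma minor_congr_of_neg (A : Matrix (Fin 3) (Fin 3) F) (a c : F) :
    (A * planeMatrix a (-a) c * Aᵀ) 0 0 * (A * planeMatrix a (-a) c * Aᵀ) 1 1 -
      (A * planeMatrix a (-a) c * Aᵀ) 0 1 * (A * planeMatrix a (-a) c * Aᵀ) 1 0 =
      -(!![A 0 0, A 0 1, A 0 2; A 1 0, A 1 1, A 1 2; c, -c, -a].det) ^ 2 := by
  simp [planeMatrix, mul_apply, Fin.sum_univ_three, det_fin_three]; ring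

lemma singular_of_congr {A : Matrix (Fin 3) (Fin 3) F} {a b c d : F} (hA : IsUnit A)
    (h : A * planeMatrix a b c * Aᵀ = diagonal ![1, d, 0]) : c = 0 ∨ a + b = 0 := by
  have hdet := congr_arg det h
  rw [det_mul, det_mul, det_transpose, det_planeMatrix, det_diagonal] at hdet
  have hA' : A.det ≠ 0 := ((isUnit_iff_isUnit_det A).1 hA).ne_zero
  simpa [Fin.prod_univ_three, hA'] using hdet

lemma exterior_planeMatrix_iff (h2 : (2 : F) ≠ 0) (a b c : F) :
    Exterior (planeMatrix a b c) ↔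
      c ≠ 0 ∧ a + b = 0 ∨ c = 0 ∧ a ≠ 0 ∧ b ≠ 0 ∧ IsSquare (-(a * b)) := by
  constructor
  · rintro ⟨A, hA, h⟩
    by_cases hc : c = 0
    · subst hc
      have hm := minor_congr_diagonal A a b
      rw [h] at hm
      simp at hm
      generalize A 0 0 * A 1 1 - A 0 1 * A 1 0 = d at hm
      have hd : d ≠ 0 := by rintro rfl; simp at hm
      refine .inr ⟨rfl, ?_, ?_, d⁻¹, ?_⟩
      · rintro rfl; simp at hm
      · rintro rfl; simp at hm
      · field_simp; linear_combination hm
    · exact .inl ⟨hc, (singular_of_congr hA h).resolve_left hc⟩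
  · rintro (⟨hc, hab⟩ | ⟨rfl, ha, hb, s, hs⟩)
    · obtain rfl : b = -a := by linear_combination hab
      refine ⟨!![1, 0, (1 - a) / (2 * c); 1, 0, (-1 - a) / (2 * c); c, -c, -a], ?_, ?_⟩
      · rw [isUnit_iff_isUnit_det, isUnit_iff_ne_zero]
        have : det !![1, 0, (1 - a) / (2 * c); 1, 0, (-1 - a) / (2 * c); c, -c, -a] = -1 := by
          simp [det_fin_three]; field_simp; ring
        rw [this]; simp
      · ext i j
        fin_cases i <;> fin_cases j <;>
          simp [planeMatrix, mul_apply, Fin.sum_univ_three] <;> field_simp <;> ring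
    · have hs0 : s ≠ 0 := by rintro rfl; simp_all
      obtain rfl : b = -s ^ 2 / a := by field_simp; linear_combination -hs
      refine ⟨!![(1 + a) / (2 * a), (a - 1) / (2 * s), 0;
        (a - 1) / (2 * a), (a + 1) / (2 * s), 0; 0, 0, 1], ?_, ?_⟩
      · rw [isUnit_iff_isUnit_det, isUnit_iff_ne_zero]
        have : det !![(1 + a) / (2 * a), (a - 1) / (2 * s), 0;
            (a - 1) / (2 * a), (a + 1) / (2 * s), 0; 0, 0, 1] = s⁻¹ := by
          simp [det_fin_three]; field_simp; ring
        rw [this]; exact inv_ne_zero hs0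
      · ext i j
        fin_cases i <;> fin_cases j <;>
          simp [planeMatrix, mul_apply, Fin.sum_univ_three] <;> field_simp <;> ring

lemma exists_mul_sq_add_mul_sq_eq_one [Fintype F] (hodd : Odd (Fintype.card F)) {a b : F}
    (ha : a ≠ 0) (hb : b ≠ 0) : ∃ x y : F, a * x ^ 2 + b * y ^ 2 = 1 := by
  obtain ⟨x, y, h⟩ := FiniteField.exists_root_sum_quadratic
    (f := Polynomial.C a * Polynomial.X ^ 2 + Polynomial.C 0 * Polynomial.X + Polynomial.C (-1))
    (g := Polynomial.C b * Polynomial.X ^ 2 + Polynomial.C 0 * Polynomial.X + Polynomial.C 0)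
    (Polynomial.degree_quadratic ha) (Polynomial.degree_quadratic hb)
    (Nat.odd_iff.1 hodd)
  refine ⟨x, y, ?_⟩
  simp at h
  linear_combination h

lemma interior_planeMatrix_iff [Fintype F] (hodd : Odd (Fintype.card F)) (a b c : F) :
    Interior (planeMatrix a b c) ↔ c = 0 ∧ a ≠ 0 ∧ b ≠ 0 ∧ ¬ IsSquare (-(a * b)) := by
  constructor
  · rintro ⟨A, ε, hA, hε, h⟩
    by_cases hab : a + b = 0
    · obtain rfl : b = -a := by linear_combination hab
      have hm := minor_congr_of_neg A a c
      rw [h] at hm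
      generalize !![A 0 0, A 0 1, A 0 2; A 1 0, A 1 1, A 1 2; c, -c, -a].det = d at hm
      refine (hε ⟨d, ?_⟩).elim
      rw [← sq, ← neg_inj, ← hm]
      simp
    · obtain rfl := (singular_of_congr hA h).resolve_right hab
      have hm := minor_congr_diagonal A a b
      rw [h] at hm
      simp at hm
      generalize A 0 0 * A 1 1 - A 0 1 * A 1 0 = d at hm
      refine ⟨rfl, ?_, ?_, ?_⟩
      · rintro rfl; simp_all
      · rintro rfl; simp_all
      · rintro ⟨r, hr⟩
        exact hε ⟨r * d, by linear_combination -hm + d ^ 2 * hr⟩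
  · rintro ⟨rfl, ha, hb, hsq⟩
    obtain ⟨x, y, hxy⟩ := exists_mul_sq_add_mul_sq_eq_one hodd ha hb
    refine ⟨!![x, y, 0; -b * y, a * x, 0; 0, 0, 1], -(a * b), ?_, hsq, ?_⟩
    · rw [isUnit_iff_isUnit_det, isUnit_iff_ne_zero]
      have : det !![x, y, 0; -b * y, a * x, 0; 0, 0, 1] = 1 := by
        simp [det_fin_three]; linear_combination hxy
      rw [this]; exact one_ne_zero
    · ext i j
      fin_cases i <;> fin_cases j <;> simp [planeMatrix, mul_apply, Fin.sum_univ_three]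
      · linear_combination hxy
      · ring
      · ring
      · linear_combination (a * b) * hxy

lemma rank_planeMatrix_eq_one_iff {a b c : F} (h0 : planeMatrix a b c ≠ 0) :
    (planeMatrix a b c).rank = 1 ↔ c = 0 ∧ (a = 0 ∨ b = 0) := by
  classical
  by_cases hc : c = 0
  · subst hc
    rw [Ne, planeMatrix_eq_zero_iff] at h0
    rw [planeMatrix_zero_right, rank_diagonal, Fintype.card_subtype, card_filter,
      Fin.sum_univ_three]
    by_cases ha : a = 0 <;> by_cases hb : b = 0 <;> simp_all
  · have hsub : ((planeMatrix a b c).submatrix ![0, 2] ![0, 2]).rank = 2 := by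
      rw [rank_of_det_ne_zero]
      · simp
      · rw [det_fin_two]
        simp [planeMatrix, hc]
    have hle := rank_submatrix_le (planeMatrix a b c) ![0, 2] ![0, 2]
    simp only [hc, false_and, iff_false]
    lia

lemma rank_planeMatrix_eq_three_iff (a b c : F) :
    (planeMatrix a b c).rank = 3 ↔ c ≠ 0 ∧ a + b ≠ 0 := by
  have hdet : (planeMatrix a b c).det ≠ 0 ↔ c ≠ 0 ∧ a + b ≠ 0 := by
    simp [det_planeMatrix]
  rw [← hdet]
  constructor
  · intro h
    have htop : LinearMap.range (planeMatrix a b c).mulVecLin = ⊤ :=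
      Submodule.eq_top_of_finrank_eq (by rw [← Matrix.rank, h]; simp)
    have hsurj := LinearMap.range_eq_top.1 htop
    rw [← isUnit_iff_ne_zero, ← isUnit_iff_isUnit_det]
    exact mulVec_surjective_iff_isUnit.1 hsurj
  · intro h
    simp [rank_of_det_ne_zero h]

open Classical in
lemma card_squares_nonsquares [Fintype F] (hodd : Odd (Fintype.card F)) :
    (∑ b : F, if b ≠ 0 ∧ IsSquare b then 1 else 0) = (Fintype.card F - 1) / 2 ∧
      (∑ b : F, if b ≠ 0 ∧ ¬ IsSquare b then 1 else 0) = (Fintype.card F - 1) / 2 := by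
  have hchar : ringChar F ≠ 2 := fun h => by
    have := FiniteField.even_card_iff_char_two.1 h
    have := Nat.odd_iff.1 hodd
    lia
  have hsum := quadraticChar_sum_zero hchar
  have hdiff : (∑ b : F, if b ≠ 0 ∧ IsSquare b then (1 : ℤ) else 0) -
      (∑ b : F, if b ≠ 0 ∧ ¬ IsSquare b then 1 else 0) = 0 := by
    refine Eq.trans ?_ hsum
    rw [← sum_sub_distrib]
    refine sum_congr rfl fun b _ => ?_
    rw [quadraticChar_apply, quadraticCharFun]
    by_cases hb : b = 0 <;> by_cases hs : IsSquare b <;> simp [hb, hs]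
  have htotal : (∑ b : F, if b ≠ 0 ∧ IsSquare b then 1 else 0) +
      (∑ b : F, if b ≠ 0 ∧ ¬ IsSquare b then 1 else 0) + 1 = Fintype.card F := by
    have : (∑ b : F, if b = 0 then 1 else 0) = 1 := by simp
    rw [← this, ← sum_add_distrib, ← sum_add_distrib, Fintype.card_eq_sum_ones]
    refine sum_congr rfl fun b _ => ?_
    by_cases hb : b = 0 <;> by_cases hs : IsSquare b <;> simp [hb, hs]
  have hdiff' : (∑ b : F, if b ≠ 0 ∧ IsSquare b then 1 else 0) =
      (∑ b : F, if b ≠ 0 ∧ ¬ IsSquare b then 1 else 0) := by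
    rw [sub_eq_zero] at hdiff
    exact_mod_cast hdiff
  lia

lemma isSquare_neg_mul_mul {k a b : F} (hk : k ≠ 0) :
    IsSquare (-(k * a * (k * b))) ↔ IsSquare (-(a * b)) := by
  constructor
  · rintro ⟨r, hr⟩
    exact ⟨r / k, by field_simp; linear_combination hr⟩
  · rintro ⟨r, hr⟩
    exact ⟨k * r, by linear_combination k ^ 2 * hr⟩

end Sigma4

/-- The plane `Σ₄` representative has point-orbit distribution
`[2, (3q−1)/2, (q−1)/2, q²−q]`. -/
theorem distribution_Sigma4 (F : Type*) [Field F] [Fintype F]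
    (hodd : Odd (Fintype.card F)) :
    HasPointOrbitDistribution F
      {M | ∃ a b c : F, M = !![a, 0, c; 0, b, c; c, c, 0]}
      2
      ((3 * Fintype.card F - 1) / 2)
      ((Fintype.card F - 1) / 2)
      (Fintype.card F ^ 2 - Fintype.card F) := by
  classical
  have h2 : (2 : F) ≠ 0 := Ring.two_ne_zero fun h => by
    have := FiniteField.even_card_iff_char_two.1 h
    have := Nat.odd_iff.1 hodd
    lia
  obtain ⟨hsq, hnsq⟩ := Sigma4.card_squares_nonsquares hodd
  have hline (a : F) : (∑ b : F, if a + b = 0 then 1 else 0) = 1 := by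
    simp [add_eq_zero_iff_eq_neg']
  refine ⟨?_, ?_, ?_, ?_⟩
  · rw [Sigma4.ptsWith_eq_sum _ (fun a b c => c = 0 ∧ (a = 0 ∨ b = 0))
      (fun a b c h => Sigma4.rank_planeMatrix_eq_one_iff h)
      (fun k a b c hk => by simp [hk])]
    simp
  · rw [Sigma4.ptsWith_eq_sum _ _ (fun a b c _ => Sigma4.exterior_planeMatrix_iff h2 a b c)
      (fun k a b c hk => by
        simp only [Sigma4.isSquare_neg_mul_mul hk, ← mul_add]
        simp [hk])]
    have hneg : (∑ b : F, if b ≠ 0 ∧ IsSquare (-b) then 1 else 0) =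
        (Fintype.card F - 1) / 2 := by
      rw [← hsq]
      exact Fintype.sum_equiv (Equiv.neg F) _ _ (fun b => by simp)
    simp at hneg
    simp [hneg, hline]
    obtain ⟨m, hm⟩ := hodd
    lia
  · rw [Sigma4.ptsWith_eq_sum _ _ (fun a b c _ => Sigma4.interior_planeMatrix_iff hodd a b c)
      (fun k a b c hk => by
        simp only [Sigma4.isSquare_neg_mul_mul hk]
        simp [hk])]
    have hneg : (∑ b : F, if b ≠ 0 ∧ ¬ IsSquare (-b) then 1 else 0) =
        (Fintype.card F - 1) / 2 := by
      rw [← hnsq]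
      exact Fintype.sum_equiv (Equiv.neg F) _ _ (fun b => by simp)
    simp at hneg
    simp [hneg]
  · rw [Sigma4.ptsWith_eq_sum _ _ (fun a b c _ => Sigma4.rank_planeMatrix_eq_three_iff a b c)
      (fun k a b c hk => by
        simp only [← mul_add]
        simp [hk])]
    have hcompl (a : F) : (∑ b : F, if a + b ≠ 0 then 1 else 0) = Fintype.card F - 1 := by
      have : (∑ b : F, if a + b ≠ 0 then 1 else 0) + (∑ b : F, if a + b = 0 then 1 else 0) =
          Fintype.card F := by
        rw [← Finset.sum_add_distrib, Fintype.card_eq_sum_ones]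
        exact Finset.sum_congr rfl fun b _ => by by_cases h : a + b = 0 <;> simp [h]
      rw [hline] at this
      lia
    simp only [ne_eq, one_ne_zero, not_false_eq_true, true_and, not_true, false_and, if_false,
      Finset.sum_const_zero, add_zero]
    simp only [← ne_eq, hcompl]
    simp [sq, Nat.mul_sub]
end
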